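/- arXiv:1802.09938 — 4 statements merged into one kernel-verified Lean document; each statement's English description precedes it below -/
import Mathlib

section
/- The Gelfand–Tsetlin variety GTs for Y_1(gl_3) equals C_1 ∪ C_2 ∪ ⋯ ∪ C_7, where C_1 := Z(X_{11}, X_{22}, X_{12}, X_{33}, X_{23}, X_{13}), C_2 := Z(X_{11}, X_{22}, X_{12}, X_{33}, X_{32}, X_{13}), C_3 := Z(X_{11}, X_{22}, X_{12}, X_{33}, X_{13}X_{31} + X_{23}X_{32}, X_{21}), C_4 := Z(X_{11}, X_{22}, X_{12}, X_{33}, X_{31}, X_{32}), C_5 := Z(X_{11}, X_{22}, X_{21}, X_{33}, X_{13}, X_{23}), C_6 := Z(X_{11}, X_{22}, X_{21}, X_{33}, X_{31}, X_{23}), C_7 := Z(X_{11}, X_{22}, X_{21}, X_{33}, X_{32}, X_{31}); each C_i is irreducible of Krull dimension 3, the C_i are precisely the irreducible components of GTs, and consequently GTs is equidimensional of dimension 3. -/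
open scoped Classical

noncomputable section



/-- The Zariski topology on affine space `σ → k`: generated by complements of
hypersurfaces. -/
def zariskiTopology (k : Type*) [CommRing k] (σ : Type*) : TopologicalSpace (σ → k) :=
  TopologicalSpace.generateFrom
    {U | ∃ f : MvPolynomial σ k, U = {x | MvPolynomial.eval x f ≠ 0}}

/-- The irreducible components of a subset `V` of affine space, with respect to the
subspace topology induced by the Zariski topology. -/
def zComponents (k : Type*) [CommRing k] (σ : Type*) (V : Set (σ → k)) : Set (Set V) :=
  @irreducibleComponents V (TopologicalSpace.induced Subtype.val (zariskiTopology k σ))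

/-- The topological Krull dimension of a subset `C` of a subset `V` of affine space
(with the topology induced from the Zariski topology). -/
def zKrullDimSub (k : Type*) [CommRing k] (σ : Type*) {V : Set (σ → k)} (C : Set V) :
    WithBot ℕ∞ :=
  @topologicalKrullDim C (TopologicalSpace.induced Subtype.val
    (TopologicalSpace.induced Subtype.val (zariskiTopology k σ)))

/-- The topological Krull dimension of a subset of affine space with the Zariski topology. -/
def zKrullDim (k : Type*) [CommRing k] (σ : Type*) (V : Set (σ → k)) : WithBot ℕ∞ :=
  @topologicalKrullDim V (TopologicalSpace.induced Subtype.val (zariskiTopology k σ))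

/-- Irreducibility of a subset of affine space with the Zariski topology. -/
def zIsIrreducible (k : Type*) [CommRing k] (σ : Type*) (V : Set (σ → k)) : Prop :=
  @IsIrreducible _ (zariskiTopology k σ) V

/-- A subset of affine space is equidimensional of dimension `d` if each of its
irreducible components (w.r.t. the Zariski topology) has Krull dimension `d`. -/
def IsEquidimOfDim (k : Type*) [CommRing k] (σ : Type*) (V : Set (σ → k)) (d : ℕ) : Prop :=
  ∀ C ∈ zComponents k σ V, zKrullDimSub k σ C = (d : WithBot ℕ∞)


/-- The Gelfand–Tsetlin variety for `gl_n`: the set of `n × n` matrices `x` such that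
`tr((x_i)^j) = 0` for all `1 ≤ j ≤ i ≤ n`, where `x_i` is the `i`-th leading principal
submatrix of `x`. -/
def GTgl (k : Type*) [CommRing k] (n : ℕ) : Set (Fin n × Fin n → k) :=
  {x | ∀ (i : ℕ) (hi : i ≤ n) (j : ℕ), 1 ≤ j → j ≤ i →
    Matrix.trace ((Matrix.of fun a b : Fin i => x (Fin.castLE hi a, Fin.castLE hi b)) ^ j) = 0}

/- The seven sets `C₁, …, C₇` (coordinates `x (a, b)` are `0`-indexed: `x (a, b)` is the
matrix entry `X_{a+1, b+1}`). -/

/-- `C₁ = V(X₁₁, X₂₂, X₁₂, X₃₃, X₂₃, X₁₃)`. -/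
def GT3C1 (k : Type*) [CommRing k] : Set (Fin 3 × Fin 3 → k) :=
  {x | x (0, 0) = 0 ∧ x (1, 1) = 0 ∧ x (0, 1) = 0 ∧ x (2, 2) = 0 ∧ x (1, 2) = 0 ∧ x (0, 2) = 0}

/-- `C₂ = V(X₁₁, X₂₂, X₁₂, X₃₃, X₃₂, X₁₃)`. -/
def GT3C2 (k : Type*) [CommRing k] : Set (Fin 3 × Fin 3 → k) :=
  {x | x (0, 0) = 0 ∧ x (1, 1) = 0 ∧ x (0, 1) = 0 ∧ x (2, 2) = 0 ∧ x (2, 1) = 0 ∧ x (0, 2) = 0}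

/-- `C₃ = V(X₁₁, X₂₂, X₁₂, X₃₃, X₁₃X₃₁ + X₂₃X₃₂, X₂₁)`. -/
def GT3C3 (k : Type*) [CommRing k] : Set (Fin 3 × Fin 3 → k) :=
  {x | x (0, 0) = 0 ∧ x (1, 1) = 0 ∧ x (0, 1) = 0 ∧ x (2, 2) = 0 ∧
    x (0, 2) * x (2, 0) + x (1, 2) * x (2, 1) = 0 ∧ x (1, 0) = 0}

/-- `C₄ = V(X₁₁, X₂₂, X₁₂, X₃₃, X₃₁, X₃₂)`. -/
def GT3C4 (k : Type*) [CommRing k] : Set (Fin 3 × Fin 3 → k) :=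
  {x | x (0, 0) = 0 ∧ x (1, 1) = 0 ∧ x (0, 1) = 0 ∧ x (2, 2) = 0 ∧ x (2, 0) = 0 ∧ x (2, 1) = 0}

/-- `C₅ = V(X₁₁, X₂₂, X₂₁, X₃₃, X₁₃, X₂₃)`. -/
def GT3C5 (k : Type*) [CommRing k] : Set (Fin 3 × Fin 3 → k) :=
  {x | x (0, 0) = 0 ∧ x (1, 1) = 0 ∧ x (1, 0) = 0 ∧ x (2, 2) = 0 ∧ x (0, 2) = 0 ∧ x (1, 2) = 0}

/-- `C₆ = V(X₁₁, X₂₂, X₂₁, X₃₃, X₃₁, X₂₃)`. -/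
def GT3C6 (k : Type*) [CommRing k] : Set (Fin 3 × Fin 3 → k) :=
  {x | x (0, 0) = 0 ∧ x (1, 1) = 0 ∧ x (1, 0) = 0 ∧ x (2, 2) = 0 ∧ x (2, 0) = 0 ∧ x (1, 2) = 0}

/-- `C₇ = V(X₁₁, X₂₂, X₂₁, X₃₃, X₃₂, X₃₁)`. -/
def GT3C7 (k : Type*) [CommRing k] : Set (Fin 3 × Fin 3 → k) :=
  {x | x (0, 0) = 0 ∧ x (1, 1) = 0 ∧ x (1, 0) = 0 ∧ x (2, 2) = 0 ∧ x (2, 1) = 0 ∧ x (2, 0) = 0}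

open Topology TopologicalSpace in
theorem aux_pp_inducing (k : Type*) [Field k] (σ : Type*) :
    zariskiTopology k σ = TopologicalSpace.induced
      (MvPolynomial.pointToPoint (k := k) (K := k) (σ := σ)) inferInstance := by
  rw [PrimeSpectrum.isTopologicalBasis_basic_opens.eq_generateFrom, induced_generateFrom_eq]
  unfold zariskiTopology
  congr 1
  ext U
  simp only [Set.mem_ofPred_eq, Set.mem_image, Set.mem_range]
  have key : ∀ f : MvPolynomial σ k, (MvPolynomial.pointToPoint (k := k) (K := k) (σ := σ)) ⁻¹'
      (PrimeSpectrum.basicOpen f : Set (PrimeSpectrum (MvPolynomial σ k))) =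
      {x | MvPolynomial.eval x f ≠ 0} := by
    intro f
    ext x
    simp only [Set.mem_preimage, SetLike.mem_coe, PrimeSpectrum.mem_basicOpen,
      MvPolynomial.pointToPoint, MvPolynomial.mem_vanishingIdeal_singleton_iff, Set.mem_ofPred_eq]
    rfl
  constructor
  · rintro ⟨f, rfl⟩
    exact ⟨_, ⟨f, rfl⟩, key f⟩
  · rintro ⟨_, ⟨f, rfl⟩, rfl⟩
    exact ⟨f, key f⟩

open Topology in
theorem aux_irr_of_inducing {X Y : Type*} [TopologicalSpace X] [TopologicalSpace Y] {f : X → Y}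
    (hf : IsInducing f) {s : Set X} (h : IsIrreducible (f '' s)) : IsIrreducible s := by
  refine ⟨h.1.of_image, ?_⟩
  intro u v hu hv hsu hsv
  obtain ⟨u', hu', rfl⟩ := hf.isOpen_iff.1 hu
  obtain ⟨v', hv', rfl⟩ := hf.isOpen_iff.1 hv
  obtain ⟨x, hx, hxu⟩ := hsu
  obtain ⟨y, hy, hyv⟩ := hsv
  obtain ⟨_, ⟨z, hz, rfl⟩, h1, h2⟩ := h.2 u' v' hu' hv' ⟨f x, ⟨x, hx, rfl⟩, hxu⟩
    ⟨f y, ⟨y, hy, rfl⟩, hyv⟩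
  exact ⟨z, hz, h1, h2⟩

open Topology TopologicalSpace in
theorem aux_dim_of_dense {X Y : Type*} [TopologicalSpace X] [TopologicalSpace Y] {f : X → Y}
    (hf : IsInducing f) (hd : ∀ Z : Set Y, IsClosed Z → closure (f '' (f ⁻¹' Z)) = Z) :
    topologicalKrullDim X = topologicalKrullDim Y := by
  apply le_antisymm hf.topologicalKrullDim_le
  let g : IrreducibleCloseds Y → IrreducibleCloseds X := fun Z =>
    { carrier := f ⁻¹' Z
      isIrreducible' := aux_irr_of_inducing hf (by
        rw [← isIrreducible_iff_closure, hd _ Z.isClosed]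
        exact Z.isIrreducible)
      isClosed' := Z.isClosed.preimage hf.continuous }
  refine Order.krullDim_le_of_strictMono g (Monotone.strictMono_of_injective ?_ ?_)
  · intro a b hab
    have hab' : (a : Set Y) ⊆ b := hab
    exact Set.preimage_mono (f := f) hab'
  · intro a b hab
    have h1 : f ⁻¹' (a : Set Y) = f ⁻¹' (b : Set Y) := congrArg IrreducibleCloseds.carrier hab
    apply SetLike.coe_injective
    rw [← hd _ a.isClosed, ← hd _ b.isClosed, h1]

open Topology TopologicalSpace in
theorem aux_main {k : Type*} [Field k] [IsAlgClosed k] {σ : Type*} [Finite σ]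
    {A : Type*} [CommRing A] [IsDomain A] (φ : MvPolynomial σ k →+* A)
    (hφ : Function.Surjective φ) (C : Set (σ → k))
    (hC : ∀ x, x ∈ C ↔ ∀ f, φ f = 0 → MvPolynomial.eval x f = 0) :
    @IsClosed _ (zariskiTopology k σ) C ∧ zIsIrreducible k σ C ∧
    zKrullDim k σ C = ringKrullDim A := by
  letI := zariskiTopology k σ
  have hpp : IsInducing (MvPolynomial.pointToPoint (k := k) (K := k) (σ := σ)) :=
    ⟨aux_pp_inducing k σ⟩
  have hmem : ∀ x, x ∈ C ↔ MvPolynomial.pointToPoint (k := k) (K := k) x ∈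
      Set.range (PrimeSpectrum.comap φ) := by
    intro x
    rw [range_comap_of_surjective _ φ hφ, hC]
    rw [PrimeSpectrum.mem_zeroLocus]
    simp only [SetLike.coe_subset_coe, MvPolynomial.pointToPoint]
    constructor
    · intro h f hf
      exact (MvPolynomial.mem_vanishingIdeal_singleton_iff _ _).2 (h f hf)
    · intro h f hf
      exact (MvPolynomial.mem_vanishingIdeal_singleton_iff _ _).1 (h hf)
  have hce := PrimeSpectrum.isClosedEmbedding_comap_of_surjective _ φ hφ
  have hclosed : IsClosed C := by
    have : C = (MvPolynomial.pointToPoint (k := k) (K := k)) ⁻¹'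
      Set.range (PrimeSpectrum.comap φ) := by ext x; exact hmem x
    rw [this]
    exact hce.isClosed_range.preimage hpp.continuous
  choose g hg using fun x : C => (hmem x).1 x.2
  have hg' : PrimeSpectrum.comap φ ∘ g =
      (MvPolynomial.pointToPoint (k := k) (K := k)) ∘ (Subtype.val : C → _) := by
    funext x; exact hg x
  have hgi : IsInducing g := by
    rw [← hce.isInducing.of_comp_iff, hg']
    exact hpp.comp IsInducing.subtypeVal
  haveI : IsJacobsonRing A := isJacobsonRing_of_surjective ⟨φ, hφ⟩
  have hcp : ∀ m ∈ closedPoints (PrimeSpectrum A), m ∈ Set.range g := by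
    intro m hm
    have hm' : m.asIdeal.IsMaximal := (PrimeSpectrum.isClosed_singleton_iff_isMaximal m).1 hm
    have hm2 : (m.asIdeal.comap φ).IsMaximal := Ideal.comap_isMaximal_of_surjective φ hφ
    obtain ⟨x, hx⟩ := MvPolynomial.isMaximal_iff_eq_vanishingIdeal_singleton.1 hm2
    have hx' : PrimeSpectrum.comap φ m = MvPolynomial.pointToPoint (k := k) (K := k) x :=
      PrimeSpectrum.ext hx
    refine ⟨⟨x, (hmem x).2 ⟨m, hx'⟩⟩, hce.injective ?_⟩
    rw [hg, hx']
  have hd : ∀ Z : Set (PrimeSpectrum A), IsClosed Z → closure (g '' (g ⁻¹' Z)) = Z := by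
    intro Z hZ
    apply subset_antisymm
    · exact closure_minimal (Set.image_preimage_subset _ _) hZ
    · conv_lhs => rw [← closure_inter_closedPoints hZ]
      apply closure_mono
      rintro m ⟨hmZ, hm⟩
      obtain ⟨x, rfl⟩ := hcp m hm
      exact ⟨x, hmZ, rfl⟩
  refine ⟨hclosed, ?_, ?_⟩
  · have h1 : IsIrreducible (Set.univ : Set C) := by
      apply aux_irr_of_inducing hgi
      rw [← isIrreducible_iff_closure, ← Set.preimage_univ (f := g), hd _ isClosed_univ]
      exact IrreducibleSpace.isIrreducible_univ _
    have h2 := h1.image Subtype.val continuous_subtype_val.continuousOn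
    rw [Set.image_univ, Subtype.range_coe] at h2
    exact h2
  · rw [← PrimeSpectrum.topologicalKrullDim_eq_ringKrullDim]
    exact aux_dim_of_dense hgi hd

theorem aux_linear {k : Type*} [Field k] [IsAlgClosed k] {σ : Type*} [Finite σ]
    (s : Set σ) (C : Set (σ → k)) (hC : ∀ x, x ∈ C ↔ ∀ i, i ∉ s → x i = 0) :
    @IsClosed _ (zariskiTopology k σ) C ∧ zIsIrreducible k σ C ∧
    zKrullDim k σ C = (s.ncard : WithBot ℕ∞) := by
  let φ : MvPolynomial σ k →ₐ[k] MvPolynomial s k :=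
    MvPolynomial.aeval (fun i => if h : i ∈ s then MvPolynomial.X ⟨i, h⟩ else 0)
  have hφ : Function.Surjective φ := by
    intro p
    refine ⟨MvPolynomial.rename Subtype.val p, ?_⟩
    simp only [φ, MvPolynomial.aeval_rename]
    convert MvPolynomial.aeval_X_left_apply p using 3
    funext i
    simp
  have := aux_main (A := MvPolynomial s k) (φ : MvPolynomial σ k →+* MvPolynomial s k) hφ C ?_
  · rw [MvPolynomial.ringKrullDim_of_isNoetherianRing, ringKrullDim_eq_zero_of_field, zero_add,
      Nat.card_coe_set_eq] at this
    exact this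
  · intro x
    rw [hC]
    constructor
    · intro h f hf
      have h1 : (MvPolynomial.aeval x : MvPolynomial σ k →ₐ[k] k) =
          (MvPolynomial.aeval (fun i : s => x i)).comp φ := by
        ext i
        by_cases hi : i ∈ s
        · simp [φ, hi]
        · simp [φ, hi, h i hi]
      have h2 := DFunLike.congr_fun h1 f
      have hf' : φ f = 0 := hf
      rw [AlgHom.comp_apply, hf', map_zero] at h2
      exact h2
    · intro h i hi
      have := h (MvPolynomial.X i) (by simp [φ, hi])
      simpa using this

open MvPolynomial in
theorem aux_cone {k : Type*} [Field k] [IsAlgClosed k] :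
    @IsClosed _ (zariskiTopology k (Fin 3 × Fin 3)) (GT3C3 k) ∧
    zIsIrreducible k (Fin 3 × Fin 3) (GT3C3 k) ∧
    zKrullDim k (Fin 3 × Fin 3) (GT3C3 k) = ((3 : ℕ) : WithBot ℕ∞) := by
  let q : (MvPolynomial (Fin 2 ⊕ Fin 2) k) := X (.inl 0) * X (.inr 0) + X (.inl 1) * X (.inr 1)
  have hq : Irreducible q := by
    have h := irreducible_sumSMulXSMulY (R := k)
      (c := Finsupp.equivFunOnFinite.symm (fun _ : Fin 2 => (1 : k))) ?_ ?_
    · convert h using 1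
      simp [q, sumSMulXSMulY, Finsupp.linearCombination_apply, Finsupp.sum_fintype]
    · refine ⟨0, ?_, 1, ?_, by simp⟩ <;> simp
    · intro r hr
      exact isUnit_of_dvd_one (by simpa using hr 0)
  have hqp : Prime q := hq.prime
  let I : Ideal (MvPolynomial (Fin 2 ⊕ Fin 2) k) := Ideal.span {q}
  haveI : I.IsPrime := (Ideal.span_singleton_prime hqp.ne_zero).2 hqp
  let v : Fin 2 ⊕ Fin 2 → Fin 3 × Fin 3 := Sum.elim ![(0, 2), (1, 2)] ![(2, 0), (2, 1)]
  let w : Fin 3 × Fin 3 → (MvPolynomial (Fin 2 ⊕ Fin 2) k) := fun p => if p = (0, 2) then X (.inl 0) else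
    if p = (1, 2) then X (.inl 1) else if p = (2, 0) then X (.inr 0) else
    if p = (2, 1) then X (.inr 1) else 0
  have hwv : ∀ i, w (v i) = X i := by
    rintro (i | i) <;> fin_cases i <;> simp [w, v]
  let ψ : MvPolynomial (Fin 3 × Fin 3) k →ₐ[k] (MvPolynomial (Fin 2 ⊕ Fin 2) k) := aeval w
  have hψ : Function.Surjective ψ := by
    intro p
    refine ⟨rename v p, ?_⟩
    simp only [ψ, aeval_rename]
    convert aeval_X_left_apply p using 3
    funext i
    exact hwv i
  let φ : MvPolynomial (Fin 3 × Fin 3) k →+* (MvPolynomial (Fin 2 ⊕ Fin 2) k) ⧸ I :=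
    (Ideal.Quotient.mk I).comp (ψ : MvPolynomial (Fin 3 × Fin 3) k →+* (MvPolynomial (Fin 2 ⊕ Fin 2) k))
  have hφ : Function.Surjective φ := Ideal.Quotient.mk_surjective.comp hψ
  have hdim : ringKrullDim (MvPolynomial (Fin 2 ⊕ Fin 2) k ⧸ I) = ((3 : ℕ) : WithBot ℕ∞) := by
    have hR : ringKrullDim (MvPolynomial (Fin 2 ⊕ Fin 2) k) = ((4 : ℕ) : WithBot ℕ∞) := by
      rw [ringKrullDim_of_isNoetherianRing, ringKrullDim_eq_zero_of_field, zero_add]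
      simp
    have h1 : ringKrullDim (MvPolynomial (Fin 2 ⊕ Fin 2) k ⧸ I) + 1 ≤ ringKrullDim (MvPolynomial (Fin 2 ⊕ Fin 2) k) :=
      ringKrullDim_quotient_succ_le_of_nonZeroDivisor
        (mem_nonZeroDivisors_of_ne_zero hqp.ne_zero)
    have h2 : ((3 : ℕ) : WithBot ℕ∞) ≤ ringKrullDim (MvPolynomial (Fin 2 ⊕ Fin 2) k ⧸ I) := by
      let θ : (MvPolynomial (Fin 2 ⊕ Fin 2) k) →ₐ[k] MvPolynomial (Fin 2) k := aeval (Sum.elim (fun _ => 0) X)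
      have hθ : Function.Surjective θ := by
        intro p
        refine ⟨rename Sum.inr p, ?_⟩
        simp only [θ, aeval_rename]
        exact aeval_X_left_apply p
      have hθq : ∀ a ∈ I, (θ : (MvPolynomial (Fin 2 ⊕ Fin 2) k) →+* MvPolynomial (Fin 2) k) a = 0 := by
        intro a ha
        obtain ⟨b, rfl⟩ := Ideal.mem_span_singleton.1 ha
        simp [θ, q]
      let θ' := Ideal.Quotient.lift I (θ : (MvPolynomial (Fin 2 ⊕ Fin 2) k) →+* MvPolynomial (Fin 2) k) hθq
      have hθ' : Function.Surjective θ' := Ideal.Quotient.lift_surjective_of_surjective _ _ hθ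
      have hne : Ideal.Quotient.mk I (X (.inl 0)) ≠ 0 := by
        intro h
        rw [Ideal.Quotient.eq_zero_iff_mem, Ideal.mem_span_singleton] at h
        obtain ⟨b, hb⟩ := h
        have := congrArg (eval (Sum.elim ![(1 : k), 1] ![1, -1])) hb
        simp [q] at this
      have h3 := ringKrullDim_succ_le_of_surjective θ' hθ'
        (mem_nonZeroDivisors_of_ne_zero hne) (by simp [θ', θ])
      rw [ringKrullDim_of_isNoetherianRing, ringKrullDim_eq_zero_of_field, zero_add] at h3
      refine le_trans (le_of_eq ?_) h3
      simp
      rfl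
    rw [hR] at h1
    revert h1 h2
    generalize ringKrullDim (MvPolynomial (Fin 2 ⊕ Fin 2) k ⧸ I) = d
    intro h1 h2
    refine le_antisymm ?_ h2
    induction d with
    | bot => simp
    | coe d =>
      induction d with
      | top => exact absurd h1 (by decide)
      | coe d => 
        have h0 : (d : ℕ∞) + 1 ≤ ((4 : ℕ) : ℕ∞) := WithBot.coe_le_coe.1 h1
        have h1' : d + 1 ≤ 4 := by exact_mod_cast h0
        have h4 : d ≤ 3 := by omega
        have h5 : (d : ℕ∞) ≤ ((3 : ℕ) : ℕ∞) := by exact_mod_cast h4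
        exact WithBot.coe_le_coe.2 h5
  rw [← hdim]
  refine aux_main φ hφ _ ?_
  intro x
  have hker : ∀ f, φ f = 0 ↔ ψ f ∈ I := fun f => Ideal.Quotient.eq_zero_iff_mem
  simp only [hker]
  constructor
  · rintro ⟨h1, h2, h3, h4, h5, h6⟩ f hf
    have hh : (aeval x : MvPolynomial (Fin 3 × Fin 3) k →ₐ[k] k) =
          (aeval (fun i => x (v i))).comp ψ := by
      ext ⟨i, j⟩
      fin_cases i <;> fin_cases j <;> simp [ψ, w, v, h1, h2, h3, h4, h6]
    have h2 := DFunLike.congr_fun hh f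
    obtain ⟨b, hb⟩ := Ideal.mem_span_singleton.1 hf
    have hq0 : aeval (fun i => x (v i)) q = 0 := by
      simpa [q, v] using h5
    rw [AlgHom.comp_apply, hb, map_mul, hq0, zero_mul] at h2
    exact h2
  · intro h
    have hX : ∀ p, w p = 0 → x p = 0 := by
      intro p hp
      have := h (X p) (by simp [ψ, hp])
      simpa using this
    refine ⟨hX _ (by simp [w]), hX _ (by simp [w]), hX _ (by simp [w]), hX _ (by simp [w]), ?_,
      hX _ (by simp [w])⟩
    have := h (X (0, 2) * X (2, 0) + X (1, 2) * X (2, 1)) (by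
      apply Ideal.mem_span_singleton.2
      simp [ψ, w, q])
    simpa using this

theorem aux_mem_GT {k : Type*} [Field k] [CharZero k] (x : Fin 3 × Fin 3 → k) :
    x ∈ GTgl k 3 ↔ x (0, 0) = 0 ∧ x (1, 1) = 0 ∧ x (2, 2) = 0 ∧ x (0, 1) * x (1, 0) = 0 ∧
      x (0, 2) * x (2, 0) + x (1, 2) * x (2, 1) = 0 ∧
      x (0, 1) * x (1, 2) * x (2, 0) + x (0, 2) * x (2, 1) * x (1, 0) = 0 := by
  have h2 : (2 : k) ≠ 0 := two_ne_zero
  have h3 : (3 : k) ≠ 0 := three_ne_zero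
  have c20 : Fin.castLE (show 2 ≤ 3 by norm_num) 0 = 0 := rfl
  have c21 : Fin.castLE (show 2 ≤ 3 by norm_num) 1 = 1 := rfl
  have c10 : Fin.castLE (show 1 ≤ 3 by norm_num) 0 = 0 := rfl
  have c3 : ∀ i, Fin.castLE (show 3 ≤ 3 by norm_num) i = i := fun i => rfl
  constructor
  · intro h
    have e11 := h 1 (by norm_num) 1 (by norm_num) (by norm_num)
    have e21 := h 2 (by norm_num) 1 (by norm_num) (by norm_num)
    have e22 := h 2 (by norm_num) 2 (by norm_num) (by norm_num)
    have e31 := h 3 (by norm_num) 1 (by norm_num) (by norm_num)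
    have e32 := h 3 (by norm_num) 2 (by norm_num) (by norm_num)
    have e33 := h 3 (by norm_num) 3 (by norm_num) (by norm_num)
    simp only [pow_one, pow_two, pow_three, Matrix.trace, Matrix.diag, Matrix.mul_apply,
      Fin.sum_univ_one, Fin.sum_univ_two, Fin.sum_univ_three, Matrix.of_apply, c20, c21, c10, c3]
      at e11 e21 e22 e31 e32 e33
    have a1 : x (1, 1) = 0 := by linear_combination e21 - e11
    have a2 : x (2, 2) = 0 := by linear_combination e31 - e21
    simp only [e11, a1, a2] at e22 e32 e33
    have a3 : x (0, 1) * x (1, 0) = 0 := by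
      apply mul_left_cancel₀ h2; linear_combination e22
    refine ⟨e11, a1, a2, a3, ?_, ?_⟩
    · apply mul_left_cancel₀ h2; linear_combination e32 - 2 * a3
    · apply mul_left_cancel₀ h3; linear_combination e33
  · rintro ⟨a0, a1, a2, a3, a4, a5⟩ i hi j hj hji
    interval_cases i <;> interval_cases j <;>
    simp only [pow_one, pow_two, pow_three, Matrix.trace, Matrix.diag, Matrix.mul_apply,
      Fin.sum_univ_one, Fin.sum_univ_two, Fin.sum_univ_three, Matrix.of_apply, c20, c21, c10, c3,
      a0, a1, a2]
    · ring
    · linear_combination 2 * a3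
    · ring
    · linear_combination 2 * a3 + 2 * a4
    · linear_combination 3 * a5

def auxC (k : Type*) [CommRing k] : Fin 7 → Set (Fin 3 × Fin 3 → k) :=
  ![GT3C1 k, GT3C2 k, GT3C3 k, GT3C4 k, GT3C5 k, GT3C6 k, GT3C7 k]

theorem auxC_range (k : Type*) [CommRing k] : Set.range (auxC k) =
    {GT3C1 k, GT3C2 k, GT3C3 k, GT3C4 k, GT3C5 k, GT3C6 k, GT3C7 k} := by
  simp [auxC, Matrix.range_cons]
  ext; simp only [Set.mem_insert_iff, Set.mem_singleton_iff]; tauto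

theorem aux_union {k : Type*} [Field k] [CharZero k] : GTgl k 3 =
    GT3C1 k ∪ GT3C2 k ∪ GT3C3 k ∪ GT3C4 k ∪ GT3C5 k ∪ GT3C6 k ∪ GT3C7 k := by
  ext x
  rw [aux_mem_GT]
  simp only [Set.mem_union, GT3C1, GT3C2, GT3C3, GT3C4, GT3C5, GT3C6, GT3C7, Set.mem_ofPred_eq]
  constructor
  · rintro ⟨a0, a1, a2, a3, a4, a5⟩
    simp only [a0, a1, a2, true_and]
    by_cases h1 : x (0, 1) = 0
    · by_cases h2 : x (1, 0) = 0
      · simp [h1, h2, a4]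
      · simp only [h1, zero_mul, zero_add, mul_eq_zero, h2, or_false] at a5
        rcases a5 with a5 | a5
        · simp [a5] at a4
          rcases a4 with a4 | a4 <;> simp [h1, a5, a4]
        · simp [a5] at a4
          rcases a4 with a4 | a4 <;> simp [h1, a5, a4]
    · have h2 : x (1, 0) = 0 := by simpa [h1] using a3
      simp only [h2, mul_zero, add_zero, mul_eq_zero, h1, false_or] at a5
      rcases a5 with a5 | a5
      · simp [a5] at a4
        rcases a4 with a4 | a4 <;> simp [h2, a5, a4]
      · simp [a5] at a4
        rcases a4 with a4 | a4 <;> simp [h2, a5, a4]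
  · rintro ((((((h | h) | h) | h) | h) | h) | h) <;> obtain ⟨h1, h2, h3, h4, h5, h6⟩ := h <;>
      simp [h1, h2, h3, h4, h5, h6]

theorem aux_union' {k : Type*} [Field k] [CharZero k] : GTgl k 3 = ⋃ i, auxC k i := by
  rw [aux_union, ← Set.sUnion_range, auxC_range]
  ext x
  simp [or_assoc]

theorem auxC_props {k : Type*} [Field k] [IsAlgClosed k] (i : Fin 7) :
    @IsClosed _ (zariskiTopology k (Fin 3 × Fin 3)) (auxC k i) ∧
    zIsIrreducible k (Fin 3 × Fin 3) (auxC k i) ∧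
    zKrullDim k (Fin 3 × Fin 3) (auxC k i) = ((3 : ℕ) : WithBot ℕ∞) := by
  have key : ∀ (a b c : Fin 3 × Fin 3) (C : Set (Fin 3 × Fin 3 → k)),
      a ≠ b → a ≠ c → b ≠ c → (∀ x, x ∈ C ↔ ∀ i, i ∉ ({a, b, c} : Set (Fin 3 × Fin 3)) → x i = 0) →
      @IsClosed _ (zariskiTopology k (Fin 3 × Fin 3)) C ∧
      zIsIrreducible k (Fin 3 × Fin 3) C ∧
      zKrullDim k (Fin 3 × Fin 3) C = ((3 : ℕ) : WithBot ℕ∞) := by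
    intro a b c C hab hac hbc hC
    have h := aux_linear _ C hC
    rwa [Set.ncard_eq_three.2 ⟨a, b, c, hab, hac, hbc, rfl⟩] at h
  fin_cases i
  · refine key (1, 0) (2, 0) (2, 1) _ (by decide) (by decide) (by decide) fun x => ?_
    simp [auxC, GT3C1, Fin.forall_fin_succ, Prod.forall]
    tauto
  · refine key (1, 0) (2, 0) (1, 2) _ (by decide) (by decide) (by decide) fun x => ?_
    simp [auxC, GT3C2, Fin.forall_fin_succ, Prod.forall]
    tauto
  · exact aux_cone
  · refine key (1, 0) (0, 2) (1, 2) _ (by decide) (by decide) (by decide) fun x => ?_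
    simp [auxC, GT3C4, Fin.forall_fin_succ, Prod.forall]
    tauto
  · refine key (0, 1) (2, 0) (2, 1) _ (by decide) (by decide) (by decide) fun x => ?_
    simp [auxC, GT3C5, Fin.forall_fin_succ, Prod.forall]
    tauto
  · refine key (0, 1) (0, 2) (2, 1) _ (by decide) (by decide) (by decide) fun x => ?_
    simp [auxC, GT3C6, Fin.forall_fin_succ, Prod.forall]
    tauto
  · refine key (0, 1) (0, 2) (1, 2) _ (by decide) (by decide) (by decide) fun x => ?_
    simp [auxC, GT3C7, Fin.forall_fin_succ, Prod.forall]
    tauto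

theorem auxC_anti {k : Type*} [Field k] [CharZero k] (i j : Fin 7) (h : auxC k i ⊆ auxC k j) :
    i = j := by
  let M : Fin 7 → Matrix (Fin 3) (Fin 3) k :=
    ![!![0, 0, 0; 1, 0, 0; 1, 1, 0], !![0, 0, 0; 1, 0, 1; 1, 0, 0],
      !![0, 0, 1; 0, 0, 1; 1, -1, 0], !![0, 0, 1; 1, 0, 1; 0, 0, 0],
      !![0, 1, 0; 0, 0, 0; 1, 1, 0], !![0, 1, 1; 0, 0, 0; 0, 1, 0],
      !![0, 1, 1; 0, 0, 1; 0, 0, 0]]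
  have hm : (fun p => M i p.1 p.2) ∈ auxC k i := by
    fin_cases i <;> simp [M, auxC, GT3C1, GT3C2, GT3C3, GT3C4, GT3C5, GT3C6, GT3C7]
  have hm2 := h hm
  clear hm h
  fin_cases i <;> fin_cases j <;>
    first
    | rfl
    | (exfalso
       simp [M, auxC, GT3C1, GT3C2, GT3C3, GT3C4, GT3C5, GT3C6, GT3C7] at hm2)

open Topology in
theorem aux_components {X : Type*} [TopologicalSpace X] {n : ℕ} (C : Fin n → Set X) (V : Set X)
    (hV : V = ⋃ i, C i) (hc : ∀ i, IsClosed (C i)) (hi : ∀ i, IsIrreducible (C i))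
    (ha : ∀ i j, C i ⊆ C j → i = j) :
    (fun T : Set V => Subtype.val '' T) '' irreducibleComponents V = Set.range C := by
  have hsub : ∀ T : Set X, IsIrreducible T → T ⊆ V → ∃ i, T ⊆ C i := by
    intro T hT hTV
    obtain ⟨z, hz, hTz⟩ := isIrreducible_iff_sUnion_isClosed.1 hT (Finset.univ.image C)
      (by simpa using hc) (by simpa [hV] using hTV)
    obtain ⟨i, -, rfl⟩ := Finset.mem_image.1 hz
    exact ⟨i, hTz⟩
  have hCV : ∀ i, C i ⊆ V := fun i => hV ▸ Set.subset_iUnion C i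
  have himg : ∀ i, Subtype.val '' (Subtype.val ⁻¹' C i : Set V) = C i := by
    intro i
    rw [Subtype.image_preimage_coe]
    exact Set.inter_eq_right.2 (hCV i)
  have hirr : ∀ i, IsIrreducible (Subtype.val ⁻¹' C i : Set V) := by
    intro i
    apply aux_irr_of_inducing IsInducing.subtypeVal
    rw [himg]
    exact hi i
  have himi : ∀ T : Set V, IsIrreducible T → ∃ i, T ⊆ Subtype.val ⁻¹' C i := by
    intro T hT
    obtain ⟨i, h⟩ := hsub _ (hT.image _ continuous_subtype_val.continuousOn)
      (Subtype.coe_image_subset _ _)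
    exact ⟨i, Set.image_subset_iff.1 h⟩
  ext D
  constructor
  · rintro ⟨T, hT, rfl⟩
    obtain ⟨i, h⟩ := himi T hT.1
    have h2 := hT.2 (hirr i) h
    refine ⟨i, ?_⟩
    have : T = Subtype.val ⁻¹' C i := Set.Subset.antisymm h h2
    simp only [this, himg]
  · rintro ⟨i, rfl⟩
    refine ⟨Subtype.val ⁻¹' C i, ⟨hirr i, ?_⟩, himg i⟩
    intro T hT hle
    obtain ⟨j, h⟩ := himi T hT
    have h3 : C i ⊆ C j := by
      rw [← himg i, ← himg j]
      exact Set.image_mono (hle.trans h)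
    have := ha i j h3
    subst this
    exact h

open Topology in
theorem aux_dimSub {k : Type*} [Field k] {σ : Type*} {V : Set (σ → k)} (T : Set V) :
    zKrullDimSub k σ T = zKrullDim k σ (Subtype.val '' T) := by
  let _ := zariskiTopology k σ
  let f : T → (Subtype.val '' T : Set (σ → k)) := fun t => ⟨t.1.1, t.1, t.2, rfl⟩
  have hf : IsHomeomorph f := by
    rw [isHomeomorph_iff_isEmbedding_surjective]
    constructor
    · have : IsEmbedding ((Subtype.val : (Subtype.val '' T : Set (σ → k)) → _) ∘ f) :=
        (IsEmbedding.subtypeVal (p := (· ∈ V))).comp (IsEmbedding.subtypeVal (p := (· ∈ T)))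
      exact (IsEmbedding.of_comp_iff IsEmbedding.subtypeVal).1 this
    · rintro ⟨_, t, ht, rfl⟩
      exact ⟨⟨t, ht⟩, rfl⟩
  exact hf.topologicalKrullDim_eq f

/-- The Gelfand–Tsetlin variety for `Y₁(gl₃)` decomposes as `C₁ ∪ ⋯ ∪ C₇`; each `Cᵢ` is
irreducible of Krull dimension `3`; the `Cᵢ` are precisely the irreducible components of the
variety; and the variety is equidimensional of dimension `3`. -/
theorem GTs_Y1_gl3_decomposition (k : Type*) [Field k] [IsAlgClosed k] [CharZero k] :
    GTgl k 3 = GT3C1 k ∪ GT3C2 k ∪ GT3C3 k ∪ GT3C4 k ∪ GT3C5 k ∪ GT3C6 k ∪ GT3C7 k ∧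
    (∀ C ∈ ({GT3C1 k, GT3C2 k, GT3C3 k, GT3C4 k, GT3C5 k, GT3C6 k, GT3C7 k} :
        Set (Set (Fin 3 × Fin 3 → k))),
      zIsIrreducible k (Fin 3 × Fin 3) C ∧
        zKrullDim k (Fin 3 × Fin 3) C = ((3 : ℕ) : WithBot ℕ∞)) ∧
    (fun C : Set (GTgl k 3) => Subtype.val '' C) '' zComponents k (Fin 3 × Fin 3) (GTgl k 3) =
      {GT3C1 k, GT3C2 k, GT3C3 k, GT3C4 k, GT3C5 k, GT3C6 k, GT3C7 k} ∧
    IsEquidimOfDim k (Fin 3 × Fin 3) (GTgl k 3) 3 := by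
  have hcomp : (fun C : Set (GTgl k 3) => Subtype.val '' C) ''
      zComponents k (Fin 3 × Fin 3) (GTgl k 3) = Set.range (auxC k) :=
    @aux_components _ (zariskiTopology k (Fin 3 × Fin 3)) _ (auxC k) (GTgl k 3) aux_union'
      (fun i => (auxC_props i).1) (fun i => (auxC_props i).2.1) auxC_anti
  refine ⟨aux_union, ?_, ?_, ?_⟩
  · rw [← auxC_range]
    rintro _ ⟨i, rfl⟩
    exact (auxC_props i).2
  · rw [hcomp, auxC_range]
  · intro T hT
    rw [aux_dimSub]
    have h : (Subtype.val '' T : Set (Fin 3 × Fin 3 → k)) ∈ Set.range (auxC k) := by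
      rw [← hcomp]
      exact ⟨T, hT, rfl⟩
    obtain ⟨i, hi⟩ := h
    rw [← hi]
    exact (auxC_props i).2.2

end
end

section
/- The Gelfand–Tsetlin variety GTs for the restricted Yangian Y_2(gl_3) is equidimensional of dimension 6 (every irreducible component of GTs has Krull dimension 6), and it has exactly 22 irreducible components. -/
open scoped Classical

noncomputable section



/-- The `m × m` matrix `X(u)_m` over `k[u]` attached to a point `x` of `k^{n²p}`:
its `(a,b)` entry is `δ_{ab} u^p + Σ_{t=1}^p x_{ab}^{(t)} u^{p-t}`. -/
def Xu (k : Type*) [CommRing k] (n p : ℕ) (x : Fin n × Fin n × Fin p → k)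
    (m : ℕ) (hm : m ≤ n) : Matrix (Fin m) (Fin m) (Polynomial k) :=
  Matrix.of fun a b =>
    (if (a : ℕ) = (b : ℕ) then Polynomial.X ^ p else 0) +
      ∑ t : Fin p, Polynomial.C (x (Fin.castLE hm a, Fin.castLE hm b, t)) *
        Polynomial.X ^ (p - ((t : ℕ) + 1))

/-- The value at the point `x` of the polynomial `d̄_{mj}`, defined as the coefficient of
`u^{mp-j}` in `det X(u)_m`. -/
def dbar (k : Type*) [CommRing k] (n p : ℕ) (x : Fin n × Fin n × Fin p → k) (m j : ℕ) : k :=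
  if hm : m ≤ n then ((Xu k n p x m hm).det).coeff (m * p - j) else 0

/-- The Gelfand–Tsetlin variety for the restricted Yangian `Y_p(gl_n)`: the common zero
set in `k^{n²p}` of all the polynomials `d̄_{mj}` (`1 ≤ m ≤ n`, `1 ≤ j ≤ mp`). -/
def GTsYang (k : Type*) [CommRing k] (n p : ℕ) : Set (Fin n × Fin n × Fin p → k) :=
  {x | ∀ m j : ℕ, 1 ≤ m → m ≤ n → 1 ≤ j → j ≤ m * p → dbar k n p x m j = 0}


section ZTop
attribute [local instance] zariskiTopology

open TopologicalSpace Topology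

variable {k : Type*} [Field k]

lemma zt_isOpen_ne {ι : Type*} (f : MvPolynomial ι k) :
    IsOpen {x : ι → k | MvPolynomial.eval x f ≠ 0} :=
  TopologicalSpace.isOpen_generateFrom_of_mem ⟨f, rfl⟩

lemma zt_isClosed_eq {ι : Type*} (f : MvPolynomial ι k) :
    IsClosed {x : ι → k | MvPolynomial.eval x f = 0} := by
  rw [← isOpen_compl_iff]
  exact zt_isOpen_ne f

/-- polynomial functions -/
def PF {ι : Type*} (F : (ι → k) → k) : Prop :=
  ∃ p : MvPolynomial ι k, ∀ y, F y = MvPolynomial.eval y p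

lemma PF.var {ι : Type*} (i : ι) : PF (fun y : ι → k => y i) :=
  ⟨MvPolynomial.X i, fun y => by simp⟩
lemma PF.const {ι : Type*} (c : k) : PF (fun _ : ι → k => c) :=
  ⟨MvPolynomial.C c, fun y => by simp⟩
lemma PF.mul {ι : Type*} {F G : (ι → k) → k} (hF : PF F) (hG : PF G) :
    PF (fun y => F y * G y) := by
  obtain ⟨p, hp⟩ := hF
  obtain ⟨q, hq⟩ := hG
  exact ⟨p * q, fun y => by simp [hp, hq]⟩
lemma PF.plus {ι : Type*} {F G : (ι → k) → k} (hF : PF F) (hG : PF G) :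
    PF (fun y => F y + G y) := by
  obtain ⟨p, hp⟩ := hF
  obtain ⟨q, hq⟩ := hG
  exact ⟨p + q, fun y => by simp [hp, hq]⟩
lemma PF.sub {ι : Type*} {F G : (ι → k) → k} (hF : PF F) (hG : PF G) :
    PF (fun y => F y - G y) := by
  obtain ⟨p, hp⟩ := hF
  obtain ⟨q, hq⟩ := hG
  exact ⟨p - q, fun y => by simp [hp, hq]⟩
lemma PF.neg {ι : Type*} {F : (ι → k) → k} (hF : PF F) :
    PF (fun y => - F y) := by
  obtain ⟨p, hp⟩ := hF
  exact ⟨- p, fun y => by simp [hp]⟩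

lemma PF.isClosed_eq {ι : Type*} {F G : (ι → k) → k} (hF : PF F) (hG : PF G) :
    IsClosed {y : ι → k | F y = G y} := by
  obtain ⟨p, hp⟩ := hF.sub hG
  have : {y : ι → k | F y = G y} = {y | MvPolynomial.eval y p = 0} := by
    ext y
    simp only [Set.mem_ofPred_eq, ← hp, sub_eq_zero]
  rw [this]
  exact zt_isClosed_eq p

lemma zt_cont {ι κ : Type*} {F : (ι → k) → (κ → k)} (hF : ∀ c, PF (fun y => F y c)) :
    Continuous F := by
  choose P hP using hF
  refine continuous_generateFrom_iff.2 ?_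
  rintro U ⟨f, rfl⟩
  have : F ⁻¹' {x | MvPolynomial.eval x f ≠ 0} =
      {y | MvPolynomial.eval y (MvPolynomial.bind₁ P f) ≠ 0} := by
    ext y
    have : F y = fun c => MvPolynomial.eval y (P c) := funext fun c => hP c y
    simp only [Set.mem_preimage, Set.mem_ofPred_eq, this]
    have e := MvPolynomial.eval₂Hom_bind₁ (RingHom.id k) y P f
    change ¬ _ = _ ↔ ¬ _ = _
    exact not_congr (by rw [MvPolynomial.eval, MvPolynomial.eval, e])
  rw [this]
  exact zt_isOpen_ne _

lemma zt_isClosed_iff {ι : Type*} {T : Set (ι → k)} (hT : IsClosed T) :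
    ∃ A : Set (MvPolynomial ι k), T = {x | ∀ f ∈ A, MvPolynomial.eval x f = 0} := by
  have hT' : IsOpen Tᶜ := hT.isOpen_compl
  suffices H : ∀ U : Set (ι → k), IsOpen U →
      ∃ A : Set (MvPolynomial ι k), U = {x | ∃ f ∈ A, MvPolynomial.eval x f ≠ 0} by
    obtain ⟨A, hA⟩ := H _ hT'
    refine ⟨A, ?_⟩
    rw [← compl_compl T, hA]
    ext x
    simp
  intro U hU
  induction hU with
  | basic U h =>
    obtain ⟨f, rfl⟩ := h
    exact ⟨{f}, by simp⟩
  | univ => exact ⟨{1}, by simp⟩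
  | inter s t _ _ hs ht =>
    obtain ⟨A, rfl⟩ := hs
    obtain ⟨B, rfl⟩ := ht
    refine ⟨{h | ∃ f ∈ A, ∃ g ∈ B, h = f * g}, ?_⟩
    ext x
    constructor
    · rintro ⟨⟨f, hf, hf'⟩, ⟨g, hg, hg'⟩⟩
      exact ⟨f * g, ⟨f, hf, g, hg, rfl⟩, by simp [hf', hg']⟩
    · rintro ⟨_, ⟨f, hf, g, hg, rfl⟩, h⟩
      simp only [map_mul, ne_eq, mul_eq_zero, not_or] at h
      exact ⟨⟨f, hf, h.1⟩, ⟨g, hg, h.2⟩⟩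
  | sUnion S _ ih =>
    choose! A hA using ih
    refine ⟨⋃ s ∈ S, A s, ?_⟩
    ext x
    simp only [Set.mem_sUnion, Set.mem_iUnion, Set.mem_ofPred_eq]
    constructor
    · rintro ⟨t, ht, hx⟩
      rw [hA t ht] at hx
      obtain ⟨f, hf, h⟩ := hx
      exact ⟨f, ⟨t, ht, hf⟩, h⟩
    · rintro ⟨f, ⟨t, ht, hf⟩, h⟩
      refine ⟨t, ht, ?_⟩
      rw [hA t ht]
      exact ⟨f, hf, h⟩

instance zt_irr {ι : Type*} [Infinite k] : IrreducibleSpace (ι → k) where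
  toNonempty := ⟨fun _ => 0⟩
  isPreirreducible_univ := by
    intro U V hU hV ⟨x, _, hx⟩ ⟨y, _, hy⟩
    obtain ⟨A, hA⟩ := zt_isClosed_iff hU.isClosed_compl
    obtain ⟨B, hB⟩ := zt_isClosed_iff hV.isClosed_compl
    have hx' : x ∉ Uᶜ := fun h => h hx
    have hy' : y ∉ Vᶜ := fun h => h hy
    rw [hA] at hx'
    rw [hB] at hy'
    simp only [Set.mem_ofPred_eq, not_forall] at hx' hy'
    obtain ⟨f, hf, hfx⟩ := hx'
    obtain ⟨g, hg, hgy⟩ := hy'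
    have hf0 : f ≠ 0 := by rintro rfl; simp at hfx
    have hg0 : g ≠ 0 := by rintro rfl; simp at hgy
    have hfg : f * g ≠ 0 := mul_ne_zero hf0 hg0
    obtain ⟨z, hz⟩ : ∃ z, MvPolynomial.eval z (f * g) ≠ 0 := by
      by_contra! h
      exact hfg (MvPolynomial.funext (by simpa using h))
    simp only [map_mul, ne_eq, mul_eq_zero, not_or] at hz
    refine ⟨z, trivial, ?_, ?_⟩
    · by_contra hzU
      have : z ∈ Uᶜ := hzU
      rw [hA] at this
      exact hz.1 (this f hf)
    · by_contra hzU
      have : z ∈ Vᶜ := hzU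
      rw [hB] at this
      exact hz.2 (this g hg)

lemma zt_irr_range {ι κ : Type*} [Infinite k] {F : (ι → k) → (κ → k)}
    (hF : ∀ c, PF (fun y => F y c)) : IsIrreducible (Set.range F) := by
  rw [← Set.image_univ]
  exact (IrreducibleSpace.isIrreducible_univ _).image F (zt_cont hF).continuousOn

lemma zt_dim_le (n : ℕ) : topologicalKrullDim (Fin n → k) ≤ n := by
  have h1 : ringKrullDim (MvPolynomial (Fin n) k) = n := by
    rw [MvPolynomial.ringKrullDim_of_isNoetherianRing]
    simp
  rw [← h1, ringKrullDim, topologicalKrullDim]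
  let F : IrreducibleCloseds (Fin n → k) → (PrimeSpectrum (MvPolynomial (Fin n) k))ᵒᵈ := fun T =>
    OrderDual.toDual ⟨MvPolynomial.vanishingIdeal k (T : Set (Fin n → k)), by
      refine ⟨?_, ?_⟩
      · intro h
        obtain ⟨x, hx⟩ := T.isIrreducible.nonempty
        have : (1 : MvPolynomial (Fin n) k) ∈
          MvPolynomial.vanishingIdeal k (T : Set (Fin n → k)) := h ▸ Submodule.mem_top
        rw [MvPolynomial.mem_vanishingIdeal_iff] at this
        simpa using this x hx
      · intro f g hfg
        simp only [MvPolynomial.mem_vanishingIdeal_iff] at hfg ⊢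
        by_contra! h
        obtain ⟨⟨x, hx, hfx⟩, ⟨y, hy, hgy⟩⟩ := h
        have := T.isIrreducible.isPreirreducible _ _ (zt_isOpen_ne f) (zt_isOpen_ne g)
          ⟨x, hx, hfx⟩
          ⟨y, hy, hgy⟩
        obtain ⟨z, hz, h1, h2⟩ := this
        have h3 := hfg z hz
        have h4 : MvPolynomial.eval z (f * g) = 0 := h3
        rw [map_mul] at h4
        exact mul_ne_zero h1 h2 h4⟩
  rw [← Order.krullDim_orderDual (α := PrimeSpectrum (MvPolynomial (Fin n) k))]
  refine Order.krullDim_le_of_strictMono F ?_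
  have key : ∀ S T : IrreducibleCloseds (Fin n → k),
      MvPolynomial.vanishingIdeal k (S : Set (Fin n → k)) ≤
        MvPolynomial.vanishingIdeal k (T : Set (Fin n → k)) → T ≤ S := by
    intro S T h x hx
    obtain ⟨A, hA⟩ := zt_isClosed_iff S.isClosed
    change x ∈ (S : Set (Fin n → k))
    rw [hA]
    intro f hf
    have : f ∈ MvPolynomial.vanishingIdeal k (S : Set (Fin n → k)) := by
      rw [MvPolynomial.mem_vanishingIdeal_iff]
      intro y hy
      rw [hA] at hy
      exact hy f hf
    have := h this
    rw [MvPolynomial.mem_vanishingIdeal_iff] at this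
    exact this x hx
  intro S T hST
  refine lt_of_le_not_ge ?_ ?_
  · change MvPolynomial.vanishingIdeal k (T : Set (Fin n → k)) ≤
        MvPolynomial.vanishingIdeal k (S : Set (Fin n → k))
    exact MvPolynomial.vanishingIdeal_anti_mono hST.le
  · intro h
    exact not_le_of_gt hST (key S T h)

lemma dim_succ_le {X Y : Type*} [TopologicalSpace X] [TopologicalSpace Y] [IrreducibleSpace X]
    {f : Y → X} (hf : IsInducing f) {T : Set X} (hT : IsClosed T) (hfT : ∀ y, f y ∈ T)
    (hne : ∃ x, x ∉ T) : topologicalKrullDim Y + 1 ≤ topologicalKrullDim X := by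
  rw [topologicalKrullDim, topologicalKrullDim]
  rcases isEmpty_or_nonempty (IrreducibleCloseds Y) with hE | hE
  · rw [Order.krullDim_eq_bot]
    simp
  rw [← Order.krullDim_WithTop]
  let G : WithTop (IrreducibleCloseds Y) → IrreducibleCloseds X := fun z =>
    WithTop.recTopCoe (C := fun _ => IrreducibleCloseds X)
      ⟨Set.univ, IrreducibleSpace.isIrreducible_univ X, isClosed_univ⟩
      (fun Z => IrreducibleCloseds.map f hf.continuous Z) z
  refine Order.krullDim_le_of_strictMono G ?_
  have hm := IrreducibleCloseds.map_strictMono_of_isInducing hf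
  intro a b hab
  induction a using WithTop.recTopCoe with
  | top => exact absurd hab not_top_lt
  | coe a =>
    induction b using WithTop.recTopCoe with
    | top =>
      refine lt_of_le_not_ge (fun x _ => Set.mem_univ x) ?_
      intro h
      obtain ⟨x, hx⟩ := hne
      have h1 : x ∈ (IrreducibleCloseds.map f hf.continuous a : Set X) := h (Set.mem_univ x)
      rw [IrreducibleCloseds.coe_map] at h1
      refine hx (closure_minimal ?_ hT h1)
      rintro _ ⟨y, _, rfl⟩
      exact hfT y
    | coe b =>
      exact hm (WithTop.coe_lt_coe.1 hab)

lemma zt_inducing {X Y : Type*} [TopologicalSpace X] [TopologicalSpace Y] {f : X → Y} {g : Y → X}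
    (hf : Continuous f) (hg : Continuous g) (h : ∀ x, g (f x) = x) : IsInducing f :=
  (IsEmbedding.of_leftInverse h hg hf).isInducing

lemma zt_dim_ge [Infinite k] (n : ℕ) : (n : WithBot ℕ∞) ≤ topologicalKrullDim (Fin n → k) := by
  induction n with
  | zero =>
    have : Nonempty (IrreducibleCloseds (Fin 0 → k)) :=
      ⟨⟨Set.univ, IrreducibleSpace.isIrreducible_univ _, isClosed_univ⟩⟩
    exact Order.krullDim_nonneg
  | succ n ih =>
    have h := dim_succ_le (X := Fin (n+1) → k) (Y := Fin n → k)
      (f := fun y => Fin.cons 0 y) (T := {x | x 0 = 0})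
      (zt_inducing (g := fun x i => x i.succ) (zt_cont ?_) (zt_cont fun c => PF.var _) ?_)
      (PF.isClosed_eq (PF.var _) (PF.const 0)) (by simp) ⟨fun _ => 1, by simp⟩
    · refine le_trans ?_ h
      push_cast
      gcongr
    · intro c
      refine Fin.cases ?_ (fun c => ?_) c
      · exact PF.const 0
      · exact PF.var c
    · intro x
      simp

lemma zt_dim [Infinite k] (n : ℕ) : topologicalKrullDim (Fin n → k) = n :=
  le_antisymm (zt_dim_le n) (zt_dim_ge n)

lemma irrComp_of_cover {X ι : Type*} [TopologicalSpace X] [Finite ι] (S : ι → Set X)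
    (hc : ∀ i, IsClosed (S i)) (hi : ∀ i, IsIrreducible (S i)) (hu : ∀ x, ∃ i, x ∈ S i)
    (hn : ∀ i, ∃ x ∈ S i, ∀ j, x ∈ S j → j = i) :
    irreducibleComponents X = Set.range S ∧ Function.Injective S := by
  have hsub : ∀ T : Set X, IsIrreducible T → ∃ i, T ⊆ S i := by
    intro T hT
    have hfin : (Set.range S).Finite := Set.finite_range S
    obtain ⟨W, hW, hTW⟩ := isIrreducible_iff_sUnion_isClosed.mp hT hfin.toFinset
      (fun W hW => by
        rw [Set.Finite.mem_toFinset] at hW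
        obtain ⟨i, rfl⟩ := hW
        exact hc i)
      (by
        intro x _
        obtain ⟨i, hi⟩ := hu x
        exact ⟨S i, by simp, hi⟩)
    rw [Set.Finite.mem_toFinset] at hW
    obtain ⟨i, rfl⟩ := hW
    exact ⟨i, hTW⟩
  have hle : ∀ i j, S i ⊆ S j → j = i := by
    intro i j h
    obtain ⟨x, hx, hx'⟩ := hn i
    exact hx' j (h hx)
  refine ⟨?_, fun i j h => (hle i j h.subset).symm⟩
  ext T
  constructor
  · rintro ⟨h1, h2⟩
    obtain ⟨i, hi'⟩ := hsub T h1
    exact ⟨i, Set.Subset.antisymm (h2 (hi i) hi') hi'⟩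
  · rintro ⟨i, rfl⟩
    refine ⟨hi i, ?_⟩
    intro T hT hiT
    obtain ⟨j, hj⟩ := hsub T hT
    have : j = i := hle i j (hiT.trans hj)
    subst this
    exact hj


/-- the quadric cone times an affine space -/
def Quad (k : Type*) [Field k] (n : ℕ) : Set (Fin (n + 4) → k) := {y | y 0 * y 1 = y 2 * y 3}

/-- the tangent bundle of the quadric cone -/
def Jet (k : Type*) [Field k] : Set (Fin 8 → k) :=
  {y | y 0 * y 1 = y 2 * y 3 ∧ y 0 * y 5 + y 4 * y 1 = y 2 * y 7 + y 6 * y 3}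

lemma quad_closed (n : ℕ) : IsClosed (Quad k n) :=
  PF.isClosed_eq ((PF.var _).mul (PF.var _)) ((PF.var _).mul (PF.var _))

lemma jet_closed : IsClosed (Jet k) :=
  (PF.isClosed_eq ((PF.var _).mul (PF.var _)) ((PF.var _).mul (PF.var _))).inter
    (PF.isClosed_eq (((PF.var _).mul (PF.var _)).plus ((PF.var _).mul (PF.var _)))
      (((PF.var _).mul (PF.var _)).plus ((PF.var _).mul (PF.var _))))

/-- parametrization of the quadric -/
def quadPar (n : ℕ) (w : Fin (n + 4) → k) : Fin (n + 4) → k := fun i =>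
  if i = 0 then w 0 * w 1 else if i = 1 then w 2 * w 3 else if i = 2 then w 0 * w 2 else
    if i = 3 then w 1 * w 3 else w i

lemma fin_ne (n : ℕ) : (1 : Fin (n+4)) ≠ 0 ∧ (2 : Fin (n+4)) ≠ 0 ∧ (3 : Fin (n+4)) ≠ 0 ∧
    (2 : Fin (n+4)) ≠ 1 ∧ (3 : Fin (n+4)) ≠ 1 ∧ (3 : Fin (n+4)) ≠ 2 := by
  have h1 : ((1 : Fin (n+4)) : ℕ) = 1 := rfl
  have h2 : ((2 : Fin (n+4)) : ℕ) = 2 := rfl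
  have h3 : ((3 : Fin (n+4)) : ℕ) = 3 := rfl
  refine ⟨?_, ?_, ?_, ?_, ?_, ?_⟩ <;> rw [Ne, Fin.ext_iff] <;> simp only [h1, h2, h3, Fin.val_zero] <;> decide

lemma quad_irr [Infinite k] (n : ℕ) : IsIrreducible (Quad k n) := by
  obtain ⟨e1, e2, e3, e4, e5, e6⟩ := fin_ne n
  have : Quad k n = Set.range (quadPar (k := k) n) := by
    ext y
    constructor
    · intro (hy : y 0 * y 1 = y 2 * y 3)
      have key : ∃ p q r s : k, y 0 = p * q ∧ y 1 = r * s ∧ y 2 = p * r ∧ y 3 = q * s := by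
        by_cases h0 : y 0 = 0
        · rw [h0, zero_mul] at hy
          rcases mul_eq_zero.1 hy.symm with h | h
          · exact ⟨0, y 3, y 1, 1, by simp [h0], by simp, by simp [h], by simp⟩
          · exact ⟨y 2, 0, 1, y 1, by simp [h0], by simp, by simp, by simp [h]⟩
        · refine ⟨1, y 0, y 2, y 3 / y 0, by simp, ?_, by simp, ?_⟩
          · field_simp
            linear_combination hy
          · field_simp
      obtain ⟨p, q, r, s, h0, h1, h2, h3⟩ := key
      refine ⟨fun i => if i = 0 then p else if i = 1 then q else if i = 2 then r else
        if i = 3 then s else y i, ?_⟩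
      funext i
      simp only [quadPar, e1, e2, e3, e4, e5, e6, if_true, if_false]
      split_ifs with g0 g1 g2 g3
      · rw [g0, h0]
      · rw [g1, h1]
      · rw [g2, h2]
      · rw [g3, h3]
      · rfl
    · rintro ⟨w, rfl⟩
      simp only [Quad, Set.mem_ofPred_eq, quadPar, e1, e2, e3, e4, e5, e6, if_true, if_false]
      ring
  rw [this]
  refine zt_irr_range ?_
  intro c
  unfold quadPar
  split_ifs
  · exact (PF.var _).mul (PF.var _)
  · exact (PF.var _).mul (PF.var _)
  · exact (PF.var _).mul (PF.var _)
  · exact (PF.var _).mul (PF.var _)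
  · exact PF.var _

/-- parametrization of the tangent bundle of the quadric cone -/
def jetPar (w : Fin 9 → k) : Fin 8 → k :=
  ![w 0 * w 1 * w 3, w 0 * w 2 * w 4, w 0 * w 1 * w 4, w 0 * w 2 * w 3,
    w 1 * w 5 + w 7 * w 3, w 2 * w 6 + w 8 * w 4, w 1 * w 6 + w 7 * w 4, w 2 * w 5 + w 8 * w 3]

lemma jet_key (Y0 Y1 Y2 Y3 Y4 Y5 Y6 Y7 : k) (h0 : Y0 ≠ 0) (hy : Y0 * Y1 = Y2 * Y3)
    (hy' : Y0 * Y5 + Y4 * Y1 = Y2 * Y7 + Y6 * Y3) :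
    ∃ t v0 v1 w0 w1 y0 y1 z0 z1 : k, Y0 = t * v0 * w0 ∧ Y1 = t * v1 * w1 ∧
          Y2 = t * v0 * w1 ∧ Y3 = t * v1 * w0 ∧ Y4 = v0 * y0 + z0 * w0 ∧
          Y5 = v1 * y1 + z1 * w1 ∧ Y6 = v0 * y1 + z0 * w1 ∧ Y7 = v1 * y0 + z1 * w0 := by
  obtain ⟨r, hr⟩ : ∃ r, Y0 * r = 1 := ⟨Y0⁻¹, mul_inv_cancel₀ h0⟩
  refine ⟨1, 1, Y3 * r, Y0, Y2, Y4, Y6, 0, (Y7 - Y3 * r * Y4) * r, by ring, ?_, by ring, ?_,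
    by ring, ?_, by ring, ?_⟩
  · linear_combination (-Y1) * hr + r * hy
  · linear_combination (-Y3) * hr
  · linear_combination (-Y5) * hr + r * hy' - r * Y4 * ((-Y1) * hr + r * hy)
  · linear_combination -(Y7 - Y3 * r * Y4) * hr

lemma jet_irr [Infinite k] : IsIrreducible (Jet k) := by
  have : Jet k = Set.range (jetPar (k := k)) := by
    ext y
    constructor
    · rintro ⟨hy, hy'⟩
      have key : ∃ t v0 v1 w0 w1 y0 y1 z0 z1 : k, y 0 = t * v0 * w0 ∧ y 1 = t * v1 * w1 ∧
          y 2 = t * v0 * w1 ∧ y 3 = t * v1 * w0 ∧ y 4 = v0 * y0 + z0 * w0 ∧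
          y 5 = v1 * y1 + z1 * w1 ∧ y 6 = v0 * y1 + z0 * w1 ∧ y 7 = v1 * y0 + z1 * w0 := by
        by_cases h0 : y 0 = 0
        · by_cases h2 : y 2 = 0
          · by_cases h1 : y 1 = 0
            · by_cases h3 : y 3 = 0
              · exact ⟨0, 1, 0, y 7, y 5, y 4, y 6, 0, 1, by simp [h0], by simp [h1],
                  by simp [h2], by simp [h3], by simp, by simp, by simp, by simp⟩
              · obtain ⟨t, v0, v1, w0, w1, y0, y1, z0, z1, g⟩ := jet_key (y 3) (y 2) (y 1) (y 0)
                  (y 7) (y 6) (y 5) (y 4) h3 (by linear_combination -hy) (by linear_combination -hy')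
                exact ⟨t, v1, v0, w0, w1, y0, y1, z1, z0, by tauto⟩
            · obtain ⟨t, v0, v1, w0, w1, y0, y1, z0, z1, g⟩ := jet_key (y 1) (y 0) (y 3) (y 2)
                  (y 5) (y 4) (y 7) (y 6) h1 (by linear_combination hy) (by linear_combination hy')
              exact ⟨t, v1, v0, w1, w0, y1, y0, z1, z0, by tauto⟩
          · obtain ⟨t, v0, v1, w0, w1, y0, y1, z0, z1, g⟩ := jet_key (y 2) (y 3) (y 0) (y 1)
                  (y 6) (y 7) (y 4) (y 5) h2 (by linear_combination -hy) (by linear_combination -hy')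
            exact ⟨t, v0, v1, w1, w0, y1, y0, z0, z1, by tauto⟩
        · exact jet_key (y 0) (y 1) (y 2) (y 3) (y 4) (y 5) (y 6) (y 7) h0 hy hy'
      obtain ⟨t, v0, v1, w0, w1, y0, y1, z0, z1, h⟩ := key
      refine ⟨![t, v0, v1, w0, w1, y0, y1, z0, z1], ?_⟩
      obtain ⟨g0, g1, g2, g3, g4, g5, g6, g7⟩ := h
      funext i
      fin_cases i
      exacts [g0.symm, g1.symm, g2.symm, g3.symm, g4.symm, g5.symm, g6.symm, g7.symm]
    · rintro ⟨w, rfl⟩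
      constructor
      · change w 0 * w 1 * w 3 * (w 0 * w 2 * w 4) = w 0 * w 1 * w 4 * (w 0 * w 2 * w 3)
        ring
      · change w 0 * w 1 * w 3 * (w 2 * w 6 + w 8 * w 4) + (w 1 * w 5 + w 7 * w 3) *
          (w 0 * w 2 * w 4) = w 0 * w 1 * w 4 * (w 2 * w 5 + w 8 * w 3) +
          (w 1 * w 6 + w 7 * w 4) * (w 0 * w 2 * w 3)
        ring
  rw [this]
  refine zt_irr_range ?_
  intro c
  fin_cases c
  · exact ((PF.var _).mul (PF.var _)).mul (PF.var _)
  · exact ((PF.var _).mul (PF.var _)).mul (PF.var _)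
  · exact ((PF.var _).mul (PF.var _)).mul (PF.var _)
  · exact ((PF.var _).mul (PF.var _)).mul (PF.var _)
  · exact ((PF.var _).mul (PF.var _)).plus ((PF.var _).mul (PF.var _))
  · exact ((PF.var _).mul (PF.var _)).plus ((PF.var _).mul (PF.var _))
  · exact ((PF.var _).mul (PF.var _)).plus ((PF.var _).mul (PF.var _))
  · exact ((PF.var _).mul (PF.var _)).plus ((PF.var _).mul (PF.var _))

lemma quad_dim_le [Infinite k] (n : ℕ) :
    topologicalKrullDim (Quad k n) + 1 ≤ ((n + 4 : ℕ) : WithBot ℕ∞) := by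
  obtain ⟨e1, e2, e3, e4, e5, e6⟩ := fin_ne n
  rw [← zt_dim (k := k)]
  refine dim_succ_le (f := Subtype.val) IsInducing.subtypeVal (quad_closed n) (fun y => y.2)
    ⟨fun i => if i = 0 then 1 else if i = 1 then 1 else 0, ?_⟩
  simp [Quad, e1, e2, e4]

/-- auxiliary map between affine spaces given by polynomials, restricted to subsets -/
lemma res_cont {m n : ℕ} {A : Set (Fin m → k)} {B : Set (Fin n → k)} {F : (Fin m → k) → (Fin n → k)}
    (hF : ∀ c, PF (fun y => F y c)) (h : ∀ y ∈ A, F y ∈ B) :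
    Continuous (fun y : A => (⟨F y.1, h y.1 y.2⟩ : B)) :=
  Continuous.subtype_mk ((zt_cont hF).comp continuous_subtype_val) _

lemma sub_dim_succ_le {m n : ℕ} {A : Set (Fin m → k)} {B : Set (Fin n → k)}
    (hB : IsIrreducible B)
    (F : (Fin m → k) → (Fin n → k)) (G : (Fin n → k) → (Fin m → k))
    (hF : ∀ c, PF (fun y => F y c)) (hG : ∀ c, PF (fun y => G y c)) (h : ∀ y ∈ A, F y ∈ B)
    (hGF : ∀ y, G (F y) = y) (c : Fin n) (hc : ∀ y, F y c = 0) (hb : ∃ b ∈ B, b c ≠ 0) :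
    topologicalKrullDim A + 1 ≤ topologicalKrullDim B := by
  have : IrreducibleSpace B := isIrreducible_iff_irreducibleSpace.1 hB
  refine dim_succ_le (f := fun y : A => (⟨F y.1, h y.1 y.2⟩ : B)) (T := {b : B | b.1 c = 0})
    ?_ ?_ ?_ ?_
  · have h1 : IsInducing F := zt_inducing (zt_cont hF) (zt_cont hG) hGF
    have h2 : IsInducing (fun y : A => F y.1) := h1.comp IsInducing.subtypeVal
    exact IsInducing.of_comp (g := Subtype.val) (res_cont hF h) continuous_subtype_val h2
  · exact (PF.isClosed_eq (PF.var c) (PF.const 0)).preimage continuous_subtype_val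
  · intro y
    exact hc y.1
  · obtain ⟨b, hb, hb'⟩ := hb
    exact ⟨⟨b, hb⟩, hb'⟩

lemma univ_dim [Infinite k] (n : ℕ) :
    topologicalKrullDim (Set.univ : Set (Fin n → k)) = n := by
  rw [← zt_dim (k := k)]
  exact IsHomeomorph.topologicalKrullDim_eq _ (Homeomorph.Set.univ (Fin n → k)).isHomeomorph

lemma quad3_dim_ge [Infinite k] : (6 : ℕ) ≤ topologicalKrullDim (Quad k 3) := by
  have := sub_dim_succ_le (A := (Set.univ : Set (Fin 5 → k))) (quad_irr (k := k) 3)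
    (fun y => ![0, y 0, 0, y 1, y 2, y 3, y 4]) (fun y => ![y 1, y 3, y 4, y 5, y 6])
    (by
      intro c
      fin_cases c
      exacts [PF.const 0, PF.var 0, PF.const 0, PF.var 1, PF.var 2, PF.var 3, PF.var 4])
    (by
      intro c
      fin_cases c
      exacts [PF.var 1, PF.var 3, PF.var 4, PF.var 5, PF.var 6])
    (by
      intro y _
      change 0 * y 0 = 0 * y 1
      simp)
    (by
      intro y
      funext i
      fin_cases i <;> rfl) 0 (by intro y; rfl)
    ⟨![1, 0, 0, 0, 0, 0, 0], by change (1 : k) * 0 = 0 * 0; simp, by simp⟩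
  rw [univ_dim] at this
  exact this

lemma quad2_dim_ge [Infinite k] : (5 : ℕ) ≤ topologicalKrullDim (Quad k 2) := by
  have := sub_dim_succ_le (A := (Set.univ : Set (Fin 4 → k))) (quad_irr (k := k) 2)
    (fun y => ![0, y 0, 0, y 1, y 2, y 3]) (fun y => ![y 1, y 3, y 4, y 5])
    (by
      intro c
      fin_cases c
      exacts [PF.const 0, PF.var 0, PF.const 0, PF.var 1, PF.var 2, PF.var 3])
    (by
      intro c
      fin_cases c
      exacts [PF.var 1, PF.var 3, PF.var 4, PF.var 5])
    (by
      intro y _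
      change 0 * y 0 = 0 * y 1
      simp)
    (by
      intro y
      funext i
      fin_cases i <;> rfl) 0 (by intro y; rfl)
    ⟨![1, 0, 0, 0, 0, 0], by change (1 : k) * 0 = 0 * 0; simp, by simp⟩
  rw [univ_dim] at this
  exact this

lemma jet_dim_ge [Infinite k] : (6 : ℕ) ≤ topologicalKrullDim (Jet k) := by
  have := sub_dim_succ_le (A := Quad k 2) (jet_irr (k := k))
    (fun y => ![y 0, 0, y 2, 0, y 4, y 1, y 5, y 3])
    (fun y => ![y 0, y 5, y 2, y 7, y 4, y 6])
    (by
      intro c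
      fin_cases c
      exacts [PF.var 0, PF.const 0, PF.var 2, PF.const 0, PF.var 4, PF.var 1, PF.var 5, PF.var 3])
    (by
      intro c
      fin_cases c
      exacts [PF.var 0, PF.var 5, PF.var 2, PF.var 7, PF.var 4, PF.var 6])
    (by
      intro y (hy : y 0 * y 1 = y 2 * y 3)
      refine ⟨?_, ?_⟩
      · change y 0 * 0 = y 2 * 0
        simp
      · change y 0 * y 1 + y 4 * 0 = y 2 * y 3 + y 5 * 0
        simp [hy])
    (by
      intro y
      funext i
      fin_cases i <;> rfl) 1 (by intro y; rfl)
    ⟨![0, 1, 0, 0, 0, 0, 0, 0], ⟨by simp, by simp⟩, by simp⟩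
  refine le_trans ?_ this
  have h := quad2_dim_ge (k := k)
  calc ((6 : ℕ) : WithBot ℕ∞) = (5 : ℕ) + 1 := rfl
    _ ≤ _ := by gcongr

lemma wb_add_one {a b : WithBot ℕ∞} (h : a + 1 ≤ b + 1) : a ≤ b :=
  (ENat.WithBot.add_le_add_one_right_iff).1 h

lemma jet_dim_le [Infinite k] : topologicalKrullDim (Jet k) ≤ (6 : ℕ) := by
  have h1 := quad_dim_le (k := k) 4
  have : IrreducibleSpace (Quad k 4) := isIrreducible_iff_irreducibleSpace.1 (quad_irr 4)
  have h2 : topologicalKrullDim (Jet k) + 1 ≤ topologicalKrullDim (Quad k 4) := by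
    have hi : Jet k ⊆ Quad k 4 := fun y hy => hy.1
    refine dim_succ_le (f := Set.inclusion hi) (T := Subtype.val ⁻¹' (Jet k))
      (Topology.IsEmbedding.inclusion hi).isInducing (jet_closed.preimage continuous_subtype_val)
      (fun y => y.2) ⟨⟨![1, 0, 0, 0, 0, 1, 0, 0], ?_⟩, ?_⟩
    · change (1 : k) * 0 = 0 * 0
      simp
    · rintro ⟨_, h⟩
      change (1 : k) * 1 + 0 * 0 = 0 * 0 + 0 * 0 at h
      simp at h
  have h3 : topologicalKrullDim (Jet k) + 1 + 1 ≤ ((6 : ℕ) : WithBot ℕ∞) + 1 + 1 := by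
    refine le_trans ?_ h1
    gcongr
  exact (wb_add_one (wb_add_one h3))

lemma quad3_dim [Infinite k] : topologicalKrullDim (Quad k 3) = (6 : ℕ) := by
  refine le_antisymm ?_ quad3_dim_ge
  have h : topologicalKrullDim (Quad k 3) + 1 ≤ ((6 : ℕ) : WithBot ℕ∞) + 1 := quad_dim_le 3
  exact wb_add_one h

lemma jet_dim [Infinite k] : topologicalKrullDim (Jet k) = (6 : ℕ) :=
  le_antisymm jet_dim_le jet_dim_ge


/-- the six equations on the reduced set of twelve coordinates -/
def E12 (a0 a1 b0 b1 f0 f1 g0 g1 h0 h1 i0 i1 : k) : Prop :=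
  a0 * b0 = 0 ∧ a0 * b1 + a1 * b0 = 0 ∧
  a1 * b1 * (f0 * h0) - b0 * f0 * i0 - a0 * g0 * h0 = 0 ∧
  a1 * b1 * (f0 * h1 + f1 * h0) - (b1 * f0 * i0 + b0 * (f1 * i0 + f0 * i1))
    - (a1 * g0 * h0 + a0 * (g1 * h0 + g0 * h1)) = 0 ∧
  f0 * h0 + g0 * i0 + a1 * b1 * (f1 * h1) - (b0 * f1 * i1 + b1 * (f1 * i0 + f0 * i1))
    - (a0 * g1 * h1 + a1 * (g1 * h0 + g0 * h1)) = 0 ∧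
  f0 * h1 + f1 * h0 + g0 * i1 + g1 * i0 - b1 * f1 * i1 - a1 * g1 * h1 = 0

/-- the same for a vector -/
def E12v (z : Fin 12 → k) : Prop :=
  E12 (z 0) (z 1) (z 2) (z 3) (z 4) (z 5) (z 6) (z 7) (z 8) (z 9) (z 10) (z 11)

/-- embedding of the reduced coordinates -/
def Emb (z : Fin 12 → k) : Fin 3 × Fin 3 × Fin 2 → k := fun c =>
  (![![![0, 0], ![z 1, z 0], ![z 5, z 4]],
     ![![z 3, z 2], ![0, z 1 * z 3], ![z 7, z 6]],
     ![![z 9, z 8], ![z 11, z 10], ![0, z 5 * z 9 + z 7 * z 11]]] :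
       Fin 3 → Fin 3 → Fin 2 → k) c.1 c.2.1 c.2.2

/-- the reduced coordinates -/
def Prj (x : Fin 3 × Fin 3 × Fin 2 → k) : Fin 12 → k :=
  ![x (0, 1, 1), x (0, 1, 0), x (1, 0, 1), x (1, 0, 0), x (0, 2, 1), x (0, 2, 0),
    x (1, 2, 1), x (1, 2, 0), x (2, 0, 1), x (2, 0, 0), x (2, 1, 1), x (2, 1, 0)]

lemma prj_emb (z : Fin 12 → k) : Prj (Emb z) = z := by
  funext i
  fin_cases i <;> rfl

open Polynomial in
lemma Xu_entry (x : Fin 3 × Fin 3 × Fin 2 → k) (m : ℕ) (hm : m ≤ 3) (a b : Fin m) :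
    Xu k 3 2 x m hm a b = (if (a : ℕ) = (b : ℕ) then X ^ 2 else 0) +
      (C (x (Fin.castLE hm a, Fin.castLE hm b, 0)) * X +
        C (x (Fin.castLE hm a, Fin.castLE hm b, 1))) := by
  simp [Xu, Fin.sum_univ_two]

open Polynomial in
lemma det1 (x : Fin 3 × Fin 3 × Fin 2 → k) (hm : 1 ≤ 3) :
    (Xu k 3 2 x 1 hm).det = X ^ 2 + C (x (0, 0, 0)) * X ^ 1 + C (x (0, 0, 1)) := by
  rw [Matrix.det_fin_one, Xu_entry]
  have : Fin.castLE hm (0 : Fin 1) = 0 := rfl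
  simp only [this, if_true]
  ring

open Polynomial in
lemma det2 (x : Fin 3 × Fin 3 × Fin 2 → k) (hm : 2 ≤ 3) (h0 : x (0, 0, 0) = 0)
    (h1 : x (0, 0, 1) = 0) :
    (Xu k 3 2 x 2 hm).det = X ^ 4 + C (x (1, 1, 0)) * X ^ 3
      + C (x (1, 1, 1) - x (0, 1, 0) * x (1, 0, 0)) * X ^ 2
      + C (-(x (0, 1, 1) * x (1, 0, 0) + x (0, 1, 0) * x (1, 0, 1))) * X ^ 1
      + C (-(x (0, 1, 1) * x (1, 0, 1))) := by
  rw [Matrix.det_fin_two]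
  simp only [Xu_entry]
  have e0 : Fin.castLE hm (0 : Fin 2) = 0 := rfl
  have e1 : Fin.castLE hm (1 : Fin 2) = 1 := rfl
  simp only [e0, e1, h0, h1, Fin.val_zero, Fin.val_one, if_true, if_false, zero_ne_one,
    one_ne_zero, C_0, map_sub, map_neg, map_mul, map_add]
  ring

open Polynomial in
lemma det3 (x : Fin 3 × Fin 3 × Fin 2 → k) (hm : 3 ≤ 3) {a0 a1 b0 b1 f0 f1 g0 g1 h0 h1 i0 i1 w0 w1 : k}
    (e1 : x (0, 0, 0) = 0) (e2 : x (0, 0, 1) = 0) (e3 : x (1, 1, 0) = 0)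
    (e4 : x (1, 1, 1) = a1 * b1)
    (ha1 : x (0, 1, 0) = a1) (ha0 : x (0, 1, 1) = a0)
    (hb1 : x (1, 0, 0) = b1) (hb0 : x (1, 0, 1) = b0)
    (hf1 : x (0, 2, 0) = f1) (hf0 : x (0, 2, 1) = f0)
    (hg1 : x (1, 2, 0) = g1) (hg0 : x (1, 2, 1) = g0)
    (hh1 : x (2, 0, 0) = h1) (hh0 : x (2, 0, 1) = h0)
    (hi1 : x (2, 1, 0) = i1) (hi0 : x (2, 1, 1) = i0)
    (hw1 : x (2, 2, 0) = w1) (hw0 : x (2, 2, 1) = w0) :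
    (Xu k 3 2 x 3 hm).det = X ^ 6 + C w1 * X ^ 5 + C (w0 - (f1 * h1 + g1 * i1)) * X ^ 4
      + C (-(f0 * h1 + f1 * h0 + g0 * i1 + g1 * i0 - b1 * f1 * i1 - a1 * g1 * h1)
          - (a0 * b1 + a1 * b0)) * X ^ 3
      + C (-(f0 * h0 + g0 * i0 + a1 * b1 * (f1 * h1) - (b0 * f1 * i1 + b1 * (f1 * i0 + f0 * i1))
    - (a0 * g1 * h1 + a1 * (g1 * h0 + g0 * h1))) - a0 * b0 - w1 * (a0 * b1 + a1 * b0)) * X ^ 2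
      + C (-(a1 * b1 * (f0 * h1 + f1 * h0) - (b1 * f0 * i0 + b0 * (f1 * i0 + f0 * i1))
    - (a1 * g0 * h0 + a0 * (g1 * h0 + g0 * h1))) - w1 * (a0 * b0) - w0 * (a0 * b1 + a1 * b0)) * X ^ 1
      + C (-(a1 * b1 * (f0 * h0) - b0 * f0 * i0 - a0 * g0 * h0) - w0 * (a0 * b0)) := by
  rw [Matrix.det_fin_three]
  simp only [Xu_entry]
  have c0 : Fin.castLE hm (0 : Fin 3) = 0 := rfl
  have c1 : Fin.castLE hm (1 : Fin 3) = 1 := rfl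
  have c2 : Fin.castLE hm (2 : Fin 3) = 2 := rfl
  have v2 : ((2 : Fin 3) : ℕ) = 2 := rfl
  have n1 : (1 : ℕ) ≠ 2 := by decide
  have n2 : (2 : ℕ) ≠ 1 := by decide
  have n3 : (0 : ℕ) ≠ 2 := by decide
  have n4 : (2 : ℕ) ≠ 0 := by decide
  simp only [c0, c1, c2, v2, n1, n2, n3, n4, e1, e2, e3, e4, ha1, ha0, hb1, hb0, hf1, hf0, hg1,
    hg0, hh1, hh0, hi1, hi0, hw1, hw0, Fin.val_zero, Fin.val_one, if_true, if_false, zero_ne_one,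
    one_ne_zero, C_0, map_sub, map_neg, map_mul, map_add]
  ring

open Polynomial in
lemma coeff6 (c5 c4 c3 c2 c1 c0 : k) :
    (X ^ 6 + C c5 * X ^ 5 + C c4 * X ^ 4 + C c3 * X ^ 3 + C c2 * X ^ 2 + C c1 * X ^ 1 +
      C c0).coeff (3 * 2 - 1) = c5 ∧
    (X ^ 6 + C c5 * X ^ 5 + C c4 * X ^ 4 + C c3 * X ^ 3 + C c2 * X ^ 2 + C c1 * X ^ 1 +
      C c0).coeff (3 * 2 - 2) = c4 ∧
    (X ^ 6 + C c5 * X ^ 5 + C c4 * X ^ 4 + C c3 * X ^ 3 + C c2 * X ^ 2 + C c1 * X ^ 1 +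
      C c0).coeff (3 * 2 - 3) = c3 ∧
    (X ^ 6 + C c5 * X ^ 5 + C c4 * X ^ 4 + C c3 * X ^ 3 + C c2 * X ^ 2 + C c1 * X ^ 1 +
      C c0).coeff (3 * 2 - 4) = c2 ∧
    (X ^ 6 + C c5 * X ^ 5 + C c4 * X ^ 4 + C c3 * X ^ 3 + C c2 * X ^ 2 + C c1 * X ^ 1 +
      C c0).coeff (3 * 2 - 5) = c1 ∧
    (X ^ 6 + C c5 * X ^ 5 + C c4 * X ^ 4 + C c3 * X ^ 3 + C c2 * X ^ 2 + C c1 * X ^ 1 +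
      C c0).coeff (3 * 2 - 6) = c0 := by
  refine ⟨?_, ?_, ?_, ?_, ?_, ?_⟩ <;>
    simp only [coeff_add, coeff_C_mul, coeff_X_pow, coeff_C] <;> simp

lemma gts_iff (x : Fin 3 × Fin 3 × Fin 2 → k) :
    x ∈ GTsYang k 3 2 ↔ E12v (Prj x) ∧ Emb (Prj x) = x := by
  constructor
  · intro h
    have A1 := h 1 1 (by decide) (by decide) (by decide) (by decide)
    have A2 := h 1 2 (by decide) (by decide) (by decide) (by decide)
    rw [dbar, dif_pos (by decide), det1] at A1 A2
    simp [Polynomial.coeff_X] at A1 A2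
    have B1 := h 2 1 (by decide) (by decide) (by decide) (by decide)
    have B2 := h 2 2 (by decide) (by decide) (by decide) (by decide)
    have B3 := h 2 3 (by decide) (by decide) (by decide) (by decide)
    have B4 := h 2 4 (by decide) (by decide) (by decide) (by decide)
    rw [dbar, dif_pos (by decide), det2 x _ A1 A2] at B1 B2 B3 B4
    simp only [Polynomial.coeff_add, Polynomial.coeff_C_mul, Polynomial.coeff_X_pow,
      Polynomial.coeff_C] at B1 B2 B3 B4
    norm_num at B1 B2 B3 B4
    have C1 := h 3 1 (by decide) (by decide) (by decide) (by decide)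
    have C2 := h 3 2 (by decide) (by decide) (by decide) (by decide)
    have C3 := h 3 3 (by decide) (by decide) (by decide) (by decide)
    have C4 := h 3 4 (by decide) (by decide) (by decide) (by decide)
    have C5 := h 3 5 (by decide) (by decide) (by decide) (by decide)
    have C6 := h 3 6 (by decide) (by decide) (by decide) (by decide)
    rw [dbar, dif_pos (by decide), det3 x _ A1 A2 B1 (sub_eq_zero.1 B2) rfl rfl rfl rfl rfl rfl rfl
      rfl rfl rfl rfl rfl rfl rfl] at C1 C2 C3 C4 C5 C6
    have D1 := (coeff6 _ _ _ _ _ _).1.symm.trans C1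
    have D2 := (coeff6 _ _ _ _ _ _).2.1.symm.trans C2
    have D3 := (coeff6 _ _ _ _ _ _).2.2.1.symm.trans C3
    have D4 := (coeff6 _ _ _ _ _ _).2.2.2.1.symm.trans C4
    have D5 := (coeff6 _ _ _ _ _ _).2.2.2.2.1.symm.trans C5
    have D6 := (coeff6 _ _ _ _ _ _).2.2.2.2.2.symm.trans C6
    clear C1 C2 C3 C4 C5 C6 h
    have Q0 : x (0, 1, 1) * x (1, 0, 1) = 0 := by simpa using B4
    have Q1 : x (0, 1, 1) * x (1, 0, 0) + x (0, 1, 0) * x (1, 0, 1) = 0 := by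
      linear_combination -B3
    rw [Q0, Q1] at D4 D5
    rw [Q1] at D3
    rw [Q0] at D6
    simp only [mul_zero, sub_zero, neg_eq_zero] at D3 D4 D5 D6
    refine ⟨⟨Q0, Q1, ?_, ?_, ?_, ?_⟩, ?_⟩
    · exact D6
    · exact D5
    · exact D4
    · exact D3
    · funext ⟨a, b, t⟩
      fin_cases a <;> fin_cases b <;> fin_cases t
      exacts [A1.symm, A2.symm, rfl, rfl, rfl, rfl, rfl, rfl, B1.symm, (sub_eq_zero.1 B2).symm,
        rfl, rfl, rfl, rfl, rfl, rfl, D1.symm, (sub_eq_zero.1 D2).symm]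
  · rintro ⟨hE, hx⟩
    generalize Prj x = z at hE hx
    subst hx
    obtain ⟨q0, q1, r0, r1, r2, r3⟩ := hE
    intro m j hm1 hm3 hj1 hj
    rw [dbar, dif_pos hm3]
    interval_cases m
    · rw [det1]
      have e1 : Emb z (0, 0, 0) = 0 := rfl
      have e2 : Emb z (0, 0, 1) = 0 := rfl
      rw [e1, e2]
      interval_cases j <;> simp [Polynomial.coeff_X_pow]
    · rw [det2 _ _ rfl rfl]
      have e1 : Emb z (1, 1, 0) = 0 := rfl
      have e2 : Emb z (1, 1, 1) - Emb z (0, 1, 0) * Emb z (1, 0, 0) = 0 := sub_self _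
      have e3 : Emb z (0, 1, 1) * Emb z (1, 0, 0) + Emb z (0, 1, 0) * Emb z (1, 0, 1) = 0 := q1
      have e4 : Emb z (0, 1, 1) * Emb z (1, 0, 1) = 0 := q0
      rw [e1, e2, e3, e4]
      interval_cases j <;> simp [Polynomial.coeff_X_pow]
    · rw [det3 (Emb z) _ (a0 := z 0) (a1 := z 1) (b0 := z 2) (b1 := z 3) (f0 := z 4) (f1 := z 5)
        (g0 := z 6) (g1 := z 7) (h0 := z 8) (h1 := z 9) (i0 := z 10) (i1 := z 11) (w1 := 0)
        (w0 := z 5 * z 9 + z 7 * z 11) rfl rfl rfl rfl rfl rfl rfl rfl rfl rfl rfl rfl rfl rfl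
        rfl rfl rfl rfl]
      rw [r0, r1, r2, r3, q0, q1]
      interval_cases j <;> simp [Polynomial.coeff_X_pow]


/-- transposition on reduced coordinates -/
def Tr (z : Fin 12 → k) : Fin 12 → k :=
  ![z 2, z 3, z 0, z 1, z 8, z 9, z 10, z 11, z 4, z 5, z 6, z 7]

lemma tr_tr (z : Fin 12 → k) : Tr (Tr z) = z := by
  funext i
  fin_cases i <;> rfl

lemma tr_E (z : Fin 12 → k) (h : E12v z) : E12v (Tr z) := by
  obtain ⟨q0, q1, r0, r1, r2, r3⟩ := h
  refine ⟨?_, ?_, ?_, ?_, ?_, ?_⟩ <;> simp only [Tr, Matrix.cons_val]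
  · linear_combination q0
  · linear_combination q1
  · linear_combination r0
  · linear_combination r1
  · linear_combination r2
  · linear_combination r3

lemma PF.comp {ι κ : Type*} {F : (κ → k) → k} {G : (ι → k) → (κ → k)} (hF : PF F)
    (hG : ∀ c, PF (fun y => G y c)) : PF (fun y => F (G y)) := by
  obtain ⟨p, hp⟩ := hF
  choose P hP using hG
  refine ⟨MvPolynomial.bind₁ P p, fun y => ?_⟩
  have e := MvPolynomial.eval₂Hom_bind₁ (RingHom.id k) y P p
  have e' : G y = fun c => MvPolynomial.eval y (P c) := funext fun c => hP c y
  change F (G y) = _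
  rw [hp, e', MvPolynomial.eval, MvPolynomial.eval, e]

lemma tr_PF (c : Fin 12) : PF (fun z : Fin 12 → k => Tr z c) := by
  fin_cases c
  exacts [PF.var 2, PF.var 3, PF.var 0, PF.var 1, PF.var 8, PF.var 9, PF.var 10, PF.var 11,
    PF.var 4, PF.var 5, PF.var 6, PF.var 7]

/-- data describing one component -/
structure CD (k : Type*) [Field k] where
  m : ℕ
  Q : Set (Fin m → k)
  φ : (Fin m → k) → (Fin 12 → k)
  ρ : (Fin 12 → k) → (Fin m → k)
  W : (Fin 12 → k) → Prop
  hQc : IsClosed Q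
  hQi : IsIrreducible Q
  hQd : topologicalKrullDim Q = (6 : ℕ)
  hφ : ∀ c, PF (fun y => φ y c)
  hρ : ∀ c, PF (fun y => ρ y c)
  hr : ∀ y, ρ (φ y) = y
  hW : ∀ y ∈ Q, W (φ y)
  hWQ : ∀ z, W z → ρ z ∈ Q
  hWz : ∀ z, W z → φ (ρ z) = z
  hE : ∀ z, W z → E12v z

/-- transposed component -/
def CD.tr (D : CD k) : CD k where
  m := D.m
  Q := D.Q
  φ := fun y => Tr (D.φ y)
  ρ := fun z => D.ρ (Tr z)
  W := fun z => D.W (Tr z)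
  hQc := D.hQc
  hQi := D.hQi
  hQd := D.hQd
  hφ := fun c => PF.comp (tr_PF c) D.hφ
  hρ := fun c => PF.comp (D.hρ c) tr_PF
  hr := fun y => by rw [tr_tr, D.hr]
  hW := fun y hy => by
    rw [tr_tr]
    exact D.hW y hy
  hWQ := fun z hz => D.hWQ _ hz
  hWz := fun z hz => by rw [D.hWz _ hz, tr_tr]
  hE := fun z hz => by
    have := tr_E _ (D.hE _ hz)
    rwa [tr_tr] at this

/-- the subset of the variety attached to component data -/
def CD.S (D : CD k) : Set (GTsYang k 3 2) := {v | D.W (Prj v.1)}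

lemma emb_PF (c : Fin 3 × Fin 3 × Fin 2) : PF (fun z : Fin 12 → k => Emb z c) := by
  obtain ⟨a, b, t⟩ := c
  fin_cases a <;> fin_cases b <;> fin_cases t
  exacts [PF.const 0, PF.const 0, PF.var 1, PF.var 0, PF.var 5, PF.var 4, PF.var 3, PF.var 2,
    PF.const 0, (PF.var 1).mul (PF.var 3), PF.var 7, PF.var 6, PF.var 9, PF.var 8, PF.var 11,
    PF.var 10, PF.const 0, ((PF.var 5).mul (PF.var 9)).plus ((PF.var 7).mul (PF.var 11))]

lemma prj_PF (c : Fin 12) : PF (fun x : Fin 3 × Fin 3 × Fin 2 → k => Prj x c) := by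
  fin_cases c <;> exact PF.var _

lemma CD.closed (D : CD k) : IsClosed D.S := by
  have h : D.S = (fun v : GTsYang k 3 2 => Prj v.1) ⁻¹'
      (D.ρ ⁻¹' D.Q ∩ ⋂ c, {z | D.φ (D.ρ z) c = z c}) := by
    ext v
    simp only [CD.S, Set.mem_ofPred_eq, Set.mem_preimage, Set.mem_inter_iff, Set.mem_iInter]
    constructor
    · intro hv
      exact ⟨D.hWQ _ hv, fun c => congrFun (D.hWz _ hv) c⟩
    · rintro ⟨h1, h2⟩
      have := D.hW _ h1
      rwa [funext h2] at this
  rw [h]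
  refine IsClosed.preimage ((zt_cont prj_PF).comp continuous_subtype_val) (IsClosed.inter ?_ ?_)
  · exact D.hQc.preimage (zt_cont D.hρ)
  · exact isClosed_iInter fun c => PF.isClosed_eq (PF.comp (D.hφ c) D.hρ) (PF.var c)

/-- the component is homeomorphic to its model -/
def CD.homeo (D : CD k) : D.Q ≃ₜ D.S where
  toFun y := ⟨⟨Emb (D.φ y.1), by
    rw [gts_iff, prj_emb]
    exact ⟨D.hE _ (D.hW _ y.2), rfl⟩⟩, by
    change D.W (Prj (Emb (D.φ y.1)))
    rw [prj_emb]
    exact D.hW _ y.2⟩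
  invFun v := ⟨D.ρ (Prj v.1.1), D.hWQ _ v.2⟩
  left_inv y := by
    apply Subtype.ext
    change D.ρ (Prj (Emb (D.φ y.1))) = y.1
    rw [prj_emb, D.hr]
  right_inv v := by
    apply Subtype.ext
    apply Subtype.ext
    change Emb (D.φ (D.ρ (Prj v.1.1))) = v.1.1
    rw [D.hWz _ v.2]
    exact ((gts_iff _).1 v.1.2).2
  continuous_toFun := by
    refine Continuous.subtype_mk (Continuous.subtype_mk ?_ _) _
    exact ((zt_cont emb_PF).comp (zt_cont D.hφ)).comp continuous_subtype_val
  continuous_invFun := by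
    refine Continuous.subtype_mk ?_ _
    exact ((zt_cont D.hρ).comp (zt_cont prj_PF)).comp
      (continuous_subtype_val.comp continuous_subtype_val)

lemma CD.dim (D : CD k) : topologicalKrullDim D.S = (6 : ℕ) := by
  rw [← D.hQd]
  exact (IsHomeomorph.topologicalKrullDim_eq _ D.homeo.isHomeomorph).symm

lemma CD.irr (D : CD k) : IsIrreducible D.S := by
  have h : IrreducibleSpace D.Q := isIrreducible_iff_irreducibleSpace.1 D.hQi
  have := (IrreducibleSpace.isIrreducible_univ D.Q).image (fun y => (D.homeo y).1)
    (continuous_subtype_val.comp D.homeo.continuous).continuousOn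
  convert this
  ext v
  constructor
  · intro hv
    refine ⟨D.homeo.symm ⟨v, hv⟩, trivial, ?_⟩
    simp
  · rintro ⟨y, _, rfl⟩
    exact (D.homeo y).2


/-- all entries vanish -/
def ZL {R : Type*} [CommRing R] (l : List R) : Prop := ∀ e ∈ l, e = 0

/-- equations of a component -/
def LA1 {R : Type*} [CommRing R] (z : Fin 12 → R) : List R :=
  [z 0, z 2, z 4, z 5, z 6, z 7]

lemma WA1 (z : Fin 12 → k) : ZL (LA1 z) ↔ z 0 = 0 ∧ z 2 = 0 ∧ z 4 = 0 ∧ z 5 = 0 ∧ z 6 = 0 ∧ z 7 = 0 := by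
  simp [ZL, LA1]

lemma MA1 (p : Fin 12 → ℤ) : (LA1 (fun c => (p c : k))) = (LA1 p).map (fun e : ℤ => (e : k)) := by
  simp [LA1]

lemma EA1 (z : Fin 12 → k) (h : ZL (LA1 z)) : E12v z := by
  rw [WA1] at h
  obtain ⟨h1, h2, h3, h4, h5, h6⟩ := h
  refine ⟨?_, ?_, ?_, ?_, ?_, ?_⟩ <;> grind

/-- component data -/
def CA1 (k : Type*) [Field k] [Infinite k] : CD k where
  m := 6
  Q := Set.univ
  φ := fun y => ![0, y 0, 0, y 1, 0, 0, 0, 0, y 2, y 3, y 4, y 5]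
  ρ := fun z => ![z 1, z 3, z 8, z 9, z 10, z 11]
  W := fun z => ZL (LA1 z)
  hQc := isClosed_univ
  hQi := IrreducibleSpace.isIrreducible_univ _
  hQd := univ_dim 6
  hφ := fun c => by
    fin_cases c
    exacts [PF.const 0, (PF.var 0), PF.const 0, (PF.var 1), PF.const 0, PF.const 0, PF.const 0, PF.const 0, (PF.var 2), (PF.var 3), (PF.var 4), (PF.var 5)]
  hρ := fun c => by
    fin_cases c
    exacts [(PF.var 1), (PF.var 3), (PF.var 8), (PF.var 9), (PF.var 10), (PF.var 11)]
  hr := fun y => by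
    funext c
    fin_cases c <;> simp
  hW := fun y hy => by
    rw [WA1]
    clear hy
    refine ⟨?_, ?_, ?_, ?_, ?_, ?_⟩ <;> simp <;> grind
  hWQ := fun z h => by
    rw [WA1] at h
    obtain ⟨h1, h2, h3, h4, h5, h6⟩ := h
    trivial
  hWz := fun z h => by
    rw [WA1] at h
    obtain ⟨h1, h2, h3, h4, h5, h6⟩ := h
    funext c
    fin_cases c <;> simp <;> grind
  hE := EA1

/-- equations of a component -/
def LA3 {R : Type*} [CommRing R] (z : Fin 12 → R) : List R :=
  [z 0, z 2, z 4, z 8, z 6-z 3*z 5, z 10-z 1*z 9]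

lemma WA3 (z : Fin 12 → k) : ZL (LA3 z) ↔ z 0 = 0 ∧ z 2 = 0 ∧ z 4 = 0 ∧ z 8 = 0 ∧ z 6-z 3*z 5 = 0 ∧ z 10-z 1*z 9 = 0 := by
  simp [ZL, LA3]

lemma MA3 (p : Fin 12 → ℤ) : (LA3 (fun c => (p c : k))) = (LA3 p).map (fun e : ℤ => (e : k)) := by
  simp [LA3]

lemma EA3 (z : Fin 12 → k) (h : ZL (LA3 z)) : E12v z := by
  rw [WA3] at h
  obtain ⟨h1, h2, h3, h4, h5, h6⟩ := h
  refine ⟨?_, ?_, ?_, ?_, ?_, ?_⟩ <;> grind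

/-- component data -/
def CA3 (k : Type*) [Field k] [Infinite k] : CD k where
  m := 6
  Q := Set.univ
  φ := fun y => ![0, y 0, 0, y 1, 0, y 2, y 1*y 2, y 3, 0, y 4, y 0*y 4, y 5]
  ρ := fun z => ![z 1, z 3, z 5, z 7, z 9, z 11]
  W := fun z => ZL (LA3 z)
  hQc := isClosed_univ
  hQi := IrreducibleSpace.isIrreducible_univ _
  hQd := univ_dim 6
  hφ := fun c => by
    fin_cases c
    exacts [PF.const 0, (PF.var 0), PF.const 0, (PF.var 1), PF.const 0, (PF.var 2), ((PF.var 1).mul (PF.var 2)), (PF.var 3), PF.const 0, (PF.var 4), ((PF.var 0).mul (PF.var 4)), (PF.var 5)]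
  hρ := fun c => by
    fin_cases c
    exacts [(PF.var 1), (PF.var 3), (PF.var 5), (PF.var 7), (PF.var 9), (PF.var 11)]
  hr := fun y => by
    funext c
    fin_cases c <;> simp
  hW := fun y hy => by
    rw [WA3]
    clear hy
    refine ⟨?_, ?_, ?_, ?_, ?_, ?_⟩ <;> simp <;> grind
  hWQ := fun z h => by
    rw [WA3] at h
    obtain ⟨h1, h2, h3, h4, h5, h6⟩ := h
    trivial
  hWz := fun z h => by
    rw [WA3] at h
    obtain ⟨h1, h2, h3, h4, h5, h6⟩ := h
    funext c
    fin_cases c <;> simp <;> grind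
  hE := EA3

/-- equations of a component -/
def LA4 {R : Type*} [CommRing R] (z : Fin 12 → R) : List R :=
  [z 0, z 2, z 4, z 8, z 6-z 3*z 5, z 7]

lemma WA4 (z : Fin 12 → k) : ZL (LA4 z) ↔ z 0 = 0 ∧ z 2 = 0 ∧ z 4 = 0 ∧ z 8 = 0 ∧ z 6-z 3*z 5 = 0 ∧ z 7 = 0 := by
  simp [ZL, LA4]

lemma MA4 (p : Fin 12 → ℤ) : (LA4 (fun c => (p c : k))) = (LA4 p).map (fun e : ℤ => (e : k)) := by
  simp [LA4]

lemma EA4 (z : Fin 12 → k) (h : ZL (LA4 z)) : E12v z := by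
  rw [WA4] at h
  obtain ⟨h1, h2, h3, h4, h5, h6⟩ := h
  refine ⟨?_, ?_, ?_, ?_, ?_, ?_⟩ <;> grind

/-- component data -/
def CA4 (k : Type*) [Field k] [Infinite k] : CD k where
  m := 6
  Q := Set.univ
  φ := fun y => ![0, y 0, 0, y 1, 0, y 2, y 1*y 2, 0, 0, y 3, y 4, y 5]
  ρ := fun z => ![z 1, z 3, z 5, z 9, z 10, z 11]
  W := fun z => ZL (LA4 z)
  hQc := isClosed_univ
  hQi := IrreducibleSpace.isIrreducible_univ _
  hQd := univ_dim 6
  hφ := fun c => by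
    fin_cases c
    exacts [PF.const 0, (PF.var 0), PF.const 0, (PF.var 1), PF.const 0, (PF.var 2), ((PF.var 1).mul (PF.var 2)), PF.const 0, PF.const 0, (PF.var 3), (PF.var 4), (PF.var 5)]
  hρ := fun c => by
    fin_cases c
    exacts [(PF.var 1), (PF.var 3), (PF.var 5), (PF.var 9), (PF.var 10), (PF.var 11)]
  hr := fun y => by
    funext c
    fin_cases c <;> simp
  hW := fun y hy => by
    rw [WA4]
    clear hy
    refine ⟨?_, ?_, ?_, ?_, ?_, ?_⟩ <;> simp <;> grind
  hWQ := fun z h => by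
    rw [WA4] at h
    obtain ⟨h1, h2, h3, h4, h5, h6⟩ := h
    trivial
  hWz := fun z h => by
    rw [WA4] at h
    obtain ⟨h1, h2, h3, h4, h5, h6⟩ := h
    funext c
    fin_cases c <;> simp <;> grind
  hE := EA4

/-- equations of a component -/
def LB1 {R : Type*} [CommRing R] (z : Fin 12 → R) : List R :=
  [z 0, z 1, z 4, z 5, z 6, z 7]

lemma WB1 (z : Fin 12 → k) : ZL (LB1 z) ↔ z 0 = 0 ∧ z 1 = 0 ∧ z 4 = 0 ∧ z 5 = 0 ∧ z 6 = 0 ∧ z 7 = 0 := by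
  simp [ZL, LB1]

lemma MB1 (p : Fin 12 → ℤ) : (LB1 (fun c => (p c : k))) = (LB1 p).map (fun e : ℤ => (e : k)) := by
  simp [LB1]

lemma EB1 (z : Fin 12 → k) (h : ZL (LB1 z)) : E12v z := by
  rw [WB1] at h
  obtain ⟨h1, h2, h3, h4, h5, h6⟩ := h
  refine ⟨?_, ?_, ?_, ?_, ?_, ?_⟩ <;> grind

/-- component data -/
def CB1 (k : Type*) [Field k] [Infinite k] : CD k where
  m := 6
  Q := Set.univ
  φ := fun y => ![0, 0, y 0, y 1, 0, 0, 0, 0, y 2, y 3, y 4, y 5]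
  ρ := fun z => ![z 2, z 3, z 8, z 9, z 10, z 11]
  W := fun z => ZL (LB1 z)
  hQc := isClosed_univ
  hQi := IrreducibleSpace.isIrreducible_univ _
  hQd := univ_dim 6
  hφ := fun c => by
    fin_cases c
    exacts [PF.const 0, PF.const 0, (PF.var 0), (PF.var 1), PF.const 0, PF.const 0, PF.const 0, PF.const 0, (PF.var 2), (PF.var 3), (PF.var 4), (PF.var 5)]
  hρ := fun c => by
    fin_cases c
    exacts [(PF.var 2), (PF.var 3), (PF.var 8), (PF.var 9), (PF.var 10), (PF.var 11)]
  hr := fun y => by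
    funext c
    fin_cases c <;> simp
  hW := fun y hy => by
    rw [WB1]
    clear hy
    refine ⟨?_, ?_, ?_, ?_, ?_, ?_⟩ <;> simp <;> grind
  hWQ := fun z h => by
    rw [WB1] at h
    obtain ⟨h1, h2, h3, h4, h5, h6⟩ := h
    trivial
  hWz := fun z h => by
    rw [WB1] at h
    obtain ⟨h1, h2, h3, h4, h5, h6⟩ := h
    funext c
    fin_cases c <;> simp <;> grind
  hE := EB1

/-- equations of a component -/
def LB2 {R : Type*} [CommRing R] (z : Fin 12 → R) : List R :=
  [z 0, z 1, z 4, z 5, z 10, z 11]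

lemma WB2 (z : Fin 12 → k) : ZL (LB2 z) ↔ z 0 = 0 ∧ z 1 = 0 ∧ z 4 = 0 ∧ z 5 = 0 ∧ z 10 = 0 ∧ z 11 = 0 := by
  simp [ZL, LB2]

lemma MB2 (p : Fin 12 → ℤ) : (LB2 (fun c => (p c : k))) = (LB2 p).map (fun e : ℤ => (e : k)) := by
  simp [LB2]

lemma EB2 (z : Fin 12 → k) (h : ZL (LB2 z)) : E12v z := by
  rw [WB2] at h
  obtain ⟨h1, h2, h3, h4, h5, h6⟩ := h
  refine ⟨?_, ?_, ?_, ?_, ?_, ?_⟩ <;> grind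

/-- component data -/
def CB2 (k : Type*) [Field k] [Infinite k] : CD k where
  m := 6
  Q := Set.univ
  φ := fun y => ![0, 0, y 0, y 1, 0, 0, y 2, y 3, y 4, y 5, 0, 0]
  ρ := fun z => ![z 2, z 3, z 6, z 7, z 8, z 9]
  W := fun z => ZL (LB2 z)
  hQc := isClosed_univ
  hQi := IrreducibleSpace.isIrreducible_univ _
  hQd := univ_dim 6
  hφ := fun c => by
    fin_cases c
    exacts [PF.const 0, PF.const 0, (PF.var 0), (PF.var 1), PF.const 0, PF.const 0, (PF.var 2), (PF.var 3), (PF.var 4), (PF.var 5), PF.const 0, PF.const 0]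
  hρ := fun c => by
    fin_cases c
    exacts [(PF.var 2), (PF.var 3), (PF.var 6), (PF.var 7), (PF.var 8), (PF.var 9)]
  hr := fun y => by
    funext c
    fin_cases c <;> simp
  hW := fun y hy => by
    rw [WB2]
    clear hy
    refine ⟨?_, ?_, ?_, ?_, ?_, ?_⟩ <;> simp <;> grind
  hWQ := fun z h => by
    rw [WB2] at h
    obtain ⟨h1, h2, h3, h4, h5, h6⟩ := h
    trivial
  hWz := fun z h => by
    rw [WB2] at h
    obtain ⟨h1, h2, h3, h4, h5, h6⟩ := h
    funext c
    fin_cases c <;> simp <;> grind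
  hE := EB2

/-- equations of a component -/
def LB3 {R : Type*} [CommRing R] (z : Fin 12 → R) : List R :=
  [z 0, z 1, z 4, z 5, z 6, z 10]

lemma WB3 (z : Fin 12 → k) : ZL (LB3 z) ↔ z 0 = 0 ∧ z 1 = 0 ∧ z 4 = 0 ∧ z 5 = 0 ∧ z 6 = 0 ∧ z 10 = 0 := by
  simp [ZL, LB3]

lemma MB3 (p : Fin 12 → ℤ) : (LB3 (fun c => (p c : k))) = (LB3 p).map (fun e : ℤ => (e : k)) := by
  simp [LB3]

lemma EB3 (z : Fin 12 → k) (h : ZL (LB3 z)) : E12v z := by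
  rw [WB3] at h
  obtain ⟨h1, h2, h3, h4, h5, h6⟩ := h
  refine ⟨?_, ?_, ?_, ?_, ?_, ?_⟩ <;> grind

/-- component data -/
def CB3 (k : Type*) [Field k] [Infinite k] : CD k where
  m := 6
  Q := Set.univ
  φ := fun y => ![0, 0, y 0, y 1, 0, 0, 0, y 2, y 3, y 4, 0, y 5]
  ρ := fun z => ![z 2, z 3, z 7, z 8, z 9, z 11]
  W := fun z => ZL (LB3 z)
  hQc := isClosed_univ
  hQi := IrreducibleSpace.isIrreducible_univ _
  hQd := univ_dim 6
  hφ := fun c => by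
    fin_cases c
    exacts [PF.const 0, PF.const 0, (PF.var 0), (PF.var 1), PF.const 0, PF.const 0, PF.const 0, (PF.var 2), (PF.var 3), (PF.var 4), PF.const 0, (PF.var 5)]
  hρ := fun c => by
    fin_cases c
    exacts [(PF.var 2), (PF.var 3), (PF.var 7), (PF.var 8), (PF.var 9), (PF.var 11)]
  hr := fun y => by
    funext c
    fin_cases c <;> simp
  hW := fun y hy => by
    rw [WB3]
    clear hy
    refine ⟨?_, ?_, ?_, ?_, ?_, ?_⟩ <;> simp <;> grind
  hWQ := fun z h => by
    rw [WB3] at h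
    obtain ⟨h1, h2, h3, h4, h5, h6⟩ := h
    trivial
  hWz := fun z h => by
    rw [WB3] at h
    obtain ⟨h1, h2, h3, h4, h5, h6⟩ := h
    funext c
    fin_cases c <;> simp <;> grind
  hE := EB3

/-- equations of a component -/
def LB4 {R : Type*} [CommRing R] (z : Fin 12 → R) : List R :=
  [z 0, z 1, z 8, z 9, z 10, z 11]

lemma WB4 (z : Fin 12 → k) : ZL (LB4 z) ↔ z 0 = 0 ∧ z 1 = 0 ∧ z 8 = 0 ∧ z 9 = 0 ∧ z 10 = 0 ∧ z 11 = 0 := by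
  simp [ZL, LB4]

lemma MB4 (p : Fin 12 → ℤ) : (LB4 (fun c => (p c : k))) = (LB4 p).map (fun e : ℤ => (e : k)) := by
  simp [LB4]

lemma EB4 (z : Fin 12 → k) (h : ZL (LB4 z)) : E12v z := by
  rw [WB4] at h
  obtain ⟨h1, h2, h3, h4, h5, h6⟩ := h
  refine ⟨?_, ?_, ?_, ?_, ?_, ?_⟩ <;> grind

/-- component data -/
def CB4 (k : Type*) [Field k] [Infinite k] : CD k where
  m := 6
  Q := Set.univ
  φ := fun y => ![0, 0, y 0, y 1, y 2, y 3, y 4, y 5, 0, 0, 0, 0]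
  ρ := fun z => ![z 2, z 3, z 4, z 5, z 6, z 7]
  W := fun z => ZL (LB4 z)
  hQc := isClosed_univ
  hQi := IrreducibleSpace.isIrreducible_univ _
  hQd := univ_dim 6
  hφ := fun c => by
    fin_cases c
    exacts [PF.const 0, PF.const 0, (PF.var 0), (PF.var 1), (PF.var 2), (PF.var 3), (PF.var 4), (PF.var 5), PF.const 0, PF.const 0, PF.const 0, PF.const 0]
  hρ := fun c => by
    fin_cases c
    exacts [(PF.var 2), (PF.var 3), (PF.var 4), (PF.var 5), (PF.var 6), (PF.var 7)]
  hr := fun y => by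
    funext c
    fin_cases c <;> simp
  hW := fun y hy => by
    rw [WB4]
    clear hy
    refine ⟨?_, ?_, ?_, ?_, ?_, ?_⟩ <;> simp <;> grind
  hWQ := fun z h => by
    rw [WB4] at h
    obtain ⟨h1, h2, h3, h4, h5, h6⟩ := h
    trivial
  hWz := fun z h => by
    rw [WB4] at h
    obtain ⟨h1, h2, h3, h4, h5, h6⟩ := h
    funext c
    fin_cases c <;> simp <;> grind
  hE := EB4

/-- equations of a component -/
def LB5 {R : Type*} [CommRing R] (z : Fin 12 → R) : List R :=
  [z 0, z 1, z 10, z 11, z 4, z 8]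

lemma WB5 (z : Fin 12 → k) : ZL (LB5 z) ↔ z 0 = 0 ∧ z 1 = 0 ∧ z 10 = 0 ∧ z 11 = 0 ∧ z 4 = 0 ∧ z 8 = 0 := by
  simp [ZL, LB5]

lemma MB5 (p : Fin 12 → ℤ) : (LB5 (fun c => (p c : k))) = (LB5 p).map (fun e : ℤ => (e : k)) := by
  simp [LB5]

lemma EB5 (z : Fin 12 → k) (h : ZL (LB5 z)) : E12v z := by
  rw [WB5] at h
  obtain ⟨h1, h2, h3, h4, h5, h6⟩ := h
  refine ⟨?_, ?_, ?_, ?_, ?_, ?_⟩ <;> grind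

/-- component data -/
def CB5 (k : Type*) [Field k] [Infinite k] : CD k where
  m := 6
  Q := Set.univ
  φ := fun y => ![0, 0, y 0, y 1, 0, y 2, y 3, y 4, 0, y 5, 0, 0]
  ρ := fun z => ![z 2, z 3, z 5, z 6, z 7, z 9]
  W := fun z => ZL (LB5 z)
  hQc := isClosed_univ
  hQi := IrreducibleSpace.isIrreducible_univ _
  hQd := univ_dim 6
  hφ := fun c => by
    fin_cases c
    exacts [PF.const 0, PF.const 0, (PF.var 0), (PF.var 1), PF.const 0, (PF.var 2), (PF.var 3), (PF.var 4), PF.const 0, (PF.var 5), PF.const 0, PF.const 0]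
  hρ := fun c => by
    fin_cases c
    exacts [(PF.var 2), (PF.var 3), (PF.var 5), (PF.var 6), (PF.var 7), (PF.var 9)]
  hr := fun y => by
    funext c
    fin_cases c <;> simp
  hW := fun y hy => by
    rw [WB5]
    clear hy
    refine ⟨?_, ?_, ?_, ?_, ?_, ?_⟩ <;> simp <;> grind
  hWQ := fun z h => by
    rw [WB5] at h
    obtain ⟨h1, h2, h3, h4, h5, h6⟩ := h
    trivial
  hWz := fun z h => by
    rw [WB5] at h
    obtain ⟨h1, h2, h3, h4, h5, h6⟩ := h
    funext c
    fin_cases c <;> simp <;> grind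
  hE := EB5

/-- equations of a component -/
def LD1 {R : Type*} [CommRing R] (z : Fin 12 → R) : List R :=
  [z 0, z 1, z 2, z 4, z 10, z 5*z 8-z 11*(z 3*z 5-z 6)]

lemma WD1 (z : Fin 12 → k) : ZL (LD1 z) ↔ z 0 = 0 ∧ z 1 = 0 ∧ z 2 = 0 ∧ z 4 = 0 ∧ z 10 = 0 ∧ z 5*z 8-z 11*(z 3*z 5-z 6) = 0 := by
  simp [ZL, LD1]

lemma MD1 (p : Fin 12 → ℤ) : (LD1 (fun c => (p c : k))) = (LD1 p).map (fun e : ℤ => (e : k)) := by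
  simp [LD1]

lemma ED1 (z : Fin 12 → k) (h : ZL (LD1 z)) : E12v z := by
  rw [WD1] at h
  obtain ⟨h1, h2, h3, h4, h5, h6⟩ := h
  refine ⟨?_, ?_, ?_, ?_, ?_, ?_⟩ <;> grind

/-- component data -/
def CD1 (k : Type*) [Field k] [Infinite k] : CD k where
  m := 7
  Q := Quad k 3
  φ := fun y => ![0, 0, 0, y 4, 0, y 0, y 4*y 0-y 3, y 5, y 1, y 6, 0, y 2]
  ρ := fun z => ![z 5, z 8, z 11, z 3*z 5-z 6, z 3, z 7, z 9]
  W := fun z => ZL (LD1 z)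
  hQc := quad_closed 3
  hQi := quad_irr 3
  hQd := quad3_dim
  hφ := fun c => by
    fin_cases c
    exacts [PF.const 0, PF.const 0, PF.const 0, (PF.var 4), PF.const 0, (PF.var 0), (((PF.var 4).mul (PF.var 0)).sub (PF.var 3)), (PF.var 5), (PF.var 1), (PF.var 6), PF.const 0, (PF.var 2)]
  hρ := fun c => by
    fin_cases c
    exacts [(PF.var 5), (PF.var 8), (PF.var 11), (((PF.var 3).mul (PF.var 5)).sub (PF.var 6)), (PF.var 3), (PF.var 7), (PF.var 9)]
  hr := fun y => by
    funext c
    fin_cases c <;> simp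
  hW := fun y hy => by
    rw [WD1]
    have hq : _ = _ := hy
    refine ⟨?_, ?_, ?_, ?_, ?_, ?_⟩ <;> simp <;> grind
  hWQ := fun z h => by
    rw [WD1] at h
    obtain ⟨h1, h2, h3, h4, h5, h6⟩ := h
    change _ * _ = _ * _
    simp
    grind
  hWz := fun z h => by
    rw [WD1] at h
    obtain ⟨h1, h2, h3, h4, h5, h6⟩ := h
    funext c
    fin_cases c <;> simp <;> grind
  hE := ED1

/-- equations of a component -/
def LD2 {R : Type*} [CommRing R] (z : Fin 12 → R) : List R :=
  [z 0, z 1, z 2, z 4, z 6-z 3*z 5, z 5*z 8+z 7*z 10]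

lemma WD2 (z : Fin 12 → k) : ZL (LD2 z) ↔ z 0 = 0 ∧ z 1 = 0 ∧ z 2 = 0 ∧ z 4 = 0 ∧ z 6-z 3*z 5 = 0 ∧ z 5*z 8+z 7*z 10 = 0 := by
  simp [ZL, LD2]

lemma MD2 (p : Fin 12 → ℤ) : (LD2 (fun c => (p c : k))) = (LD2 p).map (fun e : ℤ => (e : k)) := by
  simp [LD2]

lemma ED2 (z : Fin 12 → k) (h : ZL (LD2 z)) : E12v z := by
  rw [WD2] at h
  obtain ⟨h1, h2, h3, h4, h5, h6⟩ := h
  refine ⟨?_, ?_, ?_, ?_, ?_, ?_⟩ <;> grind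

/-- component data -/
def CD2 (k : Type*) [Field k] [Infinite k] : CD k where
  m := 7
  Q := Quad k 3
  φ := fun y => ![0, 0, 0, y 4, 0, y 0, y 4*y 0, y 2, y 1, y 5, -y 3, y 6]
  ρ := fun z => ![z 5, z 8, z 7, -z 10, z 3, z 9, z 11]
  W := fun z => ZL (LD2 z)
  hQc := quad_closed 3
  hQi := quad_irr 3
  hQd := quad3_dim
  hφ := fun c => by
    fin_cases c
    exacts [PF.const 0, PF.const 0, PF.const 0, (PF.var 4), PF.const 0, (PF.var 0), ((PF.var 4).mul (PF.var 0)), (PF.var 2), (PF.var 1), (PF.var 5), (PF.var 3).neg, (PF.var 6)]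
  hρ := fun c => by
    fin_cases c
    exacts [(PF.var 5), (PF.var 8), (PF.var 7), (PF.var 10).neg, (PF.var 3), (PF.var 9), (PF.var 11)]
  hr := fun y => by
    funext c
    fin_cases c <;> simp
  hW := fun y hy => by
    rw [WD2]
    have hq : _ = _ := hy
    refine ⟨?_, ?_, ?_, ?_, ?_, ?_⟩ <;> simp <;> grind
  hWQ := fun z h => by
    rw [WD2] at h
    obtain ⟨h1, h2, h3, h4, h5, h6⟩ := h
    change _ * _ = _ * _
    simp
    grind
  hWz := fun z h => by
    rw [WD2] at h
    obtain ⟨h1, h2, h3, h4, h5, h6⟩ := h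
    funext c
    fin_cases c <;> simp <;> grind
  hE := ED2

/-- equations of a component -/
def LD3 {R : Type*} [CommRing R] (z : Fin 12 → R) : List R :=
  [z 0, z 1, z 2, z 10, z 8-z 3*z 11, z 4*z 9+z 6*z 11]

lemma WD3 (z : Fin 12 → k) : ZL (LD3 z) ↔ z 0 = 0 ∧ z 1 = 0 ∧ z 2 = 0 ∧ z 10 = 0 ∧ z 8-z 3*z 11 = 0 ∧ z 4*z 9+z 6*z 11 = 0 := by
  simp [ZL, LD3]

lemma MD3 (p : Fin 12 → ℤ) : (LD3 (fun c => (p c : k))) = (LD3 p).map (fun e : ℤ => (e : k)) := by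
  simp [LD3]

lemma ED3 (z : Fin 12 → k) (h : ZL (LD3 z)) : E12v z := by
  rw [WD3] at h
  obtain ⟨h1, h2, h3, h4, h5, h6⟩ := h
  refine ⟨?_, ?_, ?_, ?_, ?_, ?_⟩ <;> grind

/-- component data -/
def CD3 (k : Type*) [Field k] [Infinite k] : CD k where
  m := 7
  Q := Quad k 3
  φ := fun y => ![0, 0, 0, y 4, y 0, y 5, y 2, y 6, -(y 4*y 3), y 1, 0, -y 3]
  ρ := fun z => ![z 4, z 9, z 6, -z 11, z 3, z 5, z 7]
  W := fun z => ZL (LD3 z)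
  hQc := quad_closed 3
  hQi := quad_irr 3
  hQd := quad3_dim
  hφ := fun c => by
    fin_cases c
    exacts [PF.const 0, PF.const 0, PF.const 0, (PF.var 4), (PF.var 0), (PF.var 5), (PF.var 2), (PF.var 6), ((PF.var 4).mul (PF.var 3)).neg, (PF.var 1), PF.const 0, (PF.var 3).neg]
  hρ := fun c => by
    fin_cases c
    exacts [(PF.var 4), (PF.var 9), (PF.var 6), (PF.var 11).neg, (PF.var 3), (PF.var 5), (PF.var 7)]
  hr := fun y => by
    funext c
    fin_cases c <;> simp
  hW := fun y hy => by
    rw [WD3]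
    have hq : _ = _ := hy
    refine ⟨?_, ?_, ?_, ?_, ?_, ?_⟩ <;> simp <;> grind
  hWQ := fun z h => by
    rw [WD3] at h
    obtain ⟨h1, h2, h3, h4, h5, h6⟩ := h
    change _ * _ = _ * _
    simp
    grind
  hWz := fun z h => by
    rw [WD3] at h
    obtain ⟨h1, h2, h3, h4, h5, h6⟩ := h
    funext c
    fin_cases c <;> simp <;> grind
  hE := ED3

/-- equations of a component -/
def LJ1 {R : Type*} [CommRing R] (z : Fin 12 → R) : List R :=
  [z 0, z 1, z 2, z 3, z 4*z 8+z 6*z 10, z 4*z 9+z 5*z 8+z 6*z 11+z 7*z 10]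

lemma WJ1 (z : Fin 12 → k) : ZL (LJ1 z) ↔ z 0 = 0 ∧ z 1 = 0 ∧ z 2 = 0 ∧ z 3 = 0 ∧ z 4*z 8+z 6*z 10 = 0 ∧ z 4*z 9+z 5*z 8+z 6*z 11+z 7*z 10 = 0 := by
  simp [ZL, LJ1]

lemma MJ1 (p : Fin 12 → ℤ) : (LJ1 (fun c => (p c : k))) = (LJ1 p).map (fun e : ℤ => (e : k)) := by
  simp [LJ1]

lemma EJ1 (z : Fin 12 → k) (h : ZL (LJ1 z)) : E12v z := by
  rw [WJ1] at h
  obtain ⟨h1, h2, h3, h4, h5, h6⟩ := h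
  refine ⟨?_, ?_, ?_, ?_, ?_, ?_⟩ <;> grind

/-- component data -/
def CJ1 (k : Type*) [Field k] [Infinite k] : CD k where
  m := 8
  Q := Jet k
  φ := fun y => ![0, 0, 0, 0, y 0, y 4, y 2, y 6, y 1, y 5, -y 3, -y 7]
  ρ := fun z => ![z 4, z 8, z 6, -z 10, z 5, z 9, z 7, -z 11]
  W := fun z => ZL (LJ1 z)
  hQc := jet_closed
  hQi := jet_irr
  hQd := jet_dim
  hφ := fun c => by
    fin_cases c
    exacts [PF.const 0, PF.const 0, PF.const 0, PF.const 0, (PF.var 0), (PF.var 4), (PF.var 2), (PF.var 6), (PF.var 1), (PF.var 5), (PF.var 3).neg, (PF.var 7).neg]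
  hρ := fun c => by
    fin_cases c
    exacts [(PF.var 4), (PF.var 8), (PF.var 6), (PF.var 10).neg, (PF.var 5), (PF.var 9), (PF.var 7), (PF.var 11).neg]
  hr := fun y => by
    funext c
    fin_cases c <;> simp
  hW := fun y hy => by
    rw [WJ1]
    obtain ⟨hq, hq2⟩ := hy
    refine ⟨?_, ?_, ?_, ?_, ?_, ?_⟩ <;> simp <;> grind
  hWQ := fun z h => by
    rw [WJ1] at h
    obtain ⟨h1, h2, h3, h4, h5, h6⟩ := h
    refine ⟨?_, ?_⟩
    all_goals simp
    all_goals grind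
  hWz := fun z h => by
    rw [WJ1] at h
    obtain ⟨h1, h2, h3, h4, h5, h6⟩ := h
    funext c
    fin_cases c <;> simp <;> grind
  hE := EJ1

/-- equations of all components -/
def LL {R : Type*} [CommRing R] : Fin 22 → (Fin 12 → R) → List R :=
  ![LA1, fun z => LA1 (Tr z), LA3, LA4, fun z => LA4 (Tr z), LB1, LB2, LB3, LB4, LB5, fun z => LB1 (Tr z), fun z => LB2 (Tr z), fun z => LB3 (Tr z), fun z => LB4 (Tr z), fun z => LB5 (Tr z), LD1, LD2, LD3, fun z => LD1 (Tr z), fun z => LD2 (Tr z), fun z => LD3 (Tr z), LJ1]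

/-- all components -/
def CC (k : Type*) [Field k] [Infinite k] : Fin 22 → CD k :=
  ![CA1 k, (CA1 k).tr, CA3 k, CA4 k, (CA4 k).tr, CB1 k, CB2 k, CB3 k, CB4 k, CB5 k, (CB1 k).tr, (CB2 k).tr, (CB3 k).tr, (CB4 k).tr, (CB5 k).tr, CD1 k, CD2 k, CD3 k, (CD1 k).tr, (CD2 k).tr, (CD3 k).tr, CJ1 k]

/-- test points -/
def PP : Fin 22 → Fin 12 → ℤ :=
  ![![0, 2, 0, 2, 0, 0, 0, 0, 2, -1, 1, 2],
    ![0, 2, 0, 1, 2, 1, -1, 1, 0, 0, 0, 0],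
    ![0, 2, 0, 1, 0, -1, -1, 2, 0, 1, 2, -1],
    ![0, 1, 0, -1, 0, 2, -2, 0, 0, 2, -1, 2],
    ![0, 2, 0, 2, 0, -1, 2, 2, 0, 2, 4, 0],
    ![0, 0, 2, 2, 0, 0, 0, 0, -1, -1, 1, -1],
    ![0, 0, -1, -1, 0, 0, 1, -1, -1, 2, 0, 0],
    ![0, 0, 1, -1, 0, 0, 0, 1, 2, 1, 0, -1],
    ![0, 0, 1, 2, 2, 2, -1, 1, 0, 0, 0, 0],
    ![0, 0, 2, 2, 0, 1, 1, 2, 0, -1, 0, 0],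
    ![1, -1, 0, 0, 2, 1, 1, -1, 0, 0, 0, 0],
    ![2, 1, 0, 0, -1, 1, 0, 0, 0, 0, 1, -1],
    ![2, -1, 0, 0, 2, 2, 0, 2, 0, 0, 0, 2],
    ![2, 2, 0, 0, 0, 0, 0, 0, 1, -1, 1, 1],
    ![2, 2, 0, 0, 0, 2, 0, 0, 0, -1, 2, 2],
    ![0, 0, 0, 2, 0, 1, 1, 2, 1, 2, 0, 1],
    ![0, 0, 0, 2, 0, -1, -2, -2, 4, 2, -2, 2],
    ![0, 0, 0, 1, -1, 1, 1, 1, 1, 1, 0, 1],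
    ![0, 1, 0, 0, -2, 1, 0, 2, 0, 2, 4, -1],
    ![0, 2, 0, 0, 2, 2, -4, -1, 0, -2, -4, -1],
    ![0, 1, 0, 0, -2, -2, 0, -2, -1, 1, 1, 1],
    ![0, 0, 0, 0, -1, 0, -2, -4, 4, 2, -2, 3]]

lemma CC_W [Infinite k] (j : Fin 22) (z : Fin 12 → k) : (CC k j).W z ↔ ZL (LL j z) := by
  fin_cases j <;> exact Iff.rfl

lemma tr_cast (p : Fin 12 → ℤ) : Tr (fun c => (p c : k)) = fun c => ((Tr p c : ℤ) : k) := by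
  funext c
  fin_cases c <;> rfl

lemma LL_map (j : Fin 22) (p : Fin 12 → ℤ) :
    LL j (fun c => (p c : k)) = (LL j p).map (fun e : ℤ => (e : k)) := by
  fin_cases j
  exacts [MA1 p, (congrArg LA1 (tr_cast p)).trans (MA1 _), MA3 p, MA4 p, (congrArg LA4 (tr_cast p)).trans (MA4 _), MB1 p, MB2 p, MB3 p, MB4 p, MB5 p, (congrArg LB1 (tr_cast p)).trans (MB1 _), (congrArg LB2 (tr_cast p)).trans (MB2 _), (congrArg LB3 (tr_cast p)).trans (MB3 _), (congrArg LB4 (tr_cast p)).trans (MB4 _), (congrArg LB5 (tr_cast p)).trans (MB5 _), MD1 p, MD2 p, MD3 p, (congrArg LD1 (tr_cast p)).trans (MD1 _), (congrArg LD2 (tr_cast p)).trans (MD2 _), (congrArg LD3 (tr_cast p)).trans (MD3 _), MJ1 p]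

lemma ZL_map [CharZero k] (l : List ℤ) : ZL (l.map (fun e : ℤ => (e : k))) ↔ ZL l := by
  simp [ZL]

lemma PP_test : ∀ i j : Fin 22, ((LL j (PP i)).all (fun e => e == 0)) = decide (j = i) := by
  decide +kernel

lemma PP_spec [CharZero k] (i j : Fin 22) : ZL (LL j (fun c => (PP i c : k))) ↔ j = i := by
  rw [LL_map, ZL_map]
  have := PP_test i j
  rw [← decide_eq_true_iff (p := j = i), ← this]
  simp [ZL]

lemma sc_jet (x0 x1 y0 y1 : k) (h0 : x0 * y0 = 0) (h1 : x0 * y1 + x1 * y0 = 0) :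
    (x0 = 0 ∧ x1 = 0) ∨ (y0 = 0 ∧ y1 = 0) ∨ (x0 = 0 ∧ y0 = 0) := by
  rcases mul_eq_zero.1 h0 with e | e
  · rw [e, zero_mul, zero_add] at h1
    rcases mul_eq_zero.1 h1 with e' | e'
    · exact Or.inl ⟨e, e'⟩
    · exact Or.inr (Or.inr ⟨e, e'⟩)
  · rw [e, mul_zero, add_zero] at h1
    rcases mul_eq_zero.1 h1 with e' | e'
    · exact Or.inr (Or.inr ⟨e', e⟩)
    · exact Or.inr (Or.inl ⟨e, e'⟩)

lemma sc_B (a0 a1 b0 b1 f0 f1 g0 g1 h0 h1 i0 i1 : k)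
    (h : E12 a0 a1 b0 b1 f0 f1 g0 g1 h0 h1 i0 i1) (hb : b0 ≠ 0) :
    (a0 = 0 ∧ a1 = 0 ∧ f0 = 0 ∧ f1 = 0 ∧ g0 = 0 ∧ g1 = 0) ∨
    (a0 = 0 ∧ a1 = 0 ∧ f0 = 0 ∧ f1 = 0 ∧ i0 = 0 ∧ i1 = 0) ∨
    (a0 = 0 ∧ a1 = 0 ∧ f0 = 0 ∧ f1 = 0 ∧ g0 = 0 ∧ i0 = 0) ∨
    (a0 = 0 ∧ a1 = 0 ∧ h0 = 0 ∧ h1 = 0 ∧ i0 = 0 ∧ i1 = 0) ∨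
    (a0 = 0 ∧ a1 = 0 ∧ i0 = 0 ∧ i1 = 0 ∧ f0 = 0 ∧ h0 = 0) := by
  obtain ⟨q0, q1, r0, r1, r2, r3⟩ := h
  have ha0 : a0 = 0 := (mul_eq_zero.1 q0).resolve_right hb
  subst ha0
  have ha1 : a1 = 0 := (mul_eq_zero.1 (by linear_combination q1)).resolve_right hb
  subst ha1
  have s0 : f0 * i0 = 0 :=
    (mul_eq_zero.1 (by linear_combination -r0 : b0 * (f0 * i0) = 0)).resolve_left hb
  have s1 : f0 * i1 + f1 * i0 = 0 := (mul_eq_zero.1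
    (by linear_combination -r1 - b1 * s0 : b0 * (f0 * i1 + f1 * i0) = 0)).resolve_left hb
  have s2 : f0 * h0 + g0 * i0 - b0 * (f1 * i1) = 0 := by linear_combination r2 + b1 * s1
  have key : (f0 = 0 ∧ f1 = 0) ∨ (i0 = 0 ∧ i1 = 0) := by
    rcases sc_jet _ _ _ _ s0 s1 with e | e | ⟨e, e'⟩
    · exact Or.inl e
    · exact Or.inr e
    · subst e e'
      have : b0 * (f1 * i1) = 0 := by linear_combination -s2
      rcases mul_eq_zero.1 ((mul_eq_zero.1 this).resolve_left hb) with e | e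
      · exact Or.inl ⟨rfl, e⟩
      · exact Or.inr ⟨rfl, e⟩
  rcases key with ⟨e, e'⟩ | ⟨e, e'⟩
  · subst e e'
    rcases sc_jet g0 g1 i0 i1 (by linear_combination s2) (by linear_combination r3) with
      ⟨e, e'⟩ | ⟨e, e'⟩ | ⟨e, e'⟩
    · exact Or.inl ⟨rfl, rfl, rfl, rfl, e, e'⟩
    · exact Or.inr (Or.inl ⟨rfl, rfl, rfl, rfl, e, e'⟩)
    · exact Or.inr (Or.inr (Or.inl ⟨rfl, rfl, rfl, rfl, e, e'⟩))
  · subst e e'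
    rcases sc_jet f0 f1 h0 h1 (by linear_combination s2) (by linear_combination r3) with
      ⟨e, e'⟩ | ⟨e, e'⟩ | ⟨e, e'⟩
    · exact Or.inr (Or.inl ⟨rfl, rfl, e, e', rfl, rfl⟩)
    · exact Or.inr (Or.inr (Or.inr (Or.inl ⟨rfl, rfl, e, e', rfl, rfl⟩)))
    · exact Or.inr (Or.inr (Or.inr (Or.inr ⟨rfl, rfl, rfl, rfl, e, e'⟩)))

lemma coverB (z : Fin 12 → k) (h : E12v z) (hb : z 2 ≠ 0) :
    ZL (LB1 z) ∨ ZL (LB2 z) ∨ ZL (LB3 z) ∨ ZL (LB4 z) ∨ ZL (LB5 z) := by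
  rw [WB1, WB2, WB3, WB4, WB5]
  exact sc_B _ _ _ _ _ _ _ _ _ _ _ _ h hb

lemma sc_A (a0 a1 b0 b1 f0 f1 g0 g1 h0 h1 i0 i1 : k)
    (h : E12 a0 a1 b0 b1 f0 f1 g0 g1 h0 h1 i0 i1) (ha : a0 = 0) (hb : b0 = 0) (ha1 : a1 ≠ 0)
    (hb1 : b1 ≠ 0) :
    (a0 = 0 ∧ b0 = 0 ∧ f0 = 0 ∧ f1 = 0 ∧ g0 = 0 ∧ g1 = 0) ∨
    (b0 = 0 ∧ a0 = 0 ∧ h0 = 0 ∧ h1 = 0 ∧ i0 = 0 ∧ i1 = 0) ∨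
    (a0 = 0 ∧ b0 = 0 ∧ f0 = 0 ∧ h0 = 0 ∧ g0 - b1 * f1 = 0 ∧ i0 - a1 * h1 = 0) ∨
    (a0 = 0 ∧ b0 = 0 ∧ f0 = 0 ∧ h0 = 0 ∧ g0 - b1 * f1 = 0 ∧ g1 = 0) ∨
    (b0 = 0 ∧ a0 = 0 ∧ h0 = 0 ∧ f0 = 0 ∧ i0 - a1 * h1 = 0 ∧ i1 = 0) := by
  obtain ⟨q0, q1, r0, r1, r2, r3⟩ := h
  subst ha hb
  have hab : a1 * b1 ≠ 0 := mul_ne_zero ha1 hb1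
  have s0 : f0 * h0 = 0 :=
    (mul_eq_zero.1 (by linear_combination r0 : (a1 * b1) * (f0 * h0) = 0)).resolve_left hab
  by_cases hf : f0 = 0
  · subst hf
    by_cases hh : h0 = 0
    · subst hh
      rcases sc_jet (g0 - b1 * f1) g1 (i0 - a1 * h1) i1 (by linear_combination r2)
        (by linear_combination r3) with ⟨e, e'⟩ | ⟨e, e'⟩ | ⟨e, e'⟩
      · exact Or.inr (Or.inr (Or.inr (Or.inl ⟨rfl, rfl, rfl, rfl, e, e'⟩)))
      · exact Or.inr (Or.inr (Or.inr (Or.inr ⟨rfl, rfl, rfl, rfl, e, e'⟩)))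
      · exact Or.inr (Or.inr (Or.inl ⟨rfl, rfl, rfl, rfl, e, e'⟩))
    · have e0 : b1 * f1 - g0 = 0 := (mul_eq_zero.1 (by linear_combination r1 :
        (a1 * h0) * (b1 * f1 - g0) = 0)).resolve_left (mul_ne_zero ha1 hh)
      have e1 : g1 = 0 := (mul_eq_zero.1 (by
        linear_combination -r2 + (a1 * h1 - i0) * e0 :
        (a1 * h0) * g1 = 0)).resolve_left (mul_ne_zero ha1 hh)
      subst e1
      have e2 : f1 = 0 := (mul_eq_zero.1 (by
        linear_combination r3 + i1 * e0 : h0 * f1 = 0)).resolve_left hh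
      subst e2
      exact Or.inl ⟨rfl, rfl, rfl, rfl, by linear_combination -e0, rfl⟩
  · have hh := (mul_eq_zero.1 s0).resolve_left hf
    subst hh
    have e0 : a1 * h1 - i0 = 0 := (mul_eq_zero.1 (by linear_combination r1 :
      (b1 * f0) * (a1 * h1 - i0) = 0)).resolve_left (mul_ne_zero hb1 hf)
    have e1 : i1 = 0 := (mul_eq_zero.1 (by
      linear_combination -r2 + (b1 * f1 - g0) * e0 :
      (b1 * f0) * i1 = 0)).resolve_left (mul_ne_zero hb1 hf)
    subst e1
    have e2 : h1 = 0 := (mul_eq_zero.1 (by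
      linear_combination r3 + g1 * e0 : f0 * h1 = 0)).resolve_left hf
    subst e2
    exact Or.inr (Or.inl ⟨rfl, rfl, rfl, rfl, by linear_combination -e0, rfl⟩)

lemma coverA (z : Fin 12 → k) (h : E12v z) (ha : z 0 = 0) (hb : z 2 = 0) (ha1 : z 1 ≠ 0)
    (hb1 : z 3 ≠ 0) : ZL (LA1 z) ∨ ZL (LA1 (Tr z)) ∨ ZL (LA3 z) ∨ ZL (LA4 z) ∨
      ZL (LA4 (Tr z)) := by
  rw [WA1, WA1, WA3, WA4, WA4]
  exact sc_A _ _ _ _ _ _ _ _ _ _ _ _ h ha hb ha1 hb1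

lemma sc_D (a0 a1 b0 b1 f0 f1 g0 g1 h0 h1 i0 i1 : k)
    (h : E12 a0 a1 b0 b1 f0 f1 g0 g1 h0 h1 i0 i1) (ha : a0 = 0) (ha1 : a1 = 0) (hb : b0 = 0)
    (hb1 : b1 ≠ 0) :
    (a0 = 0 ∧ a1 = 0 ∧ b0 = 0 ∧ f0 = 0 ∧ i0 = 0 ∧ f1 * h0 - i1 * (b1 * f1 - g0) = 0) ∨
    (a0 = 0 ∧ a1 = 0 ∧ b0 = 0 ∧ f0 = 0 ∧ g0 - b1 * f1 = 0 ∧ f1 * h0 + g1 * i0 = 0) ∨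
    (a0 = 0 ∧ a1 = 0 ∧ b0 = 0 ∧ i0 = 0 ∧ h0 - b1 * i1 = 0 ∧ f0 * h1 + g0 * i1 = 0) := by
  obtain ⟨q0, q1, r0, r1, r2, r3⟩ := h
  subst ha hb ha1
  have s0 : f0 * i0 = 0 :=
    (mul_eq_zero.1 (by linear_combination -r1 : b1 * (f0 * i0) = 0)).resolve_left hb1
  by_cases hf : f0 = 0
  · subst hf
    rcases mul_eq_zero.1 (by linear_combination r2 : i0 * (g0 - b1 * f1) = 0) with e | e
    · subst e
      exact Or.inl ⟨rfl, rfl, rfl, rfl, rfl, by linear_combination r3⟩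
    · exact Or.inr (Or.inl ⟨rfl, rfl, rfl, rfl, e, by linear_combination r3 - i1 * e⟩)
  · have hi := (mul_eq_zero.1 s0).resolve_left hf
    subst hi
    have e : h0 - b1 * i1 = 0 := (mul_eq_zero.1
      (by linear_combination r2 : f0 * (h0 - b1 * i1) = 0)).resolve_left hf
    exact Or.inr (Or.inr ⟨rfl, rfl, rfl, rfl, e, by linear_combination r3 - f1 * e⟩)

lemma coverD (z : Fin 12 → k) (h : E12v z) (ha : z 0 = 0) (ha1 : z 1 = 0) (hb : z 2 = 0)
    (hb1 : z 3 ≠ 0) : ZL (LD1 z) ∨ ZL (LD2 z) ∨ ZL (LD3 z) := by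
  rw [WD1, WD2, WD3]
  exact sc_D _ _ _ _ _ _ _ _ _ _ _ _ h ha ha1 hb hb1

lemma coverJ (z : Fin 12 → k) (h : E12v z) (ha : z 0 = 0) (ha1 : z 1 = 0) (hb : z 2 = 0)
    (hb1 : z 3 = 0) : ZL (LJ1 z) := by
  rw [WJ1]
  obtain ⟨q0, q1, r0, r1, r2, r3⟩ := h
  rw [ha1, hb1, ha, hb] at r2
  rw [ha1, hb1] at r3
  exact ⟨ha, ha1, hb, hb1, by linear_combination r2, by linear_combination r3⟩

lemma cover (z : Fin 12 → k) (h : E12v z) : ∃ j, ZL (LL j z) := by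
  by_cases hb : z 2 = 0
  · by_cases ha : z 0 = 0
    · by_cases ha1 : z 1 = 0
      · by_cases hb1 : z 3 = 0
        · exact ⟨21, coverJ z h ha ha1 hb hb1⟩
        · rcases coverD z h ha ha1 hb hb1 with e | e | e
          exacts [⟨15, e⟩, ⟨16, e⟩, ⟨17, e⟩]
      · by_cases hb1 : z 3 = 0
        · rcases coverD (Tr z) (tr_E z h) hb hb1 ha ha1 with e | e | e
          exacts [⟨18, e⟩, ⟨19, e⟩, ⟨20, e⟩]
        · rcases coverA z h ha hb ha1 hb1 with e | e | e | e | e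
          exacts [⟨0, e⟩, ⟨1, e⟩, ⟨2, e⟩, ⟨3, e⟩, ⟨4, e⟩]
    · rcases coverB (Tr z) (tr_E z h) ha with e | e | e | e | e
      exacts [⟨10, e⟩, ⟨11, e⟩, ⟨12, e⟩, ⟨13, e⟩, ⟨14, e⟩]
  · rcases coverB z h hb with e | e | e | e | e
    exacts [⟨5, e⟩, ⟨6, e⟩, ⟨7, e⟩, ⟨8, e⟩, ⟨9, e⟩]

lemma main_comp [CharZero k] [Infinite k] :
    irreducibleComponents (GTsYang k 3 2) = Set.range (fun j => (CC k j).S) ∧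
      Function.Injective (fun j => (CC k j).S) := by
  refine irrComp_of_cover _ (fun i => (CC k i).closed) (fun i => (CC k i).irr) (fun x => ?_)
    (fun i => ?_)
  · obtain ⟨j, hj⟩ := cover (Prj x.1) ((gts_iff x.1).1 x.2).1
    exact ⟨j, (CC_W j _).2 hj⟩
  · have hi := (CC_W i _).2 ((PP_spec (k := k) i i).2 rfl)
    refine ⟨⟨Emb (fun c => (PP i c : k)), ?_⟩, ?_, fun j hj => ?_⟩
    · rw [gts_iff, prj_emb]
      exact ⟨(CC k i).hE _ hi, rfl⟩
    · change (CC k i).W (Prj (Emb (fun c => (PP i c : k))))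
      rwa [prj_emb]
    · change (CC k j).W (Prj (Emb (fun c => (PP i c : k)))) at hj
      rw [prj_emb, CC_W, PP_spec] at hj
      exact hj

lemma main_all [CharZero k] :
    IsEquidimOfDim k (Fin 3 × Fin 3 × Fin 2) (GTsYang k 3 2) 6 ∧
    (zComponents k (Fin 3 × Fin 3 × Fin 2) (GTsYang k 3 2)).ncard = 22 := by
  have : Infinite k := CharZero.infinite k
  obtain ⟨h1, h2⟩ := main_comp (k := k)
  have h3 : zComponents k (Fin 3 × Fin 3 × Fin 2) (GTsYang k 3 2) =
    Set.range (fun j => (CC k j).S) := h1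
  constructor
  · intro C hC
    rw [h3] at hC
    obtain ⟨j, rfl⟩ := hC
    exact (CC k j).dim
  · rw [h3, ← Set.image_univ, Set.ncard_image_of_injective _ h2, Set.ncard_univ, Nat.card_fin]

end ZTop
/-- The Gelfand–Tsetlin variety for the restricted Yangian `Y₂(gl₃)` is equidimensional of
dimension `6`, and it has exactly `22` irreducible components. -/
theorem GTsYang_gl3_level2 (k : Type*) [Field k] [IsAlgClosed k] [CharZero k] :
    IsEquidimOfDim k (Fin 3 × Fin 3 × Fin 2) (GTsYang k 3 2) 6 ∧
    (zComponents k (Fin 3 × Fin 3 × Fin 2) (GTsYang k 3 2)).ncard = 22 := by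
  exact main_all

end
end

section
/- The Gelfand–Tsetlin variety GTs for the restricted Yangian Y_p(gl_n) satisfies GTs = GTs_1 ∪ GTs_2 ∪ ⋯ ∪ GTs_{p+1}, where GTs_1 := Z({p_{1j}, p_{2j} : 1 ≤ j ≤ p} ∪ {X_{12}^{(t)} : 1 ≤ t ≤ p} ∪ {p_{mj} : 3 ≤ m ≤ n, 1 ≤ j ≤ mp}); for 2 ≤ s ≤ p, GTs_s := Z({p_{1j}, p_{2j} : 1 ≤ j ≤ p} ∪ {X_{12}^{(t)} : s ≤ t ≤ p} ∪ {X_{21}^{(t)} : p−s+2 ≤ t ≤ p} ∪ {p_{mj} : 3 ≤ m ≤ n, 1 ≤ j ≤ mp}); and GTs_{p+1} := Z({p_{1j}, p_{2j} : 1 ≤ j ≤ p} ∪ {X_{21}^{(t)} : 1 ≤ t ≤ p} ∪ {p_{mj} : 3 ≤ m ≤ n, 1 ≤ j ≤ mp}). Here Z(F) denotes the common zero set in k^{n²p} of a family F of polynomials. -/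
open scoped Classical

noncomputable section



/-- Accessor for the coordinate `X_{ab}^{(t)}` of a point of `k^{n²p}`, with `1`-based
indices `a, b ∈ {1, …, n}` and `t ∈ {1, …, p}` (and value `0` out of range). -/
def xvn (k : Type*) [CommRing k] (n p : ℕ) (x : Fin n × Fin n × Fin p → k) (a b t : ℕ) : k :=
  if h : 1 ≤ a ∧ a ≤ n ∧ 1 ≤ b ∧ b ≤ n ∧ 1 ≤ t ∧ t ≤ p then
    x (⟨a - 1, by omega⟩, ⟨b - 1, by omega⟩, ⟨t - 1, by omega⟩) else 0

/-- The value of the polynomial `p_{1i} = X_{11}^{(i)}`. -/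
def P1v (k : Type*) [CommRing k] (n p : ℕ) (x : Fin n × Fin n × Fin p → k) (i : ℕ) : k :=
  xvn k n p x 1 1 i

/-- The value of the polynomial `p_{2i}` (for `1 ≤ i ≤ 2p`). -/
def P2v (k : Type*) [CommRing k] (n p : ℕ) (x : Fin n × Fin n × Fin p → k) (i : ℕ) : k :=
  if i ≤ p then
    xvn k n p x 2 2 i - ∑ t ∈ Finset.Icc 1 (i - 1), xvn k n p x 1 2 t * xvn k n p x 2 1 (i - t)
  else
    ∑ t ∈ Finset.Icc (i - p) p, xvn k n p x 1 2 t * xvn k n p x 2 1 (i - t)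

/-- The value of
`T(r,s,m) = −X_{13}^{(r)}X_{22}^{(s)}X_{31}^{(m)} + X_{12}^{(r)}X_{23}^{(s)}X_{31}^{(m)}
 + X_{13}^{(r)}X_{21}^{(s)}X_{32}^{(m)}`. -/
def Tv (k : Type*) [CommRing k] (n p : ℕ) (x : Fin n × Fin n × Fin p → k) (r s m : ℕ) : k :=
  -(xvn k n p x 1 3 r * xvn k n p x 2 2 s * xvn k n p x 3 1 m) +
    xvn k n p x 1 2 r * xvn k n p x 2 3 s * xvn k n p x 3 1 m +
    xvn k n p x 1 3 r * xvn k n p x 2 1 s * xvn k n p x 3 2 m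

/-- The value of the polynomial `p_{3i}` (for `1 ≤ i ≤ 3p`). -/
def P3v (k : Type*) [CommRing k] (n p : ℕ) (x : Fin n × Fin n × Fin p → k) (i : ℕ) : k :=
  if i ≤ p then
    xvn k n p x 3 3 i
      - ∑ s ∈ Finset.Icc 1 (i - 1),
          (xvn k n p x 1 3 s * xvn k n p x 3 1 (i - s) +
           xvn k n p x 2 3 s * xvn k n p x 3 2 (i - s))
      - ∑ r ∈ Finset.Icc 1 (i - 2), ∑ s ∈ Finset.Icc 2 (i - r - 1),
          xvn k n p x 1 3 r * xvn k n p x 2 2 s * xvn k n p x 3 1 (i - r - s)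
      + ∑ r ∈ Finset.Icc 1 (i - 2), ∑ s ∈ Finset.Icc 1 (i - r - 1),
          (xvn k n p x 1 2 r * xvn k n p x 2 3 s * xvn k n p x 3 1 (i - r - s) +
           xvn k n p x 1 3 r * xvn k n p x 2 1 s * xvn k n p x 3 2 (i - r - s))
  else if i = p + 1 then
    - ∑ s ∈ Finset.Icc 1 p,
          (xvn k n p x 1 3 s * xvn k n p x 3 1 (p + 1 - s) +
           xvn k n p x 2 3 s * xvn k n p x 3 2 (p + 1 - s))
      - ∑ r ∈ Finset.Icc 1 (p - 1), ∑ s ∈ Finset.Icc 2 (p - r),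
          xvn k n p x 1 3 r * xvn k n p x 2 2 s * xvn k n p x 3 1 (p + 1 - r - s)
      + ∑ r ∈ Finset.Icc 1 (p - 1), ∑ s ∈ Finset.Icc 1 (p - r),
          (xvn k n p x 1 2 r * xvn k n p x 2 3 s * xvn k n p x 3 1 (p + 1 - r - s) +
           xvn k n p x 1 3 r * xvn k n p x 2 1 s * xvn k n p x 3 2 (p + 1 - r - s))
  else if i ≤ 2 * p then
    - ∑ s ∈ Finset.Icc (i - p) p,
          (xvn k n p x 1 3 s * xvn k n p x 3 1 (i - s) +
           xvn k n p x 2 3 s * xvn k n p x 3 2 (i - s))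
      + ∑ r ∈ Finset.Icc 1 (i - p - 1), ∑ s ∈ Finset.Icc (i - p - r) p,
          Tv k n p x r s (i - r - s)
      + ∑ r ∈ Finset.Icc (i - p) p, ∑ s ∈ Finset.Icc 1 (i - r - 1),
          Tv k n p x r s (i - r - s)
  else
    ∑ r ∈ Finset.Icc (i - 2 * p) p, ∑ s ∈ Finset.Icc (i - p - r) p,
      Tv k n p x r s (i - r - s)


/-- The value of the polynomial `p_{mj}`: `p_{1j}, p_{2j}, p_{3j}` as above for `m ≤ 3`,
and `p_{mj} = d̄_{mj}` for `m ≥ 4`. -/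
def Pmv (k : Type*) [CommRing k] (n p : ℕ) (x : Fin n × Fin n × Fin p → k) (m j : ℕ) : k :=
  if m = 1 then P1v k n p x j
  else if m = 2 then P2v k n p x j
  else if m = 3 then P3v k n p x j
  else dbar k n p x m j

/-- The subvariety `GTs_s` (`1 ≤ s ≤ p+1`) of the Gelfand–Tsetlin variety for `Y_p(gl_n)`:
the common zero set of `p_{1j}, p_{2j}` (`1 ≤ j ≤ p`), the variables `X₁₂^{(t)}` for
`s ≤ t ≤ p` and `X₂₁^{(t)}` for `p−s+2 ≤ t ≤ p`, and the `p_{mj}` (`3 ≤ m ≤ n`,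
`1 ≤ j ≤ mp`).  (For `s = 1` the `X₂₁` conditions are vacuous, and for `s = p+1` the
`X₁₂` conditions are vacuous.) -/
def GTsPart (k : Type*) [CommRing k] (n p s : ℕ) : Set (Fin n × Fin n × Fin p → k) :=
  {x | (∀ j : ℕ, 1 ≤ j → j ≤ p → P1v k n p x j = 0) ∧
       (∀ j : ℕ, 1 ≤ j → j ≤ p → P2v k n p x j = 0) ∧
       (∀ t : ℕ, s ≤ t → t ≤ p → xvn k n p x 1 2 t = 0) ∧
       (∀ t : ℕ, p + 2 - s ≤ t → t ≤ p → xvn k n p x 2 1 t = 0) ∧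
       (∀ m j : ℕ, 3 ≤ m → m ≤ n → 1 ≤ j → j ≤ m * p → Pmv k n p x m j = 0)}

def gA (k : Type*) [CommRing k] (n p : ℕ) (x : Fin n × Fin n × Fin p → k) (a b : ℕ) :
    Polynomial k := ∑ t ∈ Finset.Icc 1 p, Polynomial.monomial t (xvn k n p x a b t)

theorem gx_zero (k : Type*) [CommRing k] (n p : ℕ) (x : Fin n × Fin n × Fin p → k) (a b t : ℕ)
    (h : t = 0 ∨ p < t) : xvn k n p x a b t = 0 := by
  unfold xvn
  rw [dif_neg]
  omega

theorem gA_coeff (k : Type*) [CommRing k] (n p : ℕ) (x : Fin n × Fin n × Fin p → k) (a b j : ℕ) :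
    (gA k n p x a b).coeff j = xvn k n p x a b j := by
  unfold gA
  simp only [Polynomial.finsetSum_coeff, Polynomial.coeff_monomial, Finset.sum_ite_eq',
    Finset.mem_Icc]
  split_ifs with h
  · rfl
  · rw [gx_zero]
    omega

theorem gA_deg (k : Type*) [CommRing k] (n p : ℕ) (x : Fin n × Fin n × Fin p → k) (a b : ℕ) :
    (gA k n p x a b).natDegree ≤ p := by
  rw [Polynomial.natDegree_le_iff_coeff_eq_zero]
  intro j hj
  rw [gA_coeff, gx_zero]
  omega

def gE (k : Type*) [CommRing k] (n p : ℕ) (x : Fin n × Fin n × Fin p → k) (a b : ℕ) :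
    Polynomial k := (if a = b then 1 else 0) + gA k n p x a b

theorem gE_deg (k : Type*) [CommRing k] (n p : ℕ) (x : Fin n × Fin n × Fin p → k) (a b : ℕ) :
    (gE k n p x a b).natDegree ≤ p := by
  unfold gE
  refine (Polynomial.natDegree_add_le _ _).trans (max_le ?_ (gA_deg ..))
  split_ifs <;> simp

theorem gXu (k : Type*) [CommRing k] (n p : ℕ) (x : Fin n × Fin n × Fin p → k)
    (m : ℕ) (hm : m ≤ n) (a b : Fin m) :
    Xu k n p x m hm a b = Polynomial.reflect p (gE k n p x (a + 1) (b + 1)) := by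
  unfold Xu gE gA
  have h1 : ∀ s : Finset ℕ, ∀ f : ℕ → Polynomial k,
      Polynomial.reflect p (∑ t ∈ s, f t) = ∑ t ∈ s, Polynomial.reflect p (f t) := by
    intro s f
    ext i
    simp [Polynomial.coeff_reflect]
  rw [Polynomial.reflect_add, h1, Matrix.of_apply]
  congr 1
  · by_cases h : (a : ℕ) = b
    · rw [if_pos h, if_pos (by omega)]
      simpa using (Polynomial.reflect_C (1 : k) p).symm
    · rw [if_neg h, if_neg (by omega)]
      simp
  · rw [← Finset.sum_subset_zero_on_sdiff (s₁ := Finset.Icc 1 p) (s₂ := Finset.Icc 1 p)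
      (f := fun t => Polynomial.reflect p (Polynomial.monomial t (xvn k n p x (a + 1) (b + 1) t)))
      (Finset.Subset.refl _) (by simp) (fun _ _ => rfl)]
    rw [← Finset.Ico_add_one_right_eq_Icc, Finset.sum_Ico_eq_sum_range,
      Nat.add_sub_cancel, Finset.sum_range]
    refine Finset.sum_congr rfl fun t _ => ?_
    rw [← Polynomial.C_mul_X_pow_eq_monomial, Polynomial.reflect_C_mul_X_pow,
      Polynomial.revAt_le (by omega)]
    congr 2
    · unfold xvn
      rw [dif_pos (by omega)]
      congr 3
      apply Fin.ext
      simp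
    · omega

theorem gc2 {k : Type*} [CommRing k] (p j : ℕ) (f g : Polynomial k) (hf : f.natDegree ≤ p)
    (hg : g.natDegree ≤ p) (hj : j ≤ 2 * p) :
    (Polynomial.reflect p f * Polynomial.reflect p g).coeff (2 * p - j) = (f * g).coeff j := by
  rw [← Polynomial.reflect_mul f g hf hg, Polynomial.coeff_reflect, Polynomial.revAt_le (by omega)]
  congr 1
  omega

theorem gc3 {k : Type*} [CommRing k] (p j : ℕ) (f g h : Polynomial k) (hf : f.natDegree ≤ p)
    (hg : g.natDegree ≤ p) (hh : h.natDegree ≤ p) (hj : j ≤ 3 * p) :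
    (Polynomial.reflect p f * Polynomial.reflect p g * Polynomial.reflect p h).coeff (3 * p - j)
      = (f * g * h).coeff j := by
  rw [← Polynomial.reflect_mul f g hf hg, ← Polynomial.reflect_mul (f * g) h
    (Polynomial.natDegree_mul_le.trans (by omega)) hh,
    Polynomial.coeff_reflect, Polynomial.revAt_le (by omega)]
  congr 1
  omega

theorem gd1 (k : Type*) [CommRing k] (n p : ℕ) (x : Fin n × Fin n × Fin p → k) (j : ℕ)
    (hn : 3 ≤ n) (h1 : 1 ≤ j) (hj : j ≤ 1 * p) : dbar k n p x 1 j = xvn k n p x 1 1 j := by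
  unfold dbar
  rw [dif_pos (by omega), Matrix.det_fin_one, gXu, Polynomial.coeff_reflect,
    Polynomial.revAt_le (by omega)]
  have : p - (1 * p - j) = j := by omega
  rw [this]
  simp [gE, gA_coeff, Polynomial.coeff_one]
  omega

theorem gd2 (k : Type*) [CommRing k] (n p : ℕ) (x : Fin n × Fin n × Fin p → k) (j : ℕ)
    (hn : 3 ≤ n) (hj : j ≤ 2 * p) : dbar k n p x 2 j =
      ((1 + gA k n p x 1 1) * (1 + gA k n p x 2 2) - gA k n p x 1 2 * gA k n p x 2 1).coeff j := by
  unfold dbar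
  rw [dif_pos (by omega), Matrix.det_fin_two]
  simp only [gXu]
  rw [Polynomial.coeff_sub, gc2 _ _ _ _ (gE_deg ..) (gE_deg ..) hj,
    gc2 _ _ _ _ (gE_deg ..) (gE_deg ..) hj]
  simp [gE]

theorem gd3 (k : Type*) [CommRing k] (n p : ℕ) (x : Fin n × Fin n × Fin p → k) (j : ℕ)
    (hn : 3 ≤ n) (hj : j ≤ 3 * p) (h11 : gA k n p x 1 1 = 0)
    (h22 : 1 + gA k n p x 2 2 - gA k n p x 1 2 * gA k n p x 2 1 = 1) : dbar k n p x 3 j =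
      (1 + gA k n p x 3 3 - (gA k n p x 1 3 * gA k n p x 3 1 + gA k n p x 2 3 * gA k n p x 3 2)
        - gA k n p x 1 3 * (gA k n p x 2 2 * gA k n p x 3 1)
        + (gA k n p x 1 2 * (gA k n p x 2 3 * gA k n p x 3 1)
        + gA k n p x 1 3 * (gA k n p x 2 1 * gA k n p x 3 2))).coeff j := by
  unfold dbar
  rw [dif_pos (by omega), Matrix.det_fin_three]
  simp only [gXu]
  simp only [Polynomial.coeff_sub, Polynomial.coeff_add (_ - _), Polynomial.coeff_add (_ + _)]
  simp only [Polynomial.coeff_sub, Polynomial.coeff_add, gc3 _ _ _ _ _ (gE_deg ..) (gE_deg ..) (gE_deg ..) hj]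
  simp only [← Polynomial.coeff_sub, ← Polynomial.coeff_add]
  congr 1
  simp [gE, h11]
  linear_combination (1 + gA k n p x 3 3) * h22

theorem gp2 {k : Type*} [CommRing k] (f g : Polynomial k) (i : ℕ) (S : Finset ℕ)
    (hS : ∀ r ∈ S, r ≤ i) (hz : ∀ r, r ≤ i → r ∉ S → f.coeff r * g.coeff (i - r) = 0) :
    (f * g).coeff i = ∑ r ∈ S, f.coeff r * g.coeff (i - r) := by
  rw [Polynomial.coeff_mul, Finset.Nat.sum_antidiagonal_eq_sum_range_succ
    (fun a b => f.coeff a * g.coeff b)]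
  symm
  apply Finset.sum_subset
  · intro r hr
    have := hS r hr
    simp
    omega
  · intro r hr hr'
    simp at hr
    exact hz r (by omega) hr'

theorem gp3 {k : Type*} [CommRing k] (f g h : Polynomial k) (i : ℕ) (S : Finset ℕ)
    (S' : ℕ → Finset ℕ)
    (hS : ∀ r ∈ S, ∀ s ∈ S' r, r + s ≤ i)
    (hz : ∀ r s, r + s ≤ i → (r ∈ S → s ∉ S' r) →
      f.coeff r * g.coeff s * h.coeff (i - r - s) = 0) :
    (f * (g * h)).coeff i =
      ∑ r ∈ S, ∑ s ∈ S' r, f.coeff r * g.coeff s * h.coeff (i - r - s) := by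
  rw [Polynomial.coeff_mul, Finset.Nat.sum_antidiagonal_eq_sum_range_succ
    (fun a b => f.coeff a * (g * h).coeff b)]
  simp only [Polynomial.coeff_mul]
  simp only [Finset.Nat.sum_antidiagonal_eq_sum_range_succ (fun a b => g.coeff a * h.coeff b),
    Finset.mul_sum, ← mul_assoc]
  rw [Finset.sum_sigma', Finset.sum_sigma']
  symm
  apply Finset.sum_subset
  · rintro ⟨r, s⟩ hr
    simp only [Finset.mem_sigma] at hr
    have := hS r hr.1 s hr.2
    simp
    omega
  · rintro ⟨r, s⟩ hr hr'
    simp only [Finset.mem_sigma, Finset.mem_range] at hr hr'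
    exact hz r s (by omega) (by tauto)

theorem gP2 (k : Type*) [CommRing k] (n p : ℕ) (x : Fin n × Fin n × Fin p → k) (j : ℕ)
    (h1 : 1 ≤ j) : P2v k n p x j =
      if j ≤ p then (1 + gA k n p x 2 2 - gA k n p x 1 2 * gA k n p x 2 1).coeff j
      else - (1 + gA k n p x 2 2 - gA k n p x 1 2 * gA k n p x 2 1).coeff j := by
  unfold P2v
  have h0 : (1 : Polynomial k).coeff j = 0 := by
    rw [Polynomial.coeff_one, if_neg]
    omega
  split_ifs with h
  · rw [Polynomial.coeff_sub, Polynomial.coeff_add, h0, zero_add, gA_coeff,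
      gp2 _ _ j (Finset.Icc 1 (j - 1))]
    · simp only [gA_coeff]
    · intro r hr
      simp at hr
      omega
    · intro r hr hr'
      simp only [Finset.mem_Icc] at hr'
      rw [gA_coeff, gA_coeff]
      by_cases h : r = 0
      · rw [gx_zero _ _ _ _ _ _ r (by omega), zero_mul]
      · rw [gx_zero _ _ _ _ _ _ (j - r) (by omega), mul_zero]
  · rw [Polynomial.coeff_sub, Polynomial.coeff_add, h0, zero_add, gA_coeff,
      gx_zero _ _ _ _ _ _ j (by omega), zero_sub, neg_neg,
      gp2 _ _ j (Finset.Icc (j - p) p)]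
    · simp only [gA_coeff]
    · intro r hr
      simp at hr
      omega
    · intro r hr hr'
      simp only [Finset.mem_Icc] at hr'
      rw [gA_coeff, gA_coeff]
      by_cases h : p < r
      · rw [gx_zero _ _ _ _ _ _ r (by omega), zero_mul]
      · rw [gx_zero _ _ _ _ _ _ (j - r) (by omega), mul_zero]

theorem gA2 (k : Type*) [CommRing k] (n p : ℕ) (x : Fin n × Fin n × Fin p → k)
    (a b c d i : ℕ) (S : Finset ℕ)
    (hS : ∀ r, r ∈ S ↔ (1 ≤ r ∧ r ≤ p ∧ r + 1 ≤ i ∧ i ≤ r + p)) :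
    ∑ r ∈ S, xvn k n p x a b r * xvn k n p x c d (i - r) =
      (gA k n p x a b * gA k n p x c d).coeff i := by
  rw [gp2 _ _ i S]
  · simp only [gA_coeff]
  · intro r hr
    have := (hS r).1 hr
    omega
  · intro r hr hr'
    rw [hS] at hr'
    rw [gA_coeff, gA_coeff]
    by_cases h : r = 0 ∨ p < r
    · rw [gx_zero _ _ _ _ _ _ r h, zero_mul]
    · rw [gx_zero _ _ _ _ _ _ (i - r) (by omega), mul_zero]

theorem gA3 (k : Type*) [CommRing k] (n p : ℕ) (x : Fin n × Fin n × Fin p → k)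
    (a b c d e f i l : ℕ) (S : Finset ℕ) (S' : ℕ → Finset ℕ)
    (hl : ∀ s, 1 ≤ s → s < l → xvn k n p x c d s = 0)
    (hS : ∀ r s, (r ∈ S ∧ s ∈ S' r) → (r + s ≤ i))
    (hS' : ∀ r s, (1 ≤ r ∧ r ≤ p ∧ l ≤ s ∧ 1 ≤ s ∧ s ≤ p ∧ r + s + 1 ≤ i ∧ i ≤ r + s + p) →
      (r ∈ S ∧ s ∈ S' r)) :
    ∑ r ∈ S, ∑ s ∈ S' r, xvn k n p x a b r * xvn k n p x c d s * xvn k n p x e f (i - r - s) =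
      (gA k n p x a b * (gA k n p x c d * gA k n p x e f)).coeff i := by
  rw [gp3 _ _ _ i S S']
  · simp only [gA_coeff]
  · intro r hr s hs
    exact hS r s ⟨hr, hs⟩
  · intro r s hrs hz
    rw [gA_coeff, gA_coeff, gA_coeff]
    by_cases h : r = 0 ∨ p < r
    · rw [gx_zero _ _ _ _ _ _ r h, zero_mul, zero_mul]
    by_cases h2 : s = 0 ∨ p < s
    · rw [gx_zero _ _ _ _ _ _ s h2, mul_zero, zero_mul]
    by_cases h3 : s < l
    · rw [hl s (by omega) h3, mul_zero, zero_mul]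
    have := hS' r s
    rw [gx_zero _ _ _ _ _ _ (i - r - s), mul_zero]
    by_contra h4
    obtain ⟨h5, h6⟩ := this (by omega)
    exact hz h5 h6

theorem gP3 (k : Type*) [CommRing k] (n p : ℕ) (x : Fin n × Fin n × Fin p → k) (i : ℕ)
    (h1 : 1 ≤ i) (h21 : xvn k n p x 2 2 1 = 0) : P3v k n p x i =
      (1 + gA k n p x 3 3 - (gA k n p x 1 3 * gA k n p x 3 1 + gA k n p x 2 3 * gA k n p x 3 2)
        - gA k n p x 1 3 * (gA k n p x 2 2 * gA k n p x 3 1)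
        + (gA k n p x 1 2 * (gA k n p x 2 3 * gA k n p x 3 1)
        + gA k n p x 1 3 * (gA k n p x 2 1 * gA k n p x 3 2))).coeff i := by
  have hl1 : ∀ c d s, 1 ≤ s → s < 1 → xvn k n p x c d s = 0 := by
    intro c d s h h'
    omega
  have hl2 : ∀ s, 1 ≤ s → s < 2 → xvn k n p x 2 2 s = 0 := by
    intro s h h'
    have : s = 1 := by omega
    rw [this, h21]
  have h0 : (1 : Polynomial k).coeff i = 0 := by
    rw [Polynomial.coeff_one, if_neg]
    omega
  simp only [Polynomial.coeff_sub, Polynomial.coeff_add, h0, zero_add, gA_coeff]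
  unfold P3v
  split_ifs with ha hb hc
  · simp only [Finset.sum_add_distrib]
    rw [gA2, gA2, gA3 k n p x _ _ _ _ _ _ _ 2, gA3 k n p x _ _ _ _ _ _ _ 1, gA3 k n p x _ _ _ _ _ _ _ 1]
    all_goals first | exact hl2 | exact hl1 _ _ | (intros; simp only [Finset.mem_Icc] at *; omega)
  · subst hb
    rw [gx_zero _ _ _ _ 3 3 (p + 1) (by omega)]
    simp only [Finset.sum_add_distrib]
    rw [gA2, gA2, gA3 k n p x _ _ _ _ _ _ _ 2, gA3 k n p x _ _ _ _ _ _ _ 1, gA3 k n p x _ _ _ _ _ _ _ 1]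
    · ring
    all_goals first | exact hl2 | exact hl1 _ _ | (intros; simp only [Finset.mem_Icc] at *; omega)
  · rw [gx_zero _ _ _ _ 3 3 i (by omega), add_assoc]
    have hu : ∀ F : ℕ → ℕ → k, ∑ r ∈ Finset.Icc 1 (i - p - 1), ∑ s ∈ Finset.Icc (i - p - r) p, F r s
        + ∑ r ∈ Finset.Icc (i - p) p, ∑ s ∈ Finset.Icc 1 (i - r - 1), F r s =
        ∑ r ∈ Finset.Icc 1 p, ∑ s ∈ (if r ≤ i - p - 1 then Finset.Icc (i - p - r) p
          else Finset.Icc 1 (i - r - 1)), F r s := by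
      intro F
      have : Finset.Icc 1 p = Finset.Icc 1 (i - p - 1) ∪ Finset.Icc (i - p) p := by
        ext r
        simp only [Finset.mem_union, Finset.mem_Icc]
        omega
      rw [this, Finset.sum_union]
      · congr 1
        · refine Finset.sum_congr rfl fun r hr => ?_
          simp only [Finset.mem_Icc] at hr
          rw [if_pos (by omega)]
        · refine Finset.sum_congr rfl fun r hr => ?_
          simp only [Finset.mem_Icc] at hr
          rw [if_neg (by omega)]
      · rw [Finset.disjoint_left]
        intro r hr
        simp only [Finset.mem_Icc] at *
        omega
    rw [hu]
    unfold Tv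
    simp only [Finset.sum_add_distrib, Finset.sum_neg_distrib]
    rw [gA2, gA2, gA3 k n p x _ _ _ _ _ _ _ 1, gA3 k n p x _ _ _ _ _ _ _ 1, gA3 k n p x _ _ _ _ _ _ _ 1]
    · ring
    all_goals first | exact hl1 _ _ | (intros; simp only [Finset.mem_Icc] at *; omega) | (intro r s; split_ifs <;> simp only [Finset.mem_Icc] <;> omega)
  · rw [gx_zero _ _ _ _ 3 3 i (by omega)]
    have hv : ∀ a b c d, (gA k n p x a b * gA k n p x c d).coeff i = 0 := by
      intro a b c d
      apply Polynomial.coeff_eq_zero_of_natDegree_lt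
      have := gA_deg k n p x a b
      have := gA_deg k n p x c d
      refine lt_of_le_of_lt Polynomial.natDegree_mul_le ?_
      omega
    rw [hv, hv]
    unfold Tv
    simp only [Finset.sum_add_distrib, Finset.sum_neg_distrib]
    rw [gA3 k n p x _ _ _ _ _ _ _ 1, gA3 k n p x _ _ _ _ _ _ _ 1, gA3 k n p x _ _ _ _ _ _ _ 1]
    · ring
    all_goals first | exact hl1 _ _ | (intros; simp only [Finset.mem_Icc] at *; omega)

/-- degree-2 step -/
theorem gU (k : Type*) [CommRing k] (n p : ℕ) (x : Fin n × Fin n × Fin p → k)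
    (h : ∀ j, 1 ≤ j → j ≤ 2 * p → P2v k n p x j = 0) :
    1 + gA k n p x 2 2 - gA k n p x 1 2 * gA k n p x 2 1 = 1 := by
  ext j
  rcases Nat.eq_zero_or_pos j with rfl | hj
  · simp [Polynomial.mul_coeff_zero, gA_coeff, gx_zero]
  rw [Polynomial.coeff_one, if_neg (by omega)]
  by_cases h2 : j ≤ 2 * p
  · have := h j hj h2
    rw [gP2 _ _ _ _ _ hj] at this
    split_ifs at this
    · exact this
    · exact neg_eq_zero.1 this
  · apply Polynomial.coeff_eq_zero_of_natDegree_lt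
    have := gA_deg k n p x 1 2
    have := gA_deg k n p x 2 1
    have := gA_deg k n p x 2 2
    have h3 : (gA k n p x 1 2 * gA k n p x 2 1).natDegree ≤ 2 * p :=
      Polynomial.natDegree_mul_le.trans (by omega)
    have h4 : (1 + gA k n p x 2 2).natDegree ≤ 2 * p :=
      (Polynomial.natDegree_add_le _ _).trans (by simp; omega)
    have := (Polynomial.natDegree_sub_le (1 + gA k n p x 2 2) (gA k n p x 1 2 * gA k n p x 2 1))
    have := max_le h4 h3
    omega

theorem gMem (k : Type*) [CommRing k] (n p : ℕ) (hn : 3 ≤ n) (hp : 1 ≤ p)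
    (x : Fin n × Fin n × Fin p → k) :
    x ∈ GTsYang k n p ↔ (∀ j : ℕ, 1 ≤ j → j ≤ p → P1v k n p x j = 0) ∧
       (∀ j : ℕ, 1 ≤ j → j ≤ 2 * p → P2v k n p x j = 0) ∧
       (∀ m j : ℕ, 3 ≤ m → m ≤ n → 1 ≤ j → j ≤ m * p → Pmv k n p x m j = 0) := by
  have key1 : (∀ j : ℕ, 1 ≤ j → j ≤ p → P1v k n p x j = 0) → gA k n p x 1 1 = 0 := by
    intro h
    ext j
    rw [gA_coeff, Polynomial.coeff_zero]
    by_cases hj : 1 ≤ j ∧ j ≤ p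
    · exact h j hj.1 hj.2
    · exact gx_zero _ _ _ _ _ _ _ (by omega)
  have key2 : gA k n p x 1 1 = 0 → ∀ j, 1 ≤ j → j ≤ 2 * p →
      (dbar k n p x 2 j = 0 ↔ P2v k n p x j = 0) := by
    intro h j h1 h2
    rw [gd2 _ _ _ _ _ hn h2, gP2 _ _ _ _ _ h1, h, add_zero, one_mul]
    split_ifs
    · rfl
    · rw [neg_eq_zero]
  have key3 : gA k n p x 1 1 = 0 → (∀ j : ℕ, 1 ≤ j → j ≤ 2 * p → P2v k n p x j = 0) →
      ∀ m j : ℕ, 3 ≤ m → 1 ≤ j → j ≤ m * p → dbar k n p x m j = Pmv k n p x m j := by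
    intro h h2 m j hm h1 hj
    unfold Pmv
    rw [if_neg (by omega), if_neg (by omega)]
    split_ifs with h3
    · subst h3
      rw [gd3 _ _ _ _ _ hn hj h (gU _ _ _ _ h2), gP3 _ _ _ _ _ h1]
      have := h2 1 le_rfl (by omega)
      simpa [P2v, hp] using this
    · rfl
  constructor
  · intro h
    have h1 : ∀ j : ℕ, 1 ≤ j → j ≤ p → P1v k n p x j = 0 := by
      intro j hj hj'
      rw [P1v, ← gd1 _ _ _ _ _ hn hj (by omega)]
      exact h 1 j le_rfl (by omega) hj (by omega)
    have h2 : ∀ j : ℕ, 1 ≤ j → j ≤ 2 * p → P2v k n p x j = 0 := fun j hj hj' =>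
      (key2 (key1 h1) j hj hj').1 (h 2 j (by omega) (by omega) hj hj')
    refine ⟨h1, h2, fun m j hm hmn hj hj' => ?_⟩
    rw [← key3 (key1 h1) h2 m j hm hj hj']
    exact h m j (by omega) hmn hj hj'
  · rintro ⟨h1, h2, h3⟩ m j hm hmn hj hj'
    by_cases hm1 : m = 1
    · subst hm1
      rw [gd1 _ _ _ _ _ hn hj hj']
      exact h1 j hj (by omega)
    by_cases hm2 : m = 2
    · subst hm2
      exact (key2 (key1 h1) j hj hj').2 (h2 j hj hj')
    rw [key3 (key1 h1) h2 m j (by omega) hj hj']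
    exact h3 m j (by omega) hmn hj hj'

theorem gHi (k : Type*) [CommRing k] (n p : ℕ) (x : Fin n × Fin n × Fin p → k) (j : ℕ)
    (h : p < j) : P2v k n p x j = (gA k n p x 1 2 * gA k n p x 2 1).coeff j := by
  rw [gP2 _ _ _ _ _ (by omega), if_neg (by omega), Polynomial.coeff_sub, Polynomial.coeff_add,
    Polynomial.coeff_one, if_neg (by omega), gA_coeff, gx_zero _ _ _ _ _ _ j (by omega)]
  ring

/-- The Gelfand–Tsetlin variety for the restricted Yangian `Y_p(gl_n)` decomposes as
`GTs = GTs₁ ∪ GTs₂ ∪ ⋯ ∪ GTs_{p+1}`. -/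
theorem GTsYang_decomposition (k : Type*) [Field k] [IsAlgClosed k] [CharZero k]
    (n p : ℕ) (hn : 3 ≤ n) (hp : 1 ≤ p) :
    GTsYang k n p = ⋃ s ∈ Set.Icc 1 (p + 1), GTsPart k n p s := by
  ext x
  simp only [Set.mem_iUnion, Set.mem_Icc, exists_prop]
  rw [gMem k n p hn hp]
  constructor
  · rintro ⟨h1, h2, h3⟩
    have hd : (gA k n p x 1 2 * gA k n p x 2 1).natDegree ≤ p := by
      rw [Polynomial.natDegree_le_iff_coeff_eq_zero]
      intro j hj
      rw [← gHi _ _ _ _ _ hj]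
      by_cases hj2 : j ≤ 2 * p
      · exact h2 j (by omega) hj2
      · rw [gHi _ _ _ _ _ hj]
        apply Polynomial.coeff_eq_zero_of_natDegree_lt
        have := gA_deg k n p x 1 2
        have := gA_deg k n p x 2 1
        refine lt_of_le_of_lt Polynomial.natDegree_mul_le ?_
        omega
    have h2' : ∀ j : ℕ, 1 ≤ j → j ≤ p → P2v k n p x j = 0 := fun j h h' => h2 j h (by omega)
    by_cases ha : gA k n p x 1 2 = 0
    · refine ⟨1, ⟨by omega, by omega⟩, h1, h2', ?_, ?_, h3⟩
      · intro t _ _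
        rw [← gA_coeff, ha, Polynomial.coeff_zero]
      · intro t _ _
        omega
    by_cases hb : gA k n p x 2 1 = 0
    · refine ⟨p + 1, ⟨by omega, by omega⟩, h1, h2', ?_, ?_, h3⟩
      · intro t _ _
        omega
      · intro t _ _
        rw [← gA_coeff, hb, Polynomial.coeff_zero]
    rw [Polynomial.natDegree_mul ha hb] at hd
    refine ⟨(gA k n p x 1 2).natDegree + 1, ⟨by omega, by omega⟩, h1, h2', ?_, ?_, h3⟩
    · intro t _ _
      rw [← gA_coeff]
      exact Polynomial.coeff_eq_zero_of_natDegree_lt (by omega)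
    · intro t _ _
      rw [← gA_coeff]
      exact Polynomial.coeff_eq_zero_of_natDegree_lt (by omega)
  · rintro ⟨s, ⟨hs1, hs2⟩, h1, h2, ha, hb, h3⟩
    refine ⟨h1, fun j hj hj' => ?_, h3⟩
    by_cases hjp : j ≤ p
    · exact h2 j hj hjp
    rw [gHi _ _ _ _ _ (by omega)]
    apply Polynomial.coeff_eq_zero_of_natDegree_lt
    have hA : (gA k n p x 1 2).natDegree ≤ s - 1 := by
      rw [Polynomial.natDegree_le_iff_coeff_eq_zero]
      intro t ht
      rw [gA_coeff]
      by_cases h : t ≤ p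
      · exact ha t (by omega) h
      · exact gx_zero _ _ _ _ _ _ _ (by omega)
    have hB : (gA k n p x 2 1).natDegree ≤ p + 1 - s := by
      rw [Polynomial.natDegree_le_iff_coeff_eq_zero]
      intro t ht
      rw [gA_coeff]
      by_cases h : t ≤ p
      · exact hb t (by omega) h
      · exact gx_zero _ _ _ _ _ _ _ (by omega)
    refine lt_of_le_of_lt Polynomial.natDegree_mul_le ?_
    omega

end
end

section
/- For the restricted Yangian Y_p(gl_n): if p = 1 then GTs_1 = W_1 ∪ W_2; if p = 2 then GTs_1 = W_1 ∪ W_2 ∪ W_3; and if p ≥ 3 then GTs_1 = W^p ∪ W_1 ∪ W_2 ∪ W_3. -/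
open scoped Classical

noncomputable section



/-- Condition `W`: all the variables `X₁₁^{(t)}, X₁₂^{(t)}, X₂₂^{(t)}` (`1 ≤ t ≤ p`)
vanish at `x`. -/
def WZero (k : Type*) [CommRing k] (n p : ℕ) (x : Fin n × Fin n × Fin p → k) : Prop :=
  ∀ t : ℕ, 1 ≤ t → t ≤ p →
    xvn k n p x 1 1 t = 0 ∧ xvn k n p x 1 2 t = 0 ∧ xvn k n p x 2 2 t = 0

/-- Condition `D`: all the polynomials `p_{mj} = d̄_{mj}` (`4 ≤ m ≤ n`, `1 ≤ j ≤ mp`)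
vanish at `x` (vacuous when `n = 3`). -/
def DZero (k : Type*) [CommRing k] (n p : ℕ) (x : Fin n × Fin n × Fin p → k) : Prop :=
  ∀ m j : ℕ, 4 ≤ m → m ≤ n → 1 ≤ j → j ≤ m * p → dbar k n p x m j = 0

/-- Condition: `p_{3j}` vanishes at `x` for all `1 ≤ j ≤ J`. -/
def P3Zero (k : Type*) [CommRing k] (n p : ℕ) (x : Fin n × Fin n × Fin p → k) (J : ℕ) : Prop :=
  ∀ j : ℕ, 1 ≤ j → j ≤ J → P3v k n p x j = 0

/-- `GTs₁ = Z(W ∪ {p_{3j} : 1 ≤ j ≤ 3p} ∪ D)`. -/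
def GTs1 (k : Type*) [CommRing k] (n p : ℕ) : Set (Fin n × Fin n × Fin p → k) :=
  {x | WZero k n p x ∧ P3Zero k n p x (3 * p) ∧ DZero k n p x}

/-- `W^p = Z(W ∪ {p_{3j} : 1 ≤ j ≤ 3p−3} ∪ {X₃₂^{(p)}, X₂₁^{(p)}, X₁₃^{(p)}} ∪ D)`. -/
def Wtop (k : Type*) [CommRing k] (n p : ℕ) : Set (Fin n × Fin n × Fin p → k) :=
  {x | WZero k n p x ∧ P3Zero k n p x (3 * p - 3) ∧
       xvn k n p x 3 2 p = 0 ∧ xvn k n p x 2 1 p = 0 ∧ xvn k n p x 1 3 p = 0 ∧ DZero k n p x}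

/-- `W_{1s}` (`1 ≤ s ≤ p+1`): the zero set of `W`, `{p_{3j} : 1 ≤ j ≤ 2p}`,
`X₁₃^{(t)}` for `s ≤ t ≤ p`, `X₂₁^{(t)}` for `p−s+2 ≤ t ≤ p`, and `D`.
(For `s = 1` the `X₂₁` conditions are vacuous; for `s = p+1` the `X₁₃` conditions are
vacuous.) -/
def W1s (k : Type*) [CommRing k] (n p s : ℕ) : Set (Fin n × Fin n × Fin p → k) :=
  {x | WZero k n p x ∧ P3Zero k n p x (2 * p) ∧
       (∀ t : ℕ, s ≤ t → t ≤ p → xvn k n p x 1 3 t = 0) ∧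
       (∀ t : ℕ, p + 2 - s ≤ t → t ≤ p → xvn k n p x 2 1 t = 0) ∧ DZero k n p x}

/-- `W₁ = ⋃_{s=1}^{p+1} W_{1s}`. -/
def W1 (k : Type*) [CommRing k] (n p : ℕ) : Set (Fin n × Fin n × Fin p → k) :=
  ⋃ s ∈ Set.Icc 1 (p + 1), W1s k n p s

/-- `W_{2s}` (`2 ≤ s ≤ p+1`): the zero set of `W`, `{p_{3j} : 1 ≤ j ≤ 2p}`,
`X₂₁^{(t)}` for `s ≤ t ≤ p`, `X₃₂^{(t)}` for `p−s+2 ≤ t ≤ p`, and `D`.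
(For `s = p+1` the `X₂₁` conditions are vacuous.) -/
def W2s (k : Type*) [CommRing k] (n p s : ℕ) : Set (Fin n × Fin n × Fin p → k) :=
  {x | WZero k n p x ∧ P3Zero k n p x (2 * p) ∧
       (∀ t : ℕ, s ≤ t → t ≤ p → xvn k n p x 2 1 t = 0) ∧
       (∀ t : ℕ, p + 2 - s ≤ t → t ≤ p → xvn k n p x 3 2 t = 0) ∧ DZero k n p x}

/-- `W₂ = ⋃_{s=2}^{p+1} W_{2s}`. -/
def W2 (k : Type*) [CommRing k] (n p : ℕ) : Set (Fin n × Fin n × Fin p → k) :=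
  ⋃ s ∈ Set.Icc 2 (p + 1), W2s k n p s

/-- `W_{3s}` (`2 ≤ s ≤ p`): the zero set of `W`, `{p_{3j} : 1 ≤ j ≤ 2p}`,
`X₁₃^{(t)}` for `s ≤ t ≤ p`, `X₃₂^{(t)}` for `p−s+2 ≤ t ≤ p`, and `D`. -/
def W3s (k : Type*) [CommRing k] (n p s : ℕ) : Set (Fin n × Fin n × Fin p → k) :=
  {x | WZero k n p x ∧ P3Zero k n p x (2 * p) ∧
       (∀ t : ℕ, s ≤ t → t ≤ p → xvn k n p x 1 3 t = 0) ∧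
       (∀ t : ℕ, p + 2 - s ≤ t → t ≤ p → xvn k n p x 3 2 t = 0) ∧ DZero k n p x}

/-- `W₃ = ⋃_{s=2}^{p} W_{3s}`. -/
def W3 (k : Type*) [CommRing k] (n p : ℕ) : Set (Fin n × Fin n × Fin p → k) :=
  ⋃ s ∈ Set.Icc 2 p, W3s k n p s

theorem P3v_high (k : Type*) [CommRing k] (n p : ℕ) (x : Fin n × Fin n × Fin p → k)
    (hW : WZero k n p x) (hp : 1 ≤ p) (i : ℕ) (hi : 2 * p < i) :
    P3v k n p x i = ∑ r ∈ Finset.Icc (i - 2 * p) p, ∑ s ∈ Finset.Icc (i - p - r) p,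
      xvn k n p x 1 3 r * xvn k n p x 2 1 s * xvn k n p x 3 2 (i - r - s) := by
  unfold P3v
  rw [if_neg (by omega), if_neg (by omega), if_neg (by omega)]
  refine Finset.sum_congr rfl fun r hr => Finset.sum_congr rfl fun s hs => ?_
  rw [Finset.mem_Icc] at hr hs
  unfold Tv
  rw [(hW r (by omega) hr.2).2.1, (hW s (by omega) hs.2).2.2]
  ring

theorem P3v_high_zero (k : Type*) [CommRing k] (n p : ℕ) (x : Fin n × Fin n × Fin p → k)
    (hW : WZero k n p x) (hp : 1 ≤ p) (i : ℕ) (hi : 2 * p < i)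
    (h : ∀ r s m, r ≤ p → s ≤ p → m ≤ p → r + s + m = i →
      xvn k n p x 1 3 r = 0 ∨ xvn k n p x 2 1 s = 0 ∨ xvn k n p x 3 2 m = 0) :
    P3v k n p x i = 0 := by
  rw [P3v_high k n p x hW hp i hi]
  refine Finset.sum_eq_zero fun r hr => Finset.sum_eq_zero fun s hs => ?_
  rw [Finset.mem_Icc] at hr hs
  rcases h r s (i - r - s) (by omega) (by omega) (by omega) (by omega) with h | h | h <;> simp [h]

theorem exists_last {k : Type*} [CommRing k] (f : ℕ → k) (p : ℕ) :
    ∃ r ≤ p, (∀ t, r < t → t ≤ p → f t = 0) ∧ (r = 0 ∨ f r ≠ 0) := by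
  refine ⟨Nat.findGreatest (fun t => f t ≠ 0) p, Nat.findGreatest_le p, ?_, ?_⟩
  · intro t h1 h2
    by_contra h
    exact Nat.findGreatest_is_greatest h1 h2 h
  · by_cases h0 : Nat.findGreatest (fun t => f t ≠ 0) p = 0
    · exact Or.inl h0
    · exact Or.inr (Nat.findGreatest_of_ne_zero (P := fun t => f t ≠ 0) rfl h0)

theorem P3v_last (k : Type*) [Field k] (n p : ℕ) (x : Fin n × Fin n × Fin p → k)
    (hW : WZero k n p x) (hp : 1 ≤ p) (hP : P3Zero k n p x (3 * p)) (r₀ s₀ m₀ : ℕ)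
    (hr : r₀ ≤ p) (hs : s₀ ≤ p) (hm : m₀ ≤ p)
    (ha : ∀ t, r₀ < t → t ≤ p → xvn k n p x 1 3 t = 0)
    (hb : ∀ t, s₀ < t → t ≤ p → xvn k n p x 2 1 t = 0)
    (hc : ∀ t, m₀ < t → t ≤ p → xvn k n p x 3 2 t = 0)
    (ha' : xvn k n p x 1 3 r₀ ≠ 0) (hb' : xvn k n p x 2 1 s₀ ≠ 0)
    (hc' : xvn k n p x 3 2 m₀ ≠ 0) : r₀ + s₀ + m₀ ≤ 2 * p := by
  by_contra hlt
  have h := hP (r₀ + s₀ + m₀) (by omega) (by omega)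
  rw [P3v_high k n p x hW hp _ (by omega), Finset.sum_eq_single r₀, Finset.sum_eq_single s₀] at h
  · rw [show r₀ + s₀ + m₀ - r₀ - s₀ = m₀ by omega] at h
    exact mul_ne_zero (mul_ne_zero ha' hb') hc' h
  · intro s hs1 hne
    rw [Finset.mem_Icc] at hs1
    rcases lt_or_ge s₀ s with h1 | h1
    · simp [hb s h1 hs1.2]
    · simp [hc (r₀ + s₀ + m₀ - r₀ - s) (by omega) (by omega)]
  · intro h1
    exact absurd (Finset.mem_Icc.2 ⟨by omega, by omega⟩) h1
  · intro r hr1 hne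
    rw [Finset.mem_Icc] at hr1
    refine Finset.sum_eq_zero fun s hs1 => ?_
    rw [Finset.mem_Icc] at hs1
    rcases lt_or_ge r₀ r with h0 | h0
    · simp [ha r h0 hr1.2]
    rcases lt_or_ge s₀ s with h1 | h1
    · simp [hb s h1 hs1.2]
    · simp [hc (r₀ + s₀ + m₀ - r - s) (by omega) (by omega)]
  · intro h1
    exact absurd (Finset.mem_Icc.2 ⟨by omega, by omega⟩) h1

theorem GTs1_of (k : Type*) [CommRing k] (n p : ℕ) (x : Fin n × Fin n × Fin p → k) (hp : 1 ≤ p)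
    (J : ℕ) (hJ : 2 * p ≤ J) (hW : WZero k n p x) (hP : P3Zero k n p x J) (hD : DZero k n p x)
    (h : ∀ r s m, r ≤ p → s ≤ p → m ≤ p → J < r + s + m →
      xvn k n p x 1 3 r = 0 ∨ xvn k n p x 2 1 s = 0 ∨ xvn k n p x 3 2 m = 0) :
    x ∈ GTs1 k n p := by
  refine ⟨hW, fun j h1 h2 => ?_, hD⟩
  by_cases hj : j ≤ J
  · exact hP j h1 hj
  · exact P3v_high_zero k n p x hW hp j (by omega) fun r s m hr hs hm he =>
      h r s m hr hs hm (by omega)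

theorem W1_sub (k : Type*) [CommRing k] (n p : ℕ) (hp : 1 ≤ p) : W1 k n p ⊆ GTs1 k n p := by
  intro x hx
  simp only [W1, Set.mem_iUnion] at hx
  obtain ⟨s, hs, hW, hP, ha, hb, hD⟩ := hx
  refine GTs1_of k n p x hp _ le_rfl hW hP hD fun r t m hr ht hm hj => ?_
  by_cases h : s ≤ r
  · exact Or.inl (ha r h hr)
  · exact Or.inr (Or.inl (hb t (by omega) ht))

theorem W2_sub (k : Type*) [CommRing k] (n p : ℕ) (hp : 1 ≤ p) : W2 k n p ⊆ GTs1 k n p := by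
  intro x hx
  simp only [W2, Set.mem_iUnion] at hx
  obtain ⟨s, hs, hW, hP, ha, hb, hD⟩ := hx
  refine GTs1_of k n p x hp _ le_rfl hW hP hD fun r t m hr ht hm hj => ?_
  by_cases h : s ≤ t
  · exact Or.inr (Or.inl (ha t h ht))
  · exact Or.inr (Or.inr (hb m (by omega) hm))

theorem W3_sub (k : Type*) [CommRing k] (n p : ℕ) (hp : 1 ≤ p) : W3 k n p ⊆ GTs1 k n p := by
  intro x hx
  simp only [W3, Set.mem_iUnion] at hx
  obtain ⟨s, hs, hW, hP, ha, hb, hD⟩ := hx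
  refine GTs1_of k n p x hp _ le_rfl hW hP hD fun r t m hr ht hm hj => ?_
  by_cases h : s ≤ r
  · exact Or.inl (ha r h hr)
  · exact Or.inr (Or.inr (hb m (by omega) hm))

theorem Wtop_sub (k : Type*) [CommRing k] (n p : ℕ) (hp : 3 ≤ p) :
    Wtop k n p ⊆ GTs1 k n p := by
  rintro x ⟨hW, hP, hc, hb, ha, hD⟩
  refine GTs1_of k n p x (by omega) _ (by omega) hW hP hD fun r t m hr ht hm hj => ?_
  by_cases h : r = p
  · subst h; exact Or.inl ha
  by_cases h : t = p
  · subst h; exact Or.inr (Or.inl hb)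
  · obtain rfl : m = p := by omega
    exact Or.inr (Or.inr hc)

theorem GTs1_cases (k : Type*) [Field k] (n p : ℕ) (hp : 1 ≤ p) (x : Fin n × Fin n × Fin p → k)
    (hx : x ∈ GTs1 k n p) :
    x ∈ W1 k n p ∨ x ∈ W2 k n p ∨ (2 ≤ p ∧ x ∈ W3 k n p) ∨ (3 ≤ p ∧ x ∈ Wtop k n p) := by
  obtain ⟨hW, hP, hD⟩ := hx
  have hP2 : P3Zero k n p x (2 * p) := fun j h1 h2 => hP j h1 (by omega)
  obtain ⟨r, hr, ha, ha'⟩ := exists_last (xvn k n p x 1 3) p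
  obtain ⟨s, hs, hb, hb'⟩ := exists_last (xvn k n p x 2 1) p
  obtain ⟨m, hm, hc, hc'⟩ := exists_last (xvn k n p x 3 2) p
  have key : r = 0 ∨ s = 0 ∨ m = 0 ∨ r + s + m ≤ 2 * p := by
    rcases ha' with h | ha'
    · exact Or.inl h
    rcases hb' with h | hb'
    · exact Or.inr (Or.inl h)
    rcases hc' with h | hc'
    · exact Or.inr (Or.inr (Or.inl h))
    exact Or.inr (Or.inr (Or.inr (P3v_last k n p x hW hp hP r s m hr hs hm ha hb hc ha' hb' hc')))
  have c1 : r + s ≤ p → x ∈ W1 k n p := fun h => by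
    simp only [W1, Set.mem_iUnion]
    exact ⟨r + 1, ⟨by omega, by omega⟩, hW, hP2, fun t h1 h2 => ha t (by omega) h2,
      fun t h1 h2 => hb t (by omega) h2, hD⟩
  have c2 : 1 ≤ s → s + m ≤ p → x ∈ W2 k n p := fun h0 h => by
    simp only [W2, Set.mem_iUnion]
    exact ⟨s + 1, ⟨by omega, by omega⟩, hW, hP2, fun t h1 h2 => hb t (by omega) h2,
      fun t h1 h2 => hc t (by omega) h2, hD⟩
  have c3 : 1 ≤ r → r < p → r + m ≤ p → x ∈ W3 k n p := fun h0 h0' h => by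
    simp only [W3, Set.mem_iUnion]
    exact ⟨r + 1, ⟨by omega, by omega⟩, hW, hP2, fun t h1 h2 => ha t (by omega) h2,
      fun t h1 h2 => hc t (by omega) h2, hD⟩
  have c4 : r < p → s < p → m < p → x ∈ Wtop k n p := fun h1 h2 h3 =>
    ⟨hW, fun j h1 h2 => hP j h1 (by omega), hc p h3 le_rfl, hb p h2 le_rfl, ha p h1 le_rfl, hD⟩
  by_cases d1 : r + s ≤ p
  · exact Or.inl (c1 d1)
  by_cases d2 : s + m ≤ p
  · exact Or.inr (Or.inl (c2 (by omega) d2))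
  by_cases d3 : r < p ∧ r + m ≤ p
  · exact Or.inr (Or.inr (Or.inl ⟨by omega, c3 (by omega) d3.1 d3.2⟩))
  · exact Or.inr (Or.inr (Or.inr ⟨by omega, c4 (by omega) (by omega) (by omega)⟩))

/-- Decomposition of the first subvariety `GTs₁` for the restricted Yangian `Y_p(gl_n)`:
`GTs₁ = W₁ ∪ W₂` if `p = 1`; `GTs₁ = W₁ ∪ W₂ ∪ W₃` if `p = 2`; and
`GTs₁ = W^p ∪ W₁ ∪ W₂ ∪ W₃` if `p ≥ 3`. -/
theorem GTs1_first_decomposition (k : Type*) [Field k] [IsAlgClosed k] [CharZero k]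
    (n p : ℕ) (hn : 3 ≤ n) (hp : 1 ≤ p) :
    (p = 1 → GTs1 k n p = W1 k n p ∪ W2 k n p) ∧
    (p = 2 → GTs1 k n p = W1 k n p ∪ W2 k n p ∪ W3 k n p) ∧
    (3 ≤ p → GTs1 k n p = Wtop k n p ∪ W1 k n p ∪ W2 k n p ∪ W3 k n p) := by
  have h1 := W1_sub k n p hp
  have h2 := W2_sub k n p hp
  have h3 := W3_sub k n p hp
  refine ⟨fun h => ?_, fun h => ?_, fun h => ?_⟩
  · refine Set.Subset.antisymm (fun x hx => ?_) (Set.union_subset h1 h2)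
    rcases GTs1_cases k n p hp x hx with c | c | c | c
    · exact Or.inl c
    · exact Or.inr c
    · omega
    · omega
  · refine Set.Subset.antisymm (fun x hx => ?_) (Set.union_subset (Set.union_subset h1 h2) h3)
    rcases GTs1_cases k n p hp x hx with c | c | c | c
    · exact Or.inl (Or.inl c)
    · exact Or.inl (Or.inr c)
    · exact Or.inr c.2
    · omega
  · refine Set.Subset.antisymm (fun x hx => ?_)
      (Set.union_subset (Set.union_subset (Set.union_subset (Wtop_sub k n p h) h1) h2) h3)
    rcases GTs1_cases k n p hp x hx with c | c | c | c
    · exact Or.inl (Or.inl (Or.inr c))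
    · exact Or.inl (Or.inr c)
    · exact Or.inr c.2
    · exact Or.inl (Or.inl (Or.inl c.2))

end
end
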